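/- For the pinning model the contact fraction vanishes continuously at the critical point: limsup_{ε ↓ ε_c^p} limsup_{N→∞} (1/N) E^p_{ε,N}[ℓ_N] = 0; precisely, for every η > 0 there exists α > 0 such that for all ε ∈ (ε_c^p, ε_c^p + α], limsup_{N→∞} (1/N) E^p_{ε,N}[ℓ_N] ≤ η. -/

import Mathlib

open MeasureTheory Filter Topology Set
open scoped ENNReal NNReal BigOperators

noncomputable section

/-- The field `(φ_1, …, φ_{N-1})` extended to `ℤ` with zero boundary conditions
`φ_{-1} = φ_0 = φ_N = φ_{N+1} = 0`. -/
def fieldExt (N : ℕ) (φ : Fin (N - 1) → ℝ) (i : ℤ) : ℝ :=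
  if h : 0 < i ∧ i < (N : ℤ) then φ ⟨i.toNat - 1, by omega⟩ else 0

/-- `exp(−H_{[−1,N+1]}(φ))` with zero boundary conditions, where `E = exp(−V)` and
`H_{[a,b]}(φ) = ∑_{n=a+1}^{b-1} V(φ_{n+1} + φ_{n-1} - 2 φ_n)`. -/
def hamWeight (E : ℝ → ℝ) (N : ℕ) (φ : Fin (N - 1) → ℝ) : ℝ :=
  ∏ n ∈ Finset.Icc (0 : ℤ) (N : ℤ),
    E (fieldExt N φ (n + 1) + fieldExt N φ (n - 1) - 2 * fieldExt N φ n)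

/-- the single-site reference measure `ε δ_0(dx) + dx` of the pinning model -/
def pinFactor (ε : ℝ) : Measure ℝ :=
  ENNReal.ofReal ε • Measure.dirac 0 + volume

/-- the single-site reference measure `ε δ_0(dx) + dx 1_{(x ≥ 0)}` of the wetting model -/
def wetFactor (ε : ℝ) : Measure ℝ :=
  ENNReal.ofReal ε • Measure.dirac 0 + volume.restrict (Ici 0)

/-- the pinning partition function `Z^p_{ε,N}` -/
def Zpin (E : ℝ → ℝ) (ε : ℝ) (N : ℕ) : ℝ :=
  ∫ φ : Fin (N - 1) → ℝ, hamWeight E N φ ∂(Measure.pi fun _ => pinFactor ε)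

/-- the wetting partition function `Z^w_{ε,N}` -/
def Zwet (E : ℝ → ℝ) (ε : ℝ) (N : ℕ) : ℝ :=
  ∫ φ : Fin (N - 1) → ℝ, hamWeight E N φ ∂(Measure.pi fun _ => wetFactor ε)

/-- the pinning model `P^p_{ε,N}` -/
def Ppin (E : ℝ → ℝ) (ε : ℝ) (N : ℕ) : Measure (Fin (N - 1) → ℝ) :=
  (Measure.pi fun _ => pinFactor ε).withDensity
    fun φ => ENNReal.ofReal (hamWeight E N φ / Zpin E ε N)

/-- the wetting model `P^w_{ε,N}` -/
def Pwet (E : ℝ → ℝ) (ε : ℝ) (N : ℕ) : Measure (Fin (N - 1) → ℝ) :=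
  (Measure.pi fun _ => wetFactor ε).withDensity
    fun φ => ENNReal.ofReal (hamWeight E N φ / Zwet E ε N)

open scoped Classical in
/-- the contact number `ℓ_N(φ) = #{i ∈ {1,…,N} : φ_i = 0}` (with the convention `φ_N := 0`) -/
def contact (N : ℕ) (φ : Fin (N - 1) → ℝ) : ℕ :=
  ((Finset.Icc (1 : ℤ) (N : ℤ)).filter fun i => fieldExt N φ i = 0).card

/-- The sequence `a, b, φ 0, …, φ (m-1), 0, 0, …`. -/
def pathSeq (a b : ℝ) {m : ℕ} (φ : Fin m → ℝ) : ℕ → ℝ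
  | 0 => a
  | 1 => b
  | k + 2 => if h : k < m then φ ⟨k, h⟩ else 0

/-- Weight of a path with time dependent three-point kernel `W` and terminal factor `g`. -/
def pathWeight (W : ℕ → ℝ → ℝ → ℝ → ℝ≥0∞) (g : ℝ → ℝ≥0∞) {m : ℕ} (a b : ℝ)
    (φ : Fin m → ℝ) : ℝ≥0∞ :=
  (∏ n ∈ Finset.range (m + 1),
    W n (pathSeq a b φ n) (pathSeq a b φ (n + 1)) (pathSeq a b φ (n + 2))) *
    g (pathSeq a b φ (m + 1))

/-- Partition function of paths with kernel `W`, computed by the transfer recursion. -/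
def pathSum (g : ℝ → ℝ≥0∞) (μ : Measure ℝ) :
    ℕ → (ℕ → ℝ → ℝ → ℝ → ℝ≥0∞) → ℝ → ℝ → ℝ≥0∞
  | 0, W, a, b => W 0 a b 0 * g b
  | m + 1, W, a, b => ∫⁻ c, W 0 a b c * pathSum g μ m (fun n => W (n + 1)) b c ∂μ

lemma pathSeq_cons (a b c : ℝ) {m : ℕ} (φ : Fin m → ℝ) (n : ℕ) :
    pathSeq a b (Fin.cons c φ : Fin (m + 1) → ℝ) (n + 1) = pathSeq b c φ n := by
  match n with
  | 0 => rfl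
  | 1 => simp [pathSeq]
  | k + 2 =>
    simp only [pathSeq]
    by_cases h : k < m
    · rw [dif_pos (by omega), dif_pos h]
      exact Fin.cons_succ (α := fun _ => ℝ) c φ ⟨k, h⟩
    · rw [dif_neg (by omega), dif_neg h]

lemma pathWeight_cons (W : ℕ → ℝ → ℝ → ℝ → ℝ≥0∞) (g : ℝ → ℝ≥0∞) {m : ℕ} (a b c : ℝ)
    (φ : Fin m → ℝ) :
    pathWeight W g a b (Fin.cons c φ : Fin (m + 1) → ℝ) =
      W 0 a b c * pathWeight (fun n => W (n + 1)) g b c φ := by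
  unfold pathWeight
  rw [Finset.prod_range_succ']
  simp only [pathSeq_cons]
  have h0 : pathSeq a b (Fin.cons c φ : Fin (m + 1) → ℝ) 0 = a := rfl
  have h1 : pathSeq b c φ 0 = b := rfl
  have h2 : pathSeq b c φ 1 = c := rfl
  rw [h0, h1, h2]
  ring

lemma measurable_pathSeq (m n : ℕ) :
    Measurable fun p : ℝ × ℝ × (Fin m → ℝ) => pathSeq p.1 p.2.1 p.2.2 n := by
  match n with
  | 0 => exact measurable_fst
  | 1 => exact measurable_fst.comp measurable_snd
  | k + 2 =>
    simp only [pathSeq]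
    by_cases h : k < m
    · simp only [dif_pos h]
      fun_prop
    · simp only [dif_neg h]
      fun_prop

lemma measurable_pathSeq_field (a b : ℝ) (m n : ℕ) :
    Measurable fun φ : Fin m → ℝ => pathSeq a b φ n :=
  (measurable_pathSeq m n).comp (by fun_prop : Measurable fun φ : Fin m → ℝ => (a, b, φ))

lemma measurable_pathWeight {W : ℕ → ℝ → ℝ → ℝ → ℝ≥0∞} {g : ℝ → ℝ≥0∞}
    (hW : ∀ n, Measurable fun p : ℝ × ℝ × ℝ => W n p.1 p.2.1 p.2.2) (hg : Measurable g)
    (a b : ℝ) (m : ℕ) :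
    Measurable fun φ : Fin m → ℝ => pathWeight W g a b φ := by
  unfold pathWeight
  refine Measurable.mul ?_ (hg.comp (measurable_pathSeq_field a b m _))
  refine Finset.measurable_prod _ fun n _ => ?_
  exact (hW n).comp ((measurable_pathSeq_field a b m n).prodMk
    ((measurable_pathSeq_field a b m (n + 1)).prodMk (measurable_pathSeq_field a b m (n + 2))))

lemma lintegral_pathWeight (μ : Measure ℝ) [SigmaFinite μ] {g : ℝ → ℝ≥0∞} (hg : Measurable g)
    (m : ℕ) : ∀ {W : ℕ → ℝ → ℝ → ℝ → ℝ≥0∞},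
    (∀ n, Measurable fun p : ℝ × ℝ × ℝ => W n p.1 p.2.1 p.2.2) → ∀ a b : ℝ,
    ∫⁻ φ : Fin m → ℝ, pathWeight W g a b φ ∂(Measure.pi fun _ => μ) = pathSum g μ m W a b := by
  induction m with
  | zero =>
    intro W hW a b
    rw [Measure.pi_of_empty (fun _ : Fin 0 => μ) (fun i => i.elim0)]
    rw [lintegral_dirac]
    simp [pathWeight, pathSum, pathSeq]
  | succ m ih =>
    intro W hW a b
    have hmp := (measurePreserving_piFinSuccAbove (fun _ : Fin (m + 1) => μ) 0).symm
    rw [← hmp.lintegral_comp (measurable_pathWeight hW hg a b (m + 1))]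
    have hmeas : Measurable fun p : ℝ × (Fin m → ℝ) => pathWeight W g a b
        ((MeasurableEquiv.piFinSuccAbove (fun _ => ℝ) 0).symm p) :=
      (measurable_pathWeight hW hg a b (m + 1)).comp (MeasurableEquiv.measurable _)
    rw [lintegral_prod _ hmeas.aemeasurable]
    refine lintegral_congr fun c => ?_
    rw [← ih (fun n => hW (n + 1)) b c]
    rw [← lintegral_const_mul _ (measurable_pathWeight (fun n => hW (n + 1)) hg b c m)]
    refine lintegral_congr fun φ => ?_
    rw [← pathWeight_cons]
    congr 1
    exact Fin.insertNth_zero' c φ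

lemma measurable_pathSum {μ : Measure ℝ} [SigmaFinite μ] {g : ℝ → ℝ≥0∞} (hg : Measurable g)
    (m : ℕ) : ∀ {W : ℕ → ℝ → ℝ → ℝ → ℝ≥0∞},
    (∀ n, Measurable fun p : ℝ × ℝ × ℝ => W n p.1 p.2.1 p.2.2) →
    Measurable fun p : ℝ × ℝ => pathSum g μ m W p.1 p.2 := by
  induction m with
  | zero =>
    intro W hW
    simp only [pathSum]
    exact ((hW 0).comp (by fun_prop : Measurable fun p : ℝ × ℝ => (p.1, p.2, (0 : ℝ)))).mul
      (hg.comp measurable_snd)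
  | succ m ih =>
    intro W hW
    simp only [pathSum]
    refine Measurable.lintegral_prod_right'
      (f := fun q : (ℝ × ℝ) × ℝ => W 0 q.1.1 q.1.2 q.2 *
        pathSum g μ m (fun n => W (n + 1)) q.1.2 q.2) ?_
    refine Measurable.mul ?_ ?_
    · exact (hW 0).comp (by fun_prop : Measurable fun q : (ℝ × ℝ) × ℝ => (q.1.1, q.1.2, q.2))
    · exact (ih fun n => hW (n + 1)).comp
        (by fun_prop : Measurable fun q : (ℝ × ℝ) × ℝ => (q.1.2, q.2))

instance (ε : ℝ) : SigmaFinite (pinFactor ε) := by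
  have := Measure.smul_finite (Measure.dirac (0 : ℝ)) (ENNReal.ofReal_ne_top (r := ε))
  unfold pinFactor; infer_instance

/-- Bounded continuous probability densities which are positive at the origin. -/
structure IsBoundedDensity (E : ℝ → ℝ) (M : ℝ) : Prop where
  nonneg : ∀ x, 0 ≤ E x
  cont : Continuous E
  le : ∀ x, E x ≤ M
  pos : 0 < E 0
  int : Integrable E
  mass : ∫ x, E x = 1

/-- The weight of a triple of consecutive heights. -/
def lapWeight (E : ℝ → ℝ) (a b c : ℝ) : ℝ≥0∞ := ENNReal.ofReal (E (c + a - 2 * b))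

/-- The partition function of the pinning model as a transfer recursion. -/
def pinSum (E : ℝ → ℝ) (ε : ℝ) (m : ℕ) (a b : ℝ) : ℝ≥0∞ :=
  pathSum (fun x => ENNReal.ofReal (E x)) (pinFactor ε) m (fun _ => lapWeight E) a b

lemma lintegral_pinFactor (ε : ℝ) (f : ℝ → ℝ≥0∞) :
    ∫⁻ x, f x ∂(pinFactor ε) = ENNReal.ofReal ε * f 0 + ∫⁻ x, f x := by
  rw [pinFactor, lintegral_add_measure, lintegral_smul_measure, lintegral_dirac, smul_eq_mul]

namespace IsBoundedDensity

variable {E : ℝ → ℝ} {M : ℝ}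

lemma bound_pos (h : IsBoundedDensity E M) : 0 < M := h.pos.trans_le (h.le 0)

lemma lintegral_eq (h : IsBoundedDensity E M) : ∫⁻ x, ENNReal.ofReal (E x) = 1 := by
  rw [← ofReal_integral_eq_lintegral_ofReal h.int (Eventually.of_forall h.nonneg), h.mass,
    ENNReal.ofReal_one]

lemma lintegral_add_right (h : IsBoundedDensity E M) (a : ℝ) :
    ∫⁻ x, ENNReal.ofReal (E (x + a)) = 1 := by
  rw [lintegral_add_right_eq_self (fun x => ENNReal.ofReal (E x)), h.lintegral_eq]

lemma lintegral_lapWeight (h : IsBoundedDensity E M) (a b : ℝ) :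
    ∫⁻ c, lapWeight E a b c = 1 := by
  simp only [lapWeight, add_sub_assoc]
  exact h.lintegral_add_right _

lemma measurable (h : IsBoundedDensity E M) : Measurable E := h.cont.measurable

lemma measurable_ofReal (h : IsBoundedDensity E M) : Measurable fun x => ENNReal.ofReal (E x) :=
  h.measurable.ennreal_ofReal

lemma measurable_lapWeight (h : IsBoundedDensity E M) :
    Measurable fun p : ℝ × ℝ × ℝ => lapWeight E p.1 p.2.1 p.2.2 := by
  unfold lapWeight
  exact h.measurable_ofReal.comp (by fun_prop : Measurable fun p : ℝ × ℝ × ℝ =>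
    p.2.2 + p.1 - 2 * p.2.1)

lemma lapWeight_le (h : IsBoundedDensity E M) (a b c : ℝ) :
    lapWeight E a b c ≤ ENNReal.ofReal M := ENNReal.ofReal_le_ofReal (h.le _)

lemma pinSum_le (h : IsBoundedDensity E M) (ε : ℝ) (m : ℕ) (a b : ℝ) :
    pinSum E ε m a b ≤
      ENNReal.ofReal M ^ 2 * (ENNReal.ofReal ε * ENNReal.ofReal M + 1) ^ m := by
  induction m generalizing a b with
  | zero =>
    simp only [pinSum, pathSum, pow_zero, mul_one, sq]
    exact mul_le_mul' (h.lapWeight_le _ _ _) (ENNReal.ofReal_le_ofReal (h.le _))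
  | succ m ih =>
    simp only [pinSum, pathSum] at ih ⊢
    calc _ ≤ ∫⁻ c, lapWeight E a b c * (ENNReal.ofReal M ^ 2 *
          (ENNReal.ofReal ε * ENNReal.ofReal M + 1) ^ m) ∂(pinFactor ε) :=
          lintegral_mono fun c => mul_le_mul_right (ih b c) _
      _ = (∫⁻ c, lapWeight E a b c ∂(pinFactor ε)) * (ENNReal.ofReal M ^ 2 *
          (ENNReal.ofReal ε * ENNReal.ofReal M + 1) ^ m) := by
          rw [lintegral_mul_const]
          exact h.measurable_lapWeight.comp (by fun_prop : Measurable fun c : ℝ => (a, b, c))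
      _ ≤ (ENNReal.ofReal ε * ENNReal.ofReal M + 1) * (ENNReal.ofReal M ^ 2 *
          (ENNReal.ofReal ε * ENNReal.ofReal M + 1) ^ m) := by
          refine mul_le_mul_left ?_ _
          rw [lintegral_pinFactor, h.lintegral_lapWeight]
          gcongr
          exact h.lapWeight_le _ _ _
      _ = _ := by ring

lemma pinSum_lt_top (h : IsBoundedDensity E M) (ε : ℝ) (m : ℕ) (a b : ℝ) :
    pinSum E ε m a b < ∞ := by
  refine (h.pinSum_le ε m a b).trans_lt ?_
  finiteness

lemma pinSum_pos (h : IsBoundedDensity E M) {ε : ℝ} (hε : 0 < ε) (m : ℕ) :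
    0 < pinSum E ε m 0 0 := by
  have h0 : 0 < ENNReal.ofReal (E 0) := ENNReal.ofReal_pos.2 h.pos
  induction m with
  | zero =>
    simp only [pinSum, pathSum, lapWeight]
    norm_num
    exact h.pos
  | succ m ih =>
    simp only [pinSum, pathSum] at ih ⊢
    rw [lintegral_pinFactor]
    refine lt_of_lt_of_le ?_ le_self_add
    refine ENNReal.mul_pos (ENNReal.ofReal_pos.2 hε).ne' (mul_ne_zero ?_ ih.ne')
    simp only [lapWeight]
    norm_num
    exact h.pos

end IsBoundedDensity

lemma fieldExt_eq_pathSeq {m : ℕ} (φ : Fin (m + 1 - 1) → ℝ) (n : ℕ) :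
    fieldExt (m + 1) φ ((n : ℤ) - 1) = pathSeq 0 0 (m := m) φ n := by
  unfold fieldExt
  match n with
  | 0 => rw [dif_neg (by omega)]; rfl
  | 1 => rw [dif_neg (by omega)]; rfl
  | k + 2 =>
    simp only [pathSeq]
    by_cases hk : k < m
    · rw [dif_pos (by push_cast; omega), dif_pos hk]
      congr 2
      push_cast
      omega
    · rw [dif_neg (by push_cast; omega), dif_neg hk]

lemma hamWeight_eq_prod (E : ℝ → ℝ) {m : ℕ} (φ : Fin (m + 1 - 1) → ℝ) :
    hamWeight E (m + 1) φ = (∏ n ∈ Finset.range (m + 1),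
      E (pathSeq 0 0 (m := m) φ (n + 2) + pathSeq 0 0 (m := m) φ n -
        2 * pathSeq 0 0 (m := m) φ (n + 1))) * E (pathSeq 0 0 (m := m) φ (m + 1)) := by
  have hI : Finset.Icc (0 : ℤ) ((m + 1 : ℕ) : ℤ) =
      (Finset.range (m + 2)).map ⟨fun n : ℕ => (n : ℤ), Nat.cast_injective⟩ := by
    ext i
    simp only [Finset.mem_Icc, Finset.mem_map, Finset.mem_range, Function.Embedding.coeFn_mk]
    constructor
    · intro hi
      exact ⟨i.toNat, by omega, by omega⟩
    · rintro ⟨k, hk, rfl⟩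
      omega
  unfold hamWeight
  rw [hI, Finset.prod_map, Finset.prod_range_succ]
  simp only [Function.Embedding.coeFn_mk]
  have e1 : ∀ n : ℕ, fieldExt (m + 1) φ ((n : ℤ) + 1) = pathSeq 0 0 (m := m) φ (n + 2) := by
    intro n
    rw [← fieldExt_eq_pathSeq]; congr 1; push_cast; ring
  have e2 : ∀ n : ℕ, fieldExt (m + 1) φ (n : ℤ) = pathSeq 0 0 (m := m) φ (n + 1) := by
    intro n
    rw [← fieldExt_eq_pathSeq]; congr 1; push_cast; ring
  simp only [e1, e2, fieldExt_eq_pathSeq]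
  congr 2
  simp [pathSeq]

lemma ofReal_hamWeight {E : ℝ → ℝ} (hE : ∀ x, 0 ≤ E x) {m : ℕ} (φ : Fin (m + 1 - 1) → ℝ) :
    ENNReal.ofReal (hamWeight E (m + 1) φ) =
      pathWeight (fun _ => lapWeight E) (fun x => ENNReal.ofReal (E x)) 0 0 (m := m) φ := by
  rw [hamWeight_eq_prod, ENNReal.ofReal_mul (Finset.prod_nonneg fun _ _ => hE _),
    ENNReal.ofReal_prod_of_nonneg (fun _ _ => hE _)]
  rfl

lemma contact_eq_sum {m : ℕ} (φ : Fin (m + 1 - 1) → ℝ) :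
    contact (m + 1) φ =
      ∑ n ∈ Finset.range (m + 1), if pathSeq 0 0 (m := m) φ (n + 2) = 0 then 1 else 0 := by
  classical
  have hI : Finset.Icc (1 : ℤ) ((m + 1 : ℕ) : ℤ) =
      (Finset.range (m + 1)).image (fun n : ℕ => (n : ℤ) + 1) := by
    ext i
    simp only [Finset.mem_Icc, Finset.mem_image, Finset.mem_range]
    constructor
    · intro hi
      exact ⟨(i - 1).toNat, by omega, by omega⟩
    · rintro ⟨k, hk, rfl⟩
      omega
  have e1 : ∀ n : ℕ, fieldExt (m + 1) φ ((n : ℤ) + 1) = pathSeq 0 0 (m := m) φ (n + 2) := by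
    intro n
    rw [← fieldExt_eq_pathSeq]; congr 1; push_cast; ring
  unfold contact
  rw [Finset.card_filter, hI, Finset.sum_image (fun a _ b _ hab => by simpa using hab)]
  simp only [e1]

namespace IsBoundedDensity

variable {E : ℝ → ℝ} {M : ℝ}

lemma lintegral_hamWeight (h : IsBoundedDensity E M) (ε : ℝ) (m : ℕ) :
    ∫⁻ φ : Fin (m + 1 - 1) → ℝ, ENNReal.ofReal (hamWeight E (m + 1) φ)
      ∂(Measure.pi fun _ => pinFactor ε) = pinSum E ε m 0 0 := by
  rw [pinSum, ← lintegral_pathWeight _ h.measurable_ofReal m (fun _ => h.measurable_lapWeight)]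
  exact lintegral_congr fun φ => ofReal_hamWeight h.nonneg φ

lemma measurable_hamWeight (h : IsBoundedDensity E M) (m : ℕ) :
    Measurable fun φ : Fin (m + 1 - 1) → ℝ => hamWeight E (m + 1) φ := by
  simp only [hamWeight_eq_prod]
  refine Measurable.mul (Finset.measurable_prod _ fun n _ => ?_)
    (h.measurable.comp (measurable_pathSeq_field _ _ _ _))
  refine h.measurable.comp (Measurable.sub (Measurable.add ?_ ?_) (Measurable.const_mul ?_ 2)) <;>
    exact measurable_pathSeq_field _ _ _ _

lemma hamWeight_nonneg (h : IsBoundedDensity E M) (N : ℕ) (φ : Fin (N - 1) → ℝ) :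
    0 ≤ hamWeight E N φ := Finset.prod_nonneg fun _ _ => h.nonneg _

lemma Zpin_eq (h : IsBoundedDensity E M) (ε : ℝ) (m : ℕ) :
    Zpin E ε (m + 1) = (pinSum E ε m 0 0).toReal := by
  rw [Zpin, integral_eq_lintegral_of_nonneg_ae
    (Eventually.of_forall fun φ => h.hamWeight_nonneg _ φ)
    (h.measurable_hamWeight m).aestronglyMeasurable, h.lintegral_hamWeight]

lemma ofReal_Zpin (h : IsBoundedDensity E M) (ε : ℝ) (m : ℕ) :
    ENNReal.ofReal (Zpin E ε (m + 1)) = pinSum E ε m 0 0 := by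
  rw [h.Zpin_eq, ENNReal.ofReal_toReal (h.pinSum_lt_top ε m 0 0).ne]

lemma Zpin_pos (h : IsBoundedDensity E M) {ε : ℝ} (hε : 0 < ε) (m : ℕ) :
    0 < Zpin E ε (m + 1) := by
  rw [h.Zpin_eq]
  exact ENNReal.toReal_pos (h.pinSum_pos hε m).ne' (h.pinSum_lt_top ε m 0 0).ne

lemma Ppin_eq (h : IsBoundedDensity E M) {ε : ℝ} (hε : 0 < ε) (m : ℕ) :
    Ppin E ε (m + 1) = (ENNReal.ofReal (Zpin E ε (m + 1)))⁻¹ •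
      (Measure.pi fun _ => pinFactor ε).withDensity
        fun φ => ENNReal.ofReal (hamWeight E (m + 1) φ) := by
  rw [← withDensity_smul _ (h.measurable_hamWeight m).ennreal_ofReal, Ppin]
  congr 1
  funext φ
  rw [ENNReal.ofReal_div_of_pos (h.Zpin_pos hε m), Pi.smul_apply, smul_eq_mul, mul_comm,
    ENNReal.div_eq_inv_mul, mul_comm]

lemma lintegral_Ppin (h : IsBoundedDensity E M) {ε : ℝ} (hε : 0 < ε) (m : ℕ)
    {f : (Fin (m + 1 - 1) → ℝ) → ℝ≥0∞} (hf : Measurable f) :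
    ENNReal.ofReal (Zpin E ε (m + 1)) * ∫⁻ φ, f φ ∂(Ppin E ε (m + 1)) =
      ∫⁻ φ, ENNReal.ofReal (hamWeight E (m + 1) φ) * f φ ∂(Measure.pi fun _ => pinFactor ε) := by
  rw [h.Ppin_eq hε, lintegral_smul_measure, smul_eq_mul, ← mul_assoc,
    ENNReal.mul_inv_cancel (ENNReal.ofReal_pos.2 (h.Zpin_pos hε m)).ne' ENNReal.ofReal_ne_top,
    one_mul, lintegral_withDensity_eq_lintegral_mul _ (h.measurable_hamWeight m).ennreal_ofReal hf]
  rfl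

lemma isProbabilityMeasure_Ppin (h : IsBoundedDensity E M) {ε : ℝ} (hε : 0 < ε) (m : ℕ) :
    IsProbabilityMeasure (Ppin E ε (m + 1)) := by
  constructor
  have h1 := h.lintegral_Ppin hε m (f := fun _ => 1) measurable_const
  simp only [mul_one, lintegral_const, one_mul] at h1
  rw [h.lintegral_hamWeight, h.ofReal_Zpin] at h1
  have h2 := (h.pinSum_pos hε m).ne'
  have h3 := (h.pinSum_lt_top ε m 0 0).ne
  calc _ = (pinSum E ε m 0 0)⁻¹ * (pinSum E ε m 0 0 * Ppin E ε (m + 1) Set.univ) := by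
        rw [← mul_assoc, ENNReal.inv_mul_cancel h2 h3, one_mul]
    _ = 1 := by rw [h1, ENNReal.inv_mul_cancel h2 h3]

/-- Additive functionals of consecutive triples. -/
def _root_.pathFunctional (ξ : ℕ → ℝ → ℝ → ℝ → ℝ) {m : ℕ} (φ : Fin m → ℝ) : ℝ :=
  ∑ n ∈ Finset.range (m + 1),
    ξ n (pathSeq 0 0 φ n) (pathSeq 0 0 φ (n + 1)) (pathSeq 0 0 φ (n + 2))

lemma _root_.measurable_pathFunctional {ξ : ℕ → ℝ → ℝ → ℝ → ℝ}
    (hξ : ∀ n, Measurable fun p : ℝ × ℝ × ℝ => ξ n p.1 p.2.1 p.2.2) (m : ℕ) :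
    Measurable fun φ : Fin m → ℝ => pathFunctional ξ φ := by
  refine Finset.measurable_sum _ fun n _ => ?_
  exact (hξ n).comp ((measurable_pathSeq_field 0 0 m n).prodMk
    ((measurable_pathSeq_field 0 0 m (n + 1)).prodMk (measurable_pathSeq_field 0 0 m (n + 2))))

lemma _root_.abs_pathFunctional_le {ξ : ℕ → ℝ → ℝ → ℝ → ℝ} {C : ℝ}
    (hC : ∀ n a b c, |ξ n a b c| ≤ C) {m : ℕ} (φ : Fin m → ℝ) :
    |pathFunctional ξ φ| ≤ (m + 1) * C := by
  refine (Finset.abs_sum_le_sum_abs _ _).trans ?_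
  refine (Finset.sum_le_sum fun n _ => hC n _ _ _).trans ?_
  simp

lemma integrable_pathFunctional (h : IsBoundedDensity E M) {ε : ℝ} (hε : 0 < ε) (m : ℕ)
    {ξ : ℕ → ℝ → ℝ → ℝ → ℝ}
    (hξ : ∀ n, Measurable fun p : ℝ × ℝ × ℝ => ξ n p.1 p.2.1 p.2.2) {C : ℝ}
    (hC : ∀ n a b c, |ξ n a b c| ≤ C) :
    Integrable (fun φ => pathFunctional (m := m) ξ φ) (Ppin E ε (m + 1)) := by
  have := h.isProbabilityMeasure_Ppin hε m
  exact Integrable.of_bound (measurable_pathFunctional hξ m).aestronglyMeasurable ((m + 1) * C)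
    (Eventually.of_forall fun φ => abs_pathFunctional_le hC φ)

/-- Jensen's inequality: exponential tilts of the pinning model dominate. -/
lemma jensen (h : IsBoundedDensity E M) {ε : ℝ} (hε : 0 < ε) (m : ℕ)
    {ξ : ℕ → ℝ → ℝ → ℝ → ℝ}
    (hξ : ∀ n, Measurable fun p : ℝ × ℝ × ℝ => ξ n p.1 p.2.1 p.2.2) {C : ℝ}
    (hC : ∀ n a b c, |ξ n a b c| ≤ C) :
    ENNReal.ofReal (Zpin E ε (m + 1)) *
        ENNReal.ofReal (Real.exp (∫ φ, pathFunctional (m := m) ξ φ ∂(Ppin E ε (m + 1)))) ≤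
      pathSum (fun x => ENNReal.ofReal (E x)) (pinFactor ε) m
        (fun n a b c => lapWeight E a b c * ENNReal.ofReal (Real.exp (ξ n a b c))) 0 0 := by
  have := h.isProbabilityMeasure_Ppin hε m
  have hX := measurable_pathFunctional hξ m
  have hXi := h.integrable_pathFunctional hε m hξ hC
  have hexp : Integrable (fun φ => Real.exp (pathFunctional (m := m) ξ φ)) (Ppin E ε (m + 1)) := by
    refine Integrable.of_bound (hX.exp).aestronglyMeasurable (Real.exp ((m + 1) * C))
      (Eventually.of_forall fun φ => ?_)
    rw [Real.norm_eq_abs, Real.abs_exp]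
    exact Real.exp_le_exp.2 ((le_abs_self _).trans (abs_pathFunctional_le hC φ))
  have hj : Real.exp (∫ φ, pathFunctional (m := m) ξ φ ∂(Ppin E ε (m + 1))) ≤
      ∫ φ, Real.exp (pathFunctional (m := m) ξ φ) ∂(Ppin E ε (m + 1)) :=
    convexOn_exp.map_integral_le Real.continuous_exp.continuousOn isClosed_univ
      (Eventually.of_forall fun _ => Set.mem_univ _) hXi hexp
  calc _ ≤ ENNReal.ofReal (Zpin E ε (m + 1)) *
        ∫⁻ φ, ENNReal.ofReal (Real.exp (pathFunctional (m := m) ξ φ)) ∂(Ppin E ε (m + 1)) := by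
        refine mul_le_mul_right ?_ _
        exact (ENNReal.ofReal_le_ofReal hj).trans (ofReal_integral_eq_lintegral_ofReal hexp
          (Eventually.of_forall fun φ => (Real.exp_pos _).le)).le
    _ = _ := by
        rw [h.lintegral_Ppin hε m hX.exp.ennreal_ofReal, ← lintegral_pathWeight _
          h.measurable_ofReal m fun n => h.measurable_lapWeight.mul (hξ n).exp.ennreal_ofReal]
        refine lintegral_congr fun φ => ?_
        rw [ofReal_hamWeight h.nonneg, pathWeight, pathWeight, Finset.prod_mul_distrib,
          pathFunctional, Real.exp_sum, ENNReal.ofReal_prod_of_nonneg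
            (fun _ _ => (Real.exp_pos _).le)]
        ring

end IsBoundedDensity

lemma pathSum_pinFactor_tilt {g : ℝ → ℝ≥0∞} {ε ε' : ℝ} (hε : 0 < ε)
    (m : ℕ) : ∀ (U : ℕ → ℝ → ℝ → ℝ → ℝ≥0∞) (a b : ℝ),
    pathSum g (pinFactor ε) m
      (fun n a b c => U n a b c * ENNReal.ofReal (if c = 0 then ε' / ε else 1)) a b =
    ENNReal.ofReal (ε' / ε) * pathSum g (pinFactor ε') m U a b := by
  induction m with
  | zero =>
    intro U a b
    simp only [pathSum, if_true]
    ring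
  | succ m ih =>
    intro U a b
    simp only [pathSum]
    simp only [ih (fun n => U (n + 1)), lintegral_pinFactor]
    rw [mul_add, if_true]
    have hr : ENNReal.ofReal ε * ENNReal.ofReal (ε' / ε) = ENNReal.ofReal ε' := by
      rw [← ENNReal.ofReal_mul hε.le, mul_div_cancel₀ _ hε.ne']
    congr 1
    · rw [← hr]; ring
    · rw [← lintegral_const_mul' _ _ ENNReal.ofReal_ne_top]
      refine lintegral_congr_ae ?_
      filter_upwards [compl_mem_ae_iff.2 (measure_singleton (0 : ℝ))] with c hc
      rw [if_neg (fun h0 => hc (by simp [h0])), ENNReal.ofReal_one]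
      ring

namespace IsBoundedDensity

variable {E : ℝ → ℝ} {M : ℝ}

/-- Comparison of partition functions at two pinning strengths. -/
lemma contact_mul_log_le (h : IsBoundedDensity E M) {ε ε' : ℝ} (hε : 0 < ε) (hε' : 0 < ε')
    (m : ℕ) :
    Real.log (Zpin E ε (m + 1)) +
      (∫ φ, (contact (m + 1) φ : ℝ) ∂(Ppin E ε (m + 1))) * Real.log (ε' / ε) ≤
      Real.log (ε' / ε) + Real.log (Zpin E ε' (m + 1)) := by
  have hr : 0 < ε' / ε := div_pos hε' hε
  have key := h.jensen hε m (ξ := fun _ _ _ c => if c = 0 then Real.log (ε' / ε) else 0)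
    (fun n => Measurable.ite (measurableSet_eq_fun (by fun_prop) (by fun_prop))
      measurable_const measurable_const) (C := |Real.log (ε' / ε)|)
    (fun n a b c => by split_ifs <;> simp)
  have e1 : ∀ φ : Fin (m + 1 - 1) → ℝ, pathFunctional (m := m)
      (fun _ _ _ c => if c = 0 then Real.log (ε' / ε) else 0) φ =
      (contact (m + 1) φ : ℝ) * Real.log (ε' / ε) := by
    intro φ
    rw [contact_eq_sum, pathFunctional]
    push_cast
    rw [Finset.sum_mul]
    refine Finset.sum_congr rfl fun n _ => ?_
    split_ifs <;> simp
  have e2 : (fun (_ : ℕ) (a b c : ℝ) => lapWeight E a b c *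
      ENNReal.ofReal (Real.exp (if c = 0 then Real.log (ε' / ε) else 0))) =
      (fun (_ : ℕ) (a b c : ℝ) => lapWeight E a b c *
        ENNReal.ofReal (if c = 0 then ε' / ε else 1)) := by
    funext n a b c
    split_ifs
    · rw [Real.exp_log hr]
    · rw [Real.exp_zero]
  simp only [e1] at key
  rw [e2, pathSum_pinFactor_tilt hε, integral_mul_const] at key
  change _ ≤ _ * pinSum E ε' m 0 0 at key
  rw [← h.ofReal_Zpin, ← ENNReal.ofReal_mul (h.Zpin_pos hε m).le, ← ENNReal.ofReal_mul hr.le,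
    ENNReal.ofReal_le_ofReal_iff (mul_pos hr (h.Zpin_pos hε' m)).le] at key
  have := Real.log_le_log (mul_pos (h.Zpin_pos hε m) (Real.exp_pos _)) key
  rwa [Real.log_mul (h.Zpin_pos hε m).ne' (Real.exp_pos _).ne', Real.log_exp,
    Real.log_mul hr.ne' (h.Zpin_pos hε' m).ne'] at this

lemma integral_contact_nonneg (E : ℝ → ℝ) (ε : ℝ) (N : ℕ) :
    0 ≤ ∫ φ, (contact N φ : ℝ) ∂(Ppin E ε N) := integral_nonneg fun _ => Nat.cast_nonneg _

end IsBoundedDensity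

/-- The character `θ ↦ exp(2πiθ)`. -/
def unitChar (θ : ℝ) : ℂ := Complex.exp (((2 * Real.pi * θ : ℝ) : ℂ) * Complex.I)

lemma norm_unitChar (θ : ℝ) : ‖unitChar θ‖ = 1 := Complex.norm_exp_ofReal_mul_I _

lemma unitChar_add (x y : ℝ) : unitChar (x + y) = unitChar x * unitChar y := by
  rw [unitChar, unitChar, unitChar, ← Complex.exp_add]
  congr 1
  push_cast
  ring

lemma unitChar_zero : unitChar 0 = 1 := by simp [unitChar]

lemma continuous_unitChar : Continuous unitChar := by
  unfold unitChar
  fun_prop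

/-- The characteristic function of the density `E`, with the `2π` normalisation. -/
def densityChar (E : ℝ → ℝ) (v : ℝ) : ℂ := ∫ x, (E x : ℂ) * unitChar (v * x)

namespace IsBoundedDensity

variable {E : ℝ → ℝ} {M : ℝ}

lemma integrable_ofReal_mul_unitChar (h : IsBoundedDensity E M) (v : ℝ) :
    Integrable fun x => (E x : ℂ) * unitChar (v * x) := by
  refine Integrable.mul_bdd (c := 1) h.int.ofReal ?_ ?_
  · exact (continuous_unitChar.comp (by fun_prop)).aestronglyMeasurable
  · exact Eventually.of_forall fun x => (norm_unitChar _).le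

lemma continuous_densityChar (h : IsBoundedDensity E M) : Continuous (densityChar E) := by
  unfold densityChar
  refine continuous_of_dominated (bound := fun x => E x) (fun v => ?_) (fun v => ?_) h.int ?_
  · exact (h.integrable_ofReal_mul_unitChar v).aestronglyMeasurable
  · refine Eventually.of_forall fun x => ?_
    rw [norm_mul, norm_unitChar, mul_one, Complex.norm_real, Real.norm_eq_abs,
      abs_of_nonneg (h.nonneg x)]
  · refine Eventually.of_forall fun x => ?_
    exact continuous_const.mul (continuous_unitChar.comp (by fun_prop))

lemma norm_densityChar_le_one (h : IsBoundedDensity E M) (v : ℝ) : ‖densityChar E v‖ ≤ 1 := by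
  refine (norm_integral_le_integral_norm _).trans ?_
  simp only [norm_mul, norm_unitChar, mul_one, Complex.norm_real, Real.norm_eq_abs,
    abs_of_nonneg (h.nonneg _), h.mass, le_refl]

/-- Fourier transform of a translate of the density. -/
lemma integral_shift_mul_unitChar (_h : IsBoundedDensity E M) (d v : ℝ) :
    ∫ x, (E (x + d) : ℂ) * unitChar (v * x) = unitChar (-(v * d)) * densityChar E v := by
  rw [densityChar, ← integral_const_mul,
    ← integral_add_right_eq_self (fun x => unitChar (-(v * d)) * (↑(E x) * unitChar (v * x))) d]
  refine integral_congr_ae (Eventually.of_forall fun x => ?_)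
  dsimp only
  rw [mul_left_comm, ← unitChar_add]
  congr 2
  ring

end IsBoundedDensity

lemma one_sub_abs_sinc_ge (u : ℝ) : min (u ^ 2) 1 / 40 ≤ 1 - |Real.sinc u| := by
  have small : ∀ u : ℝ, 0 < u → u ≤ 1 → |Real.sinc u| ≤ 1 - u ^ 2 / 10 := by
    intro u hu hu1
    have hs := Real.sin_bound (x := u) (by rw [abs_of_pos hu]; exact hu1)
    rw [abs_of_pos hu] at hs
    have hs' := (abs_le.1 hs).2
    have h4 : u ^ 4 ≤ u ^ 3 := pow_le_pow_of_le_one hu.le hu1 (by norm_num)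
    have hpos : 0 ≤ Real.sin u := Real.sin_nonneg_of_nonneg_of_le_pi hu.le
      (by linarith [Real.pi_gt_three])
    rw [Real.sinc_of_ne_zero hu.ne', abs_of_nonneg (div_nonneg hpos hu.le), div_le_iff₀ hu]
    have : 0 ≤ u ^ 3 := by positivity
    nlinarith
  have pos : ∀ u : ℝ, 0 < u → min (u ^ 2) 1 / 40 ≤ 1 - |Real.sinc u| := by
    intro u hu
    rcases le_total u 1 with h1 | h1
    · have := small u hu h1
      have : min (u ^ 2) 1 ≤ u ^ 2 := min_le_left _ _
      nlinarith [sq_nonneg u]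
    · have hm : min (u ^ 2) 1 ≤ 1 := min_le_right _ _
      rcases le_total u 2 with h2 | h2
      · have h3 := small (u / 2) (by linarith) (by linarith)
        have h4 : |Real.sinc u| ≤ |Real.sinc (u / 2)| := by
          rw [Real.sinc_of_ne_zero hu.ne', Real.sinc_of_ne_zero (by positivity)]
          have : Real.sin u / u = Real.sin (u / 2) / (u / 2) * Real.cos (u / 2) := by
            have := Real.sin_two_mul (u / 2)
            rw [mul_div_cancel₀ _ (two_ne_zero)] at this
            rw [this]; field_simp
          rw [this, abs_mul]
          exact mul_le_of_le_one_right (abs_nonneg _) (Real.abs_cos_le_one _)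
        nlinarith
      · have h3 : |Real.sinc u| ≤ 1 / 2 := by
          rw [Real.sinc_of_ne_zero hu.ne', abs_div, abs_of_pos hu, div_le_div_iff₀ hu two_pos]
          nlinarith [Real.abs_sin_le_one u]
        linarith
  rcases lt_trichotomy u 0 with h | h | h
  · have := pos (-u) (by linarith)
    rwa [Real.sinc_neg, neg_sq] at this
  · simp [h]
  · exact pos u h

lemma integral_cos_affine (r w θ : ℝ) (hr : 0 < r) :
    ∫ x in (-r)..r, Real.cos (w * x - θ) = 2 * r * (Real.cos θ * Real.sinc (r * w)) := by
  rcases eq_or_ne w 0 with rfl | hw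
  · simp only [zero_mul, zero_sub, Real.cos_neg, intervalIntegral.integral_const, mul_zero,
      Real.sinc_zero, smul_eq_mul]
    ring
  · rw [intervalIntegral.integral_comp_mul_sub (fun x => Real.cos x) hw, integral_cos,
      Real.sinc_of_ne_zero (mul_ne_zero hr.ne' hw)]
    have h1 := Real.sin_sub (w * r) θ
    have h2 : Real.sin (w * -r - θ) = -(Real.sin (w * r + θ)) := by
      rw [← Real.sin_neg]; congr 1; ring
    rw [h2, h1, Real.sin_add, smul_eq_mul, mul_comm r w]
    field_simp
    ring

namespace IsBoundedDensity

variable {E : ℝ → ℝ} {M : ℝ}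

lemma exists_lower_bound (h : IsBoundedDensity E M) :
    ∃ r > 0, ∃ c₀ > 0, ∀ x, |x| ≤ r → c₀ ≤ E x := by
  have h1 : ∀ᶠ x in 𝓝 (0 : ℝ), E 0 / 2 < E x :=
    h.cont.continuousAt.eventually (lt_mem_nhds (by linarith [h.pos]))
  obtain ⟨r, hr, hr'⟩ := Metric.eventually_nhds_iff.1 h1
  refine ⟨r / 2, by positivity, E 0 / 2, by linarith [h.pos], fun x hx => (hr' ?_).le⟩
  rw [Real.dist_eq, sub_zero]
  linarith

lemma exists_norm_densityChar_le (h : IsBoundedDensity E M) :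
    ∃ κ > 0, ∀ v, ‖densityChar E v‖ ≤ 1 - κ * min (v ^ 2) 1 := by
  obtain ⟨r, hr, c₀, hc₀, hE⟩ := h.exists_lower_bound
  set b : ℝ := min ((2 * Real.pi * r) ^ 2) 1 with hb
  have hbpos : 0 < b := by positivity
  refine ⟨c₀ * (2 * r) * (b / 40), by positivity, fun v => ?_⟩
  set w := 2 * Real.pi * v with hw
  set θ := Complex.arg (densityChar E v) with hθ
  have hcosint : Integrable fun x => E x * Real.cos (w * x - θ) := by
    refine Integrable.mul_bdd (c := 1) h.int (by fun_prop) (Eventually.of_forall fun x => ?_)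
    exact Real.abs_cos_le_one _
  have hnorm : ‖densityChar E v‖ = ∫ x, E x * Real.cos (w * x - θ) := by
    have h1 : ((‖densityChar E v‖ : ℝ) : ℂ) =
        densityChar E v * Complex.exp (-(θ : ℂ) * Complex.I) := by
      conv_rhs => rw [← Complex.norm_mul_exp_arg_mul_I (densityChar E v)]
      rw [mul_assoc, ← Complex.exp_add, ← hθ]
      simp
    have h2 : ‖densityChar E v‖ =
        (∫ x, (E x : ℂ) * unitChar (v * x) * Complex.exp (-(θ : ℂ) * Complex.I)).re := by
      rw [integral_mul_const, ← Complex.ofReal_re ‖densityChar E v‖, h1]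
      rfl
    have hint : Integrable fun x => (E x : ℂ) * unitChar (v * x) *
        Complex.exp (-(θ : ℂ) * Complex.I) := (h.integrable_ofReal_mul_unitChar v).mul_const _
    have h3 := integral_re (𝕜 := ℂ) hint
    rw [h2]
    refine (h3.symm.trans ?_)
    refine integral_congr_ae (Eventually.of_forall fun x => ?_)
    dsimp only
    rw [mul_assoc, unitChar, ← Complex.exp_add]
    have : ((2 * Real.pi * (v * x) : ℝ) : ℂ) * Complex.I + -(θ : ℂ) * Complex.I =
        ((w * x - θ : ℝ) : ℂ) * Complex.I := by
      rw [hw]; push_cast; ring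
    rw [this]
    change ((E x : ℂ) * _).re = _
    rw [Complex.re_ofReal_mul, Complex.exp_ofReal_mul_I_re]
  have hone : 1 - ‖densityChar E v‖ = ∫ x, E x * (1 - Real.cos (w * x - θ)) := by
    have hsub := integral_sub h.int hcosint
    rw [h.mass] at hsub
    rw [hnorm, ← hsub]
    congr 1; funext x; ring
  have hint : Integrable fun x => E x * (1 - Real.cos (w * x - θ)) := by
    refine (h.int.sub hcosint).congr (Eventually.of_forall fun x => ?_)
    simp only [Pi.sub_apply]; ring
  have hge : c₀ * (∫ x in (-r)..r, (1 - Real.cos (w * x - θ))) ≤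
      ∫ x, E x * (1 - Real.cos (w * x - θ)) := by
    rw [intervalIntegral.integral_of_le (by linarith), ← integral_const_mul]
    refine le_trans (setIntegral_mono_on ?_ hint.integrableOn measurableSet_Ioc ?_)
      (setIntegral_le_integral hint (Eventually.of_forall fun x => ?_))
    · exact (by fun_prop : Continuous fun x => c₀ * (1 - Real.cos (w * x - θ))).integrableOn_Ioc
    · intro x hx
      exact mul_le_mul_of_nonneg_right (hE x (abs_le.2 ⟨hx.1.le, hx.2⟩))
        (by linarith [Real.cos_le_one (w * x - θ)])
    · exact mul_nonneg (h.nonneg x) (by linarith [Real.cos_le_one (w * x - θ)])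
  rw [intervalIntegral.integral_sub (by simp) (Continuous.intervalIntegrable (by fun_prop) _ _),
    integral_cos_affine r w θ hr, intervalIntegral.integral_const] at hge
  have hs := one_sub_abs_sinc_ge (r * w)
  have hcs : Real.cos θ * Real.sinc (r * w) ≤ |Real.sinc (r * w)| := by
    refine (le_abs_self _).trans ?_
    rw [abs_mul]
    exact mul_le_of_le_one_left (abs_nonneg _) (Real.abs_cos_le_one _)
  have hmin : b * min (v ^ 2) 1 ≤ min ((r * w) ^ 2) 1 := by
    have hv : 0 ≤ min (v ^ 2) 1 := le_min (sq_nonneg _) zero_le_one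
    refine le_min ?_ ?_
    · calc b * min (v ^ 2) 1 ≤ (2 * Real.pi * r) ^ 2 * v ^ 2 :=
          mul_le_mul (min_le_left _ _) (min_le_left _ _) hv (by positivity)
        _ = _ := by rw [hw]; ring
    · calc b * min (v ^ 2) 1 ≤ 1 * 1 :=
          mul_le_mul (min_le_right _ _) (min_le_right _ _) hv (by positivity)
        _ = 1 := by ring
  rw [← hone, smul_eq_mul] at hge
  have h5 : c₀ * (2 * r) * (b / 40 * min (v ^ 2) 1) ≤
      c₀ * (2 * r) * (1 - Real.cos θ * Real.sinc (r * w)) := by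
    refine mul_le_mul_of_nonneg_left ?_ (by positivity)
    linarith
  nlinarith

lemma densityChar_taylor (h : IsBoundedDensity E M) {σ : ℝ} (hσ : 0 < σ)
    (hmean : ∫ x, x * E x = 0) (hvar : ∫ x, x ^ 2 * E x = σ ^ 2) :
    ∀ η > 0, ∃ δ > 0, ∀ v, |v| ≤ δ →
      ‖densityChar E v - Complex.exp (-(2 * Real.pi ^ 2 * σ ^ 2 * v ^ 2 : ℝ))‖ ≤ η * v ^ 2 := by
  set P : Measure ℝ := volume.withDensity fun x => ENNReal.ofReal (E x) with hP
  have hPprob : IsProbabilityMeasure P := ⟨by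
    rw [hP, withDensity_apply _ MeasurableSet.univ, Measure.restrict_univ, h.lintegral_eq]⟩
  have hPint : ∀ (f : ℝ → ℝ), ∫ x, f x ∂P = ∫ x, E x * f x := by
    intro f
    rw [hP, integral_withDensity_eq_integral_toReal_smul h.measurable_ofReal
      (Eventually.of_forall fun x => ENNReal.ofReal_lt_top)]
    simp only [ENNReal.toReal_ofReal (h.nonneg _), smul_eq_mul]
  have hPintC : ∀ (f : ℝ → ℂ), ∫ x, f x ∂P = ∫ x, (E x : ℂ) * f x := by
    intro f
    rw [hP, integral_withDensity_eq_integral_toReal_smul h.measurable_ofReal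
      (Eventually.of_forall fun x => ENNReal.ofReal_lt_top)]
    simp only [ENNReal.toReal_ofReal (h.nonneg _), Complex.real_smul]
  set X : ℝ → ℝ := fun x => x / σ with hX
  have hXm : Measurable X := measurable_id.div_const σ
  have hmean' : ∫ x, X x ∂P = 0 := by
    rw [hPint]
    have : ∀ x, E x * X x = σ⁻¹ * (x * E x) := fun x => by simp only [hX]; ring
    simp only [this]
    rw [integral_const_mul, hmean, mul_zero]
  have hvar' : ∫ x, (X ^ 2) x ∂P = 1 := by
    rw [hPint]
    have : ∀ x, E x * (X ^ 2) x = (σ ^ 2)⁻¹ * (x ^ 2 * E x) := fun x => by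
      simp only [hX, Pi.pow_apply]; field_simp
    simp only [this]
    rw [integral_const_mul, hvar, inv_mul_cancel₀ (by positivity)]
  have htay := taylor_charFun_two hXm.aemeasurable hmean' hvar'
  have hchar : ∀ v, charFun (P.map X) (2 * Real.pi * σ * v) = densityChar E v := by
    intro v
    rw [charFun_apply_real, integral_map hXm.aemeasurable (by fun_prop), hPintC, densityChar]
    refine integral_congr_ae (Eventually.of_forall fun x => ?_)
    dsimp only
    rw [unitChar]
    congr 2
    simp only [hX]
    push_cast
    have : (σ : ℂ) ≠ 0 := by exact_mod_cast hσ.ne'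
    field_simp
  intro η hη
  set K := 2 * Real.pi * σ with hK
  have hKpos : 0 < K := by positivity
  have h1 := htay.def (c := η / (2 * K ^ 2)) (by positivity)
  obtain ⟨δ₁, hδ₁, h1⟩ := Metric.eventually_nhds_iff.1 h1
  set A := 2 * Real.pi ^ 2 * σ ^ 2 with hA
  have hApos : 0 < A := by positivity
  refine ⟨min (δ₁ / (2 * K)) (min (1 / (A + 1)) (η / (2 * A ^ 2 + 1))), by positivity,
    fun v hv => ?_⟩
  have hv1 := hv.trans (min_le_left _ _)
  have hv2 := (hv.trans (min_le_right _ _)).trans (min_le_left _ _)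
  have hv3 := (hv.trans (min_le_right _ _)).trans (min_le_right _ _)
  have h2 := @h1 (K * v) (by
    rw [Real.dist_eq, sub_zero, abs_mul, abs_of_pos hKpos]
    rw [le_div_iff₀ (by positivity)] at hv1
    nlinarith)
  rw [hchar] at h2
  have e1 : (1 - ((K * v : ℝ) : ℂ) ^ 2 / 2) = ((1 - A * v ^ 2 : ℝ) : ℂ) := by
    rw [hA, hK]; push_cast; ring
  rw [e1] at h2
  have h3 : η / (2 * K ^ 2) * ‖(K * v) ^ 2‖ = η / 2 * v ^ 2 := by
    rw [Real.norm_eq_abs, abs_of_nonneg (sq_nonneg _)]; field_simp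
  rw [h3] at h2
  have hvle1 : |v| ≤ 1 := hv2.trans (by rw [div_le_one (by positivity)]; linarith)
  have hAv : |-(A * v ^ 2)| ≤ 1 := by
    rw [abs_neg, abs_of_nonneg (by positivity), ← sq_abs]
    rw [le_div_iff₀ (by positivity)] at hv2
    nlinarith [abs_nonneg v]
  have h4 := Real.abs_exp_sub_one_sub_id_le hAv
  have h5 : |Real.exp (-(A * v ^ 2)) - (1 - A * v ^ 2)| ≤ η / 2 * v ^ 2 := by
    have e2 : Real.exp (-(A * v ^ 2)) - (1 - A * v ^ 2) =
      Real.exp (-(A * v ^ 2)) - 1 - -(A * v ^ 2) := by ring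
    rw [e2]
    refine h4.trans ?_
    rw [le_div_iff₀ (by positivity)] at hv3
    have h6 : A ^ 2 * v ^ 2 ≤ η / 2 := by
      rw [← sq_abs v]
      nlinarith [abs_nonneg v, mul_nonneg (sq_nonneg A) (abs_nonneg v),
        mul_nonneg (mul_nonneg (sq_nonneg A) (abs_nonneg v)) (sub_nonneg.2 hvle1)]
    nlinarith [sq_nonneg v]
  calc ‖densityChar E v - Complex.exp (-(A * v ^ 2 : ℝ))‖
      = ‖(densityChar E v - ((1 - A * v ^ 2 : ℝ) : ℂ)) -
        ((Real.exp (-(A * v ^ 2)) - (1 - A * v ^ 2) : ℝ) : ℂ)‖ := by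
        congr 1; push_cast; ring
    _ ≤ η / 2 * v ^ 2 + η / 2 * v ^ 2 := by
        refine (norm_sub_le _ _).trans (add_le_add h2 ?_)
        rw [Complex.norm_real]
        exact h5
    _ = η * v ^ 2 := by ring

end IsBoundedDensity

/-- A nonnegative minorant of a multiple of `E` with an integrable Fourier representation. -/
structure FourierMinorant (E : ℝ → ℝ) where
  T : ℝ → ℝ
  τ : ℝ → ℂ
  c₀ : ℝ
  B : ℝ
  ρ : ℝ
  nonneg : ∀ x, 0 ≤ T x
  c₀_pos : 0 < c₀
  le : ∀ x, c₀ * T x ≤ E x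
  cont : Continuous τ
  int : Integrable τ
  bound : ∀ s, ‖τ s‖ ≤ B
  ρ_pos : 0 < ρ
  apply_zero : τ 0 = ρ
  eq_integral : ∀ x, (T x : ℂ) = ∫ s, τ s * unitChar (s * x)

open scoped FourierTransform in
lemma IsBoundedDensity.exists_fourierMinorant {E : ℝ → ℝ} {M : ℝ} (h : IsBoundedDensity E M) :
    Nonempty (FourierMinorant E) := by
  obtain ⟨r, hr, c₀, hc₀, hE⟩ := h.exists_lower_bound
  let f : ContDiffBump (0 : ℝ) := ⟨r / 2, r, by positivity, by linarith⟩
  have hsupp : HasCompactSupport fun x => ((f x : ℝ) : ℂ) :=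
    f.hasCompactSupport.comp_left (g := fun y : ℝ => (y : ℂ)) Complex.ofReal_zero
  have hsm : ContDiff ℝ (⊤ : ℕ∞) fun x => ((f x : ℝ) : ℂ) :=
    Complex.ofRealCLM.contDiff.comp f.contDiff
  let S : SchwartzMap ℝ ℂ := hsupp.toSchwartzMap hsm
  have hS : ∀ x, S x = ((f x : ℝ) : ℂ) := fun x => rfl
  obtain ⟨B, hB⟩ := (𝓕 S).decay 0 0
  have hinv : 𝓕⁻ (𝓕 (S : ℝ → ℂ)) = (S : ℝ → ℂ) :=
    S.continuous.fourierInv_fourier_eq S.integrable (𝓕 S).integrable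
  refine ⟨⟨fun x => f x, fun s => (𝓕 S) s, c₀, B, ∫ x, f x, fun x => f.nonneg, hc₀,
    fun x => ?_, (𝓕 S).continuous, (𝓕 S).integrable, fun s => ?_, f.integral_pos, ?_,
    fun x => ?_⟩⟩
  · by_cases hx : |x| ≤ r
    · exact (mul_le_of_le_one_right hc₀.le f.le_one).trans (hE x hx)
    · rw [f.zero_of_le_dist (by rw [Real.dist_eq, sub_zero]; exact (not_le.1 hx).le), mul_zero]
      exact h.nonneg x
  · simpa using hB.2 s
  · rw [SchwartzMap.fourier_coe, Real.fourier_real_eq]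
    simp only [mul_zero, neg_zero, hS]
    rw [← integral_complex_ofReal]
    simp
  · rw [← hS, ← hinv, Real.fourierInv_eq']
    refine integral_congr_ae (Eventually.of_forall fun s => ?_)
    dsimp only
    rw [smul_eq_mul, mul_comm, unitChar, SchwartzMap.fourier_coe]
    congr 5
    simp [mul_comm]

lemma ofReal_integral_le_lintegral {f : ℝ → ℝ} (hf : Integrable f) :
    ENNReal.ofReal (∫ x, f x) ≤ ∫⁻ x, ENNReal.ofReal (f x) := by
  have h1 : ∫ x, f x ≤ ∫ x, max (f x) 0 :=
    integral_mono hf hf.pos_part fun x => le_max_left _ _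
  refine (ENNReal.ofReal_le_ofReal h1).trans ?_
  rw [ofReal_integral_eq_lintegral_ofReal hf.pos_part
    (Eventually.of_forall fun x => le_max_right _ _)]
  refine lintegral_mono fun x => le_of_eq ?_
  rcases le_total (f x) 0 with hx | hx
  · rw [max_eq_right hx, ENNReal.ofReal_of_nonpos hx, ENNReal.ofReal_zero]
  · rw [max_eq_left hx]

namespace FourierMinorant

variable {E : ℝ → ℝ} (F : FourierMinorant E)

/-- The amplitude of the Fourier representation of the free partition function. -/
def amp (n : ℕ) (z : ℝ × ℝ) : ℂ :=
  F.τ z.1 * F.τ (z.1 + z.2) * ∏ k ∈ Finset.range n, densityChar E ((k + 1) * z.2 - z.1)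

/-- Fourier representation of the free partition function with `n` integrated heights. -/
def freeInt (c : ℝ) (n : ℕ) (a b : ℝ) : ℂ :=
  ∫ z : ℝ × ℝ, F.amp n z *
    unitChar ((z.1 - n * z.2) * a + ((n + 1) * z.2 - z.1) * b + (z.1 + z.2) * c)

lemma integrable_tau_mul : Integrable fun z : ℝ × ℝ => F.τ z.1 * F.τ (z.1 + z.2) := by
  have h1 : Integrable (fun z : ℝ × ℝ => F.τ z.1 * F.τ z.2) (volume.prod volume) :=
    F.int.mul_prod F.int
  have h2 := (measurePreserving_prod_add (volume : Measure ℝ) (volume : Measure ℝ))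
  have h3 : MeasurePreserving (fun z : ℝ × ℝ => (z.1, z.1 + z.2)) := by
    simpa [Measure.volume_eq_prod] using h2
  rw [← Measure.volume_eq_prod] at h1
  exact h3.integrable_comp_of_integrable h1

variable {M : ℝ}

lemma continuous_amp (h : IsBoundedDensity E M) (n : ℕ) : Continuous (F.amp n) := by
  have h1 := F.cont
  have h2 := h.continuous_densityChar
  unfold amp
  fun_prop

lemma norm_amp_le (h : IsBoundedDensity E M) (n : ℕ) (z : ℝ × ℝ) :
    ‖F.amp n z‖ ≤ ‖F.τ z.1 * F.τ (z.1 + z.2)‖ := by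
  rw [amp, norm_mul]
  refine mul_le_of_le_one_right (norm_nonneg _) ?_
  rw [norm_prod]
  exact Finset.prod_le_one (fun _ _ => norm_nonneg _) fun _ _ => h.norm_densityChar_le_one _

lemma integrable_amp (h : IsBoundedDensity E M) (n : ℕ) : Integrable (F.amp n) :=
  F.integrable_tau_mul.norm.mono' (F.continuous_amp h n).aestronglyMeasurable
    (Eventually.of_forall fun z => F.norm_amp_le h n z)

lemma integrable_amp_mul (h : IsBoundedDensity E M) (n : ℕ) {g : ℝ × ℝ → ℝ} (hg : Continuous g) :
    Integrable fun z => F.amp n z * unitChar (g z) :=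
  (F.integrable_amp h n).mul_bdd (c := 1) (continuous_unitChar.comp hg).aestronglyMeasurable
    (Eventually.of_forall fun _ => (norm_unitChar _).le)

lemma continuous_freeInt (h : IsBoundedDensity E M) (c : ℝ) (n : ℕ) (b : ℝ) :
    Continuous fun x => F.freeInt c n b x := by
  unfold freeInt
  refine continuous_of_dominated (bound := fun z => ‖F.amp n z‖) (fun x => ?_) (fun x => ?_)
    (F.integrable_amp h n).norm ?_
  · exact (F.integrable_amp_mul h n (by fun_prop)).aestronglyMeasurable
  · exact Eventually.of_forall fun z => by rw [norm_mul, norm_unitChar, mul_one]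
  · refine Eventually.of_forall fun z => ?_
    exact continuous_const.mul (continuous_unitChar.comp (by fun_prop))

lemma norm_freeInt_le (c : ℝ) (n : ℕ) (a b : ℝ) :
    ‖F.freeInt c n a b‖ ≤ ∫ z, ‖F.amp n z‖ := by
  refine (norm_integral_le_integral_norm _).trans (le_of_eq ?_)
  simp only [norm_mul, norm_unitChar, mul_one]

lemma freeInt_zero (c a b : ℝ) : F.freeInt c 0 a b = ((F.T (a - 2 * b) * F.T (b + c) : ℝ) : ℂ) := by
  have hint : Integrable (fun z : ℝ × ℝ => F.amp 0 z *
      unitChar ((z.1 - (0 : ℕ) * z.2) * a + (((0 : ℕ) + 1) * z.2 - z.1) * b + (z.1 + z.2) * c))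
      (volume.prod volume) := by
    rw [← Measure.volume_eq_prod]
    refine Integrable.mul_bdd (c := 1) ?_ ?_ (Eventually.of_forall fun _ => (norm_unitChar _).le)
    · exact F.integrable_tau_mul.congr (Eventually.of_forall fun z => by simp [amp])
    · exact (continuous_unitChar.comp (by fun_prop)).aestronglyMeasurable
  rw [freeInt, Measure.volume_eq_prod, integral_prod _ hint]
  push_cast
  rw [F.eq_integral, F.eq_integral, ← integral_mul_const]
  refine integral_congr_ae (Eventually.of_forall fun s => ?_)
  dsimp only
  rw [← integral_add_left_eq_self (fun t => F.τ t * unitChar (t * (b + c))) s,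
    ← integral_const_mul]
  refine integral_congr_ae (Eventually.of_forall fun p => ?_)
  dsimp only
  have : unitChar (((s : ℝ) - 0 * p) * a + ((0 + 1) * p - s) * b + (s + p) * c) =
      unitChar (s * (a - 2 * b)) * unitChar ((s + p) * (b + c)) := by
    rw [← unitChar_add]; congr 1; ring
  simp only [this, amp, Finset.range_zero, Finset.prod_empty, mul_one]
  ring

lemma freeInt_succ (h : IsBoundedDensity E M) (c : ℝ) (n : ℕ) (a b : ℝ) :
    F.freeInt c (n + 1) a b = ∫ x, (E (x + a - 2 * b) : ℂ) * F.freeInt c n b x := by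
  have hE : Integrable fun x => (E (x + a - 2 * b) : ℂ) := by
    have := (h.int.comp_add_right (a - 2 * b)).ofReal (𝕜 := ℂ)
    simpa [add_sub_assoc] using this
  simp only [freeInt]
  simp only [← integral_const_mul]
  rw [integral_integral_swap]
  · refine integral_congr_ae (Eventually.of_forall fun z => ?_)
    dsimp only
    have e1 : ∀ x : ℝ, (E (x + a - 2 * b) : ℂ) * (F.amp n z * unitChar ((z.1 - n * z.2) * b +
        ((n + 1) * z.2 - z.1) * x + (z.1 + z.2) * c)) =
        F.amp n z * unitChar ((z.1 - n * z.2) * b + (z.1 + z.2) * c) *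
        ((E (x + (a - 2 * b)) : ℂ) * unitChar (((n + 1) * z.2 - z.1) * x)) := by
      intro x
      have : unitChar ((z.1 - n * z.2) * b + ((n + 1) * z.2 - z.1) * x + (z.1 + z.2) * c) =
          unitChar ((z.1 - n * z.2) * b + (z.1 + z.2) * c) *
            unitChar (((n + 1) * z.2 - z.1) * x) := by
        rw [← unitChar_add]; congr 1; ring
      rw [this, add_sub_assoc]
      ring
    simp only [e1]
    rw [integral_const_mul, h.integral_shift_mul_unitChar]
    have e2 : unitChar ((z.1 - (n + 1 : ℕ) * z.2) * a + (((n + 1 : ℕ) + 1) * z.2 - z.1) * b +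
        (z.1 + z.2) * c) = unitChar ((z.1 - n * z.2) * b + (z.1 + z.2) * c) *
          unitChar (-(((n + 1) * z.2 - z.1) * (a - 2 * b))) := by
      rw [← unitChar_add]; congr 1; push_cast; ring
    rw [e2, amp, amp, Finset.prod_range_succ]
    ring
  · refine (((hE.mul_prod (F.integrable_amp h n)).mul_bdd (c := 1) (g := fun q : ℝ × ℝ × ℝ =>
      unitChar ((q.2.1 - n * q.2.2) * b + ((n + 1) * q.2.2 - q.2.1) * q.1 + (q.2.1 + q.2.2) * c))
      ?_ (Eventually.of_forall fun _ => (norm_unitChar _).le))).congr ?_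
    · exact (continuous_unitChar.comp (by fun_prop)).aestronglyMeasurable
    · refine Eventually.of_forall fun q => ?_
      simp only [Function.uncurry]
      ring

lemma le_pathSum (h : IsBoundedDensity E M) (c : ℝ) (n : ℕ) (a b : ℝ) :
    ENNReal.ofReal (F.c₀ ^ 2 * (F.freeInt c n a b).re) ≤
      pathSum (fun x => ENNReal.ofReal (E (x + c))) volume n (fun _ => lapWeight E) a b := by
  induction n generalizing a b with
  | zero =>
    rw [freeInt_zero, Complex.ofReal_re]
    simp only [pathSum, lapWeight, zero_add]
    rw [← ENNReal.ofReal_mul (h.nonneg _)]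
    refine ENNReal.ofReal_le_ofReal ?_
    calc _ = (F.c₀ * F.T (a - 2 * b)) * (F.c₀ * F.T (b + c)) := by ring
      _ ≤ _ := mul_le_mul (F.le _) (F.le _) (mul_nonneg F.c₀_pos.le (F.nonneg _)) (h.nonneg _)
  | succ n ih =>
    simp only [pathSum] at ih ⊢
    have hE : Integrable fun x => (E (x + a - 2 * b) : ℂ) := by
      have := (h.int.comp_add_right (a - 2 * b)).ofReal (𝕜 := ℂ)
      simpa [add_sub_assoc] using this
    have hint : Integrable fun x => (E (x + a - 2 * b) : ℂ) * F.freeInt c n b x :=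
      hE.mul_bdd (F.continuous_freeInt h c n b).aestronglyMeasurable
        (Eventually.of_forall fun x => F.norm_freeInt_le c n b x)
    have hre : ∀ x, ((E (x + a - 2 * b) : ℂ) * F.freeInt c n b x).re =
        E (x + a - 2 * b) * (F.freeInt c n b x).re := fun x => Complex.re_ofReal_mul _ _
    have hint' : Integrable fun x => E (x + a - 2 * b) * (F.c₀ ^ 2 * (F.freeInt c n b x).re) := by
      refine (hint.re.const_mul (F.c₀ ^ 2)).congr (Eventually.of_forall fun x => ?_)
      change F.c₀ ^ 2 * ((E (x + a - 2 * b) : ℂ) * F.freeInt c n b x).re = _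
      rw [hre]; ring
    have e : F.c₀ ^ 2 * (F.freeInt c (n + 1) a b).re =
        ∫ x, E (x + a - 2 * b) * (F.c₀ ^ 2 * (F.freeInt c n b x).re) := by
      rw [F.freeInt_succ h]
      have h1 := integral_re (𝕜 := ℂ) hint
      change _ = Complex.re _ at h1
      rw [← h1, ← integral_const_mul]
      refine integral_congr_ae (Eventually.of_forall fun x => ?_)
      change F.c₀ ^ 2 * ((E (x + a - 2 * b) : ℂ) * F.freeInt c n b x).re = _
      rw [hre]; ring
    rw [e]
    refine (ofReal_integral_le_lintegral hint').trans (lintegral_mono fun x => ?_)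
    rw [ENNReal.ofReal_mul (h.nonneg _)]
    exact mul_le_mul_right (ih b x) _

end FourierMinorant

lemma min_add_min_ge {u v q : ℝ} (hu : 0 ≤ u) (hv : 0 ≤ v) (hq : q ≤ 56 * (u + v)) :
    min q 1 / 56 ≤ min u 1 + min v 1 := by
  rcases le_total u 1 with h1 | h1 <;> rcases le_total v 1 with h2 | h2 <;>
    simp only [min_eq_left, min_eq_right, h1, h2] <;>
    rcases le_total q 1 with h3 | h3 <;> simp only [min_eq_left, min_eq_right, h3] <;> linarith

/-- The phases `(k+1)p - s` cannot be small simultaneously. -/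
lemma sum_min_sq_ge (n : ℕ) (hn : 2 ≤ n) (s p : ℝ) :
    n * min (s ^ 2 + (n * p) ^ 2) 1 / 168 ≤
      ∑ k ∈ Finset.range n, min (((k + 1) * p - s) ^ 2) 1 := by
  set q := s ^ 2 + (n * p) ^ 2 with hq
  obtain ⟨h, hh1, hh2⟩ : ∃ h : ℕ, h + h ≤ n ∧ n ≤ 3 * h := ⟨n / 2, by omega, by omega⟩
  have hnh : (n : ℝ) ≤ 3 * h := by exact_mod_cast hh2
  have hnn : (0 : ℝ) ≤ n := Nat.cast_nonneg n
  have hq0 : 0 ≤ min q 1 := le_min (by positivity) zero_le_one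
  have hpair : ∀ k ∈ Finset.range h, min q 1 / 56 ≤
      min (((k + 1) * p - s) ^ 2) 1 + min ((((h + k : ℕ) + 1) * p - s) ^ 2) 1 := by
    intro k hk
    rw [Finset.mem_range] at hk
    refine min_add_min_ge (sq_nonneg _) (sq_nonneg _) ?_
    set u := ((k : ℝ) + 1) * p - s with hu
    set v := (((h + k : ℕ) : ℝ) + 1) * p - s with hv
    have hvu : h * p = v - u := by rw [hu, hv]; push_cast; ring
    have h1 : (n * p) ^ 2 ≤ 18 * (u ^ 2 + v ^ 2) := by
      have : (n * p) ^ 2 ≤ 9 * (h * p) ^ 2 := by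
        have : (n : ℝ) ^ 2 ≤ 9 * (h : ℝ) ^ 2 := by nlinarith
        nlinarith [sq_nonneg p]
      rw [hvu] at this
      nlinarith [sq_nonneg (u + v)]
    have hkn : ((k : ℝ) + 1) ≤ n := by exact_mod_cast (by omega : k + 1 ≤ n)
    have h2 : (((k : ℝ) + 1) * p) ^ 2 ≤ (n * p) ^ 2 := by
      have : ((k : ℝ) + 1) ^ 2 ≤ (n : ℝ) ^ 2 := by gcongr
      nlinarith [sq_nonneg p]
    have h3 : s ^ 2 ≤ 2 * (n * p) ^ 2 + 2 * u ^ 2 := by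
      have : s = ((k : ℝ) + 1) * p - u := by rw [hu]; ring
      nlinarith [sq_nonneg (((k : ℝ) + 1) * p + u)]
    nlinarith [sq_nonneg v]
  calc n * min q 1 / 168 ≤ ∑ k ∈ Finset.range h, min q 1 / 56 := by
        rw [Finset.sum_const, Finset.card_range, nsmul_eq_mul]
        nlinarith
    _ ≤ ∑ k ∈ Finset.range h, (min (((k + 1) * p - s) ^ 2) 1 +
          min ((((h + k : ℕ) + 1) * p - s) ^ 2) 1) := Finset.sum_le_sum hpair
    _ = ∑ k ∈ Finset.range (h + h), min (((k + 1) * p - s) ^ 2) 1 := by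
        rw [Finset.sum_range_add, Finset.sum_add_distrib]
    _ ≤ _ := by
        refine Finset.sum_le_sum_of_subset_of_nonneg (Finset.range_mono hh1) fun k _ _ => ?_
        exact le_min (sq_nonneg _) zero_le_one

lemma norm_prod_sub_prod_le_sum {f g : ℕ → ℂ} (hf : ∀ k, ‖f k‖ ≤ 1) (hg : ∀ k, ‖g k‖ ≤ 1)
    (n : ℕ) :
    ‖∏ k ∈ Finset.range n, f k - ∏ k ∈ Finset.range n, g k‖ ≤
      ∑ k ∈ Finset.range n, ‖f k - g k‖ := by
  induction n with
  | zero => simp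
  | succ n ih =>
    rw [Finset.prod_range_succ, Finset.prod_range_succ, Finset.sum_range_succ]
    have hg' : ‖∏ k ∈ Finset.range n, g k‖ ≤ 1 := by
      rw [norm_prod]
      exact Finset.prod_le_one (fun _ _ => norm_nonneg _) fun k _ => hg k
    calc _ = ‖(∏ k ∈ Finset.range n, f k - ∏ k ∈ Finset.range n, g k) * f n +
          (∏ k ∈ Finset.range n, g k) * (f n - g n)‖ := by congr 1; ring
      _ ≤ _ := by
        refine (norm_add_le _ _).trans (add_le_add ?_ ?_)
        · rw [norm_mul]
          exact (mul_le_of_le_one_right (norm_nonneg _) (hf n)).trans ih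
        · rw [norm_mul]
          exact mul_le_of_le_one_left (norm_nonneg _) hg'

lemma sum_sq_affine (n : ℕ) (s p : ℝ) :
    ∑ k ∈ Finset.range n, ((k + 1) * p - s) ^ 2 =
      p ^ 2 * (n * (n + 1) * (2 * n + 1) / 6) - p * s * (n * (n + 1)) + n * s ^ 2 := by
  induction n with
  | zero => simp
  | succ n ih => rw [Finset.sum_range_succ, ih]; push_cast; ring

lemma map_scale_volume {α β : ℝ} (hα : 0 < α) (hβ : 0 < β) :
    Measure.map (Prod.map (α * ·) (β * ·)) (volume : Measure (ℝ × ℝ)) =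
      ENNReal.ofReal (α * β)⁻¹ • volume := by
  rw [Measure.volume_eq_prod, ← Measure.map_prod_map _ _ (by fun_prop) (by fun_prop),
    Real.map_volume_mul_left hα.ne', Real.map_volume_mul_left hβ.ne',
    Measure.prod_smul_left, Measure.prod_smul_right, smul_smul,
    ← ENNReal.ofReal_mul (abs_nonneg _), abs_of_pos (inv_pos.2 hα), abs_of_pos (inv_pos.2 hβ),
    mul_inv]

lemma measurableEmbedding_scale {α β : ℝ} (hα : 0 < α) (hβ : 0 < β) :
    MeasurableEmbedding (Prod.map (α * ·) (β * ·) : ℝ × ℝ → ℝ × ℝ) :=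
  (measurableEmbedding_mulLeft₀ hα.ne').prodMap (measurableEmbedding_mulLeft₀ hβ.ne')

lemma integral_comp_scale {α β : ℝ} (hα : 0 < α) (hβ : 0 < β) {G : Type*} [NormedAddCommGroup G]
    [NormedSpace ℝ G] (f : ℝ × ℝ → G) :
    ∫ w : ℝ × ℝ, f (α * w.1, β * w.2) = (α * β)⁻¹ • ∫ z, f z := by
  have := (measurableEmbedding_scale hα hβ).integral_map (μ := volume) f
  rw [map_scale_volume hα hβ, integral_smul_measure, ENNReal.toReal_ofReal (by positivity)] at this
  exact this.symm

lemma integrable_comp_scale {α β : ℝ} (hα : 0 < α) (hβ : 0 < β) {G : Type*} [NormedAddCommGroup G]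
    {f : ℝ × ℝ → G} (hf : Integrable f) :
    Integrable fun w : ℝ × ℝ => f (α * w.1, β * w.2) := by
  refine ((measurableEmbedding_scale hα hβ).integrable_map_iff (μ := volume) (g := f)).1 ?_
  rw [map_scale_volume hα hβ]
  exact hf.smul_measure ENNReal.ofReal_ne_top

lemma integrable_exp_neg_sq_add_sq {κ : ℝ} (hκ : 0 < κ) :
    Integrable fun w : ℝ × ℝ => Real.exp (-κ * (w.1 ^ 2 + w.2 ^ 2)) := by
  have h1 := (integrable_exp_neg_mul_sq hκ).mul_prod (integrable_exp_neg_mul_sq hκ)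
  rw [← Measure.volume_eq_prod] at h1
  refine h1.congr (Eventually.of_forall fun w => ?_)
  dsimp only
  rw [← Real.exp_add]; congr 1; ring

lemma tendsto_prod_densityChar {E : ℝ → ℝ} {M : ℝ} (h : IsBoundedDensity E M) {σ : ℝ} (hσ : 0 < σ)
    (hmean : ∫ x, x * E x = 0) (hvar : ∫ x, x ^ 2 * E x = σ ^ 2) (x y : ℝ) :
    Tendsto (fun n : ℕ => ∏ k ∈ Finset.range n, densityChar E
      ((k + 1) * ((n * √n)⁻¹ * y) - (√n)⁻¹ * x)) atTop
      (𝓝 (Complex.exp (-(2 * Real.pi ^ 2 * σ ^ 2 * (y ^ 2 / 3 - x * y + x ^ 2) : ℝ)))) := by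
  set A := 2 * Real.pi ^ 2 * σ ^ 2 with hA
  have hApos : 0 < A := by positivity
  set S : ℕ → ℝ := fun n => ∑ k ∈ Finset.range n,
    ((k + 1) * ((n * √n)⁻¹ * y) - (√n)⁻¹ * x) ^ 2 with hS
  have hinv : Tendsto (fun n : ℕ => (n : ℝ)⁻¹) atTop (𝓝 0) := tendsto_inv_atTop_nhds_zero_nat
  have hSeq : ∀ n : ℕ, 1 ≤ n → S n = y ^ 2 * ((1 + (n : ℝ)⁻¹) * (2 + (n : ℝ)⁻¹) / 6) -
      x * y * (1 + (n : ℝ)⁻¹) + x ^ 2 := by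
    intro n hn
    have hn' : (0 : ℝ) < n := by exact_mod_cast hn
    simp only [hS]
    rw [sum_sq_affine]
    have hs : √(n : ℝ) ≠ 0 := (Real.sqrt_pos.2 hn').ne'
    have hs2 : √(n : ℝ) ^ 2 = n := Real.sq_sqrt hn'.le
    field_simp
    rw [hs2]
  have hSlim : Tendsto S atTop (𝓝 (y ^ 2 / 3 - x * y + x ^ 2)) := by
    have h1 : Tendsto (fun n : ℕ => y ^ 2 * ((1 + (n : ℝ)⁻¹) * (2 + (n : ℝ)⁻¹) / 6) -
      x * y * (1 + (n : ℝ)⁻¹) + x ^ 2) atTop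
      (𝓝 (y ^ 2 * ((1 + 0) * (2 + 0) / 6) - x * y * (1 + 0) + x ^ 2)) := by
      refine Tendsto.add (Tendsto.sub ?_ ?_) tendsto_const_nhds
      · exact (((hinv.const_add 1).mul (hinv.const_add 2)).div_const 6).const_mul _
      · exact (hinv.const_add 1).const_mul _
    have h2 : y ^ 2 * ((1 + 0) * (2 + 0) / 6) - x * y * (1 + 0) + x ^ 2 =
      y ^ 2 / 3 - x * y + x ^ 2 := by ring
    rw [h2] at h1
    refine h1.congr' ?_
    filter_upwards [eventually_ge_atTop 1] with n hn using (hSeq n hn).symm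
  have hgauss : Tendsto (fun n : ℕ => ∏ k ∈ Finset.range n,
      Complex.exp (-(A * ((k + 1) * ((n * √n)⁻¹ * y) - (√n)⁻¹ * x) ^ 2 : ℝ))) atTop
      (𝓝 (Complex.exp (-(A * (y ^ 2 / 3 - x * y + x ^ 2) : ℝ)))) := by
    have e : ∀ n : ℕ, ∏ k ∈ Finset.range n,
      Complex.exp (-(A * ((k + 1) * ((n * √n)⁻¹ * y) - (√n)⁻¹ * x) ^ 2 : ℝ)) =
      Complex.exp (-(A * S n : ℝ)) := by
      intro n
      rw [← Complex.exp_sum]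
      congr 1
      simp only [hS]
      rw [Finset.mul_sum]
      push_cast
      rw [Finset.sum_neg_distrib]
    simp only [e]
    refine (Complex.continuous_exp.tendsto _).comp (Tendsto.neg ?_)
    exact (Complex.continuous_ofReal.tendsto _).comp (hSlim.const_mul A)
  refine (tendsto_iff_of_dist ?_).2 hgauss
  rw [Metric.tendsto_atTop]
  intro e he
  set Q := y ^ 2 / 3 - x * y + x ^ 2 with hQ
  have hQ0 : 0 ≤ Q := by nlinarith [sq_nonneg (y / 2 - x), sq_nonneg y]
  obtain ⟨δ, hδ, hδ'⟩ := h.densityChar_taylor hσ hmean hvar (e / (2 * (Q + 1))) (by positivity)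
  have hSev : ∀ᶠ n in atTop, S n < Q + 1 := hSlim.eventually (gt_mem_nhds (by linarith))
  have hsq : Tendsto (fun n : ℕ => (|x| + |y|) * (√(n : ℝ))⁻¹) atTop (𝓝 ((|x| + |y|) * 0)) :=
    (tendsto_inv_atTop_zero.comp (Real.tendsto_sqrt_atTop.comp
      tendsto_natCast_atTop_atTop)).const_mul _
  rw [mul_zero] at hsq
  have hsev : ∀ᶠ n : ℕ in atTop, (|x| + |y|) * (√(n : ℝ))⁻¹ < δ :=
    hsq.eventually (gt_mem_nhds hδ)
  obtain ⟨N, hN⟩ := eventually_atTop.1 (hSev.and (hsev.and (eventually_ge_atTop 1)))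
  refine ⟨N, fun n hn => ?_⟩
  obtain ⟨h1, h2, h3⟩ := hN n hn
  have hn' : (0 : ℝ) < n := by exact_mod_cast h3
  rw [Real.dist_eq, sub_zero, abs_of_nonneg dist_nonneg, dist_eq_norm]
  have hspos : 0 < √(n : ℝ) := Real.sqrt_pos.2 hn'
  calc _ ≤ ∑ k ∈ Finset.range n, ‖densityChar E ((k + 1) * ((n * √n)⁻¹ * y) - (√n)⁻¹ * x) -
        Complex.exp (-(A * ((k + 1) * ((n * √n)⁻¹ * y) - (√n)⁻¹ * x) ^ 2 : ℝ))‖ := by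
        refine norm_prod_sub_prod_le_sum (fun k => h.norm_densityChar_le_one _) (fun k => ?_) n
        rw [Complex.norm_exp, ← Complex.ofReal_neg, Complex.ofReal_re, Real.exp_le_one_iff,
          neg_nonpos]
        positivity
    _ ≤ ∑ k ∈ Finset.range n, e / (2 * (Q + 1)) *
        ((k + 1) * ((n * √n)⁻¹ * y) - (√n)⁻¹ * x) ^ 2 := by
        refine Finset.sum_le_sum fun k hk => hδ' _ ?_
        rw [Finset.mem_range] at hk
        have hk' : (k : ℝ) + 1 ≤ n := by exact_mod_cast hk
        refine le_trans ?_ h2.le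
        have e1 : ((k : ℝ) + 1) * ((n * √n)⁻¹ * y) - (√n)⁻¹ * x =
          (((k : ℝ) + 1) / n * y - x) * (√n)⁻¹ := by
          field_simp
        rw [e1, abs_mul, abs_of_pos (inv_pos.2 hspos)]
        refine mul_le_mul_of_nonneg_right ?_ (inv_pos.2 hspos).le
        refine (abs_sub _ _).trans ?_
        rw [abs_mul, abs_of_nonneg (by positivity : (0 : ℝ) ≤ ((k : ℝ) + 1) / n)]
        have : ((k : ℝ) + 1) / n ≤ 1 := by rw [div_le_one hn']; exact hk'
        nlinarith [abs_nonneg y]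
    _ = e / (2 * (Q + 1)) * S n := by rw [← Finset.mul_sum]
    _ < e := by
        have : e / (2 * (Q + 1)) * S n ≤ e / (2 * (Q + 1)) * (Q + 1) :=
          mul_le_mul_of_nonneg_left h1.le (by positivity)
        have h5 : e / (2 * (Q + 1)) * (Q + 1) = e / 2 := by field_simp
        linarith

namespace IsBoundedDensity

lemma exists_norm_prod_densityChar_le {E : ℝ → ℝ} {M : ℝ} (h : IsBoundedDensity E M) :
    ∃ κ : ℝ, 0 < κ ∧ ∀ n : ℕ, 2 ≤ n → ∀ s p : ℝ,
      ‖∏ k ∈ Finset.range n, densityChar E ((k + 1) * p - s)‖ ≤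
        Real.exp (-κ * (n * min (s ^ 2 + (n * p) ^ 2) 1)) := by
  obtain ⟨κ, hκ, hle⟩ := h.exists_norm_densityChar_le
  refine ⟨κ / 168, by positivity, fun n hn s p => ?_⟩
  rw [norm_prod]
  calc ∏ k ∈ Finset.range n, ‖densityChar E ((k + 1) * p - s)‖
      ≤ ∏ k ∈ Finset.range n, Real.exp (-κ * min (((k + 1) * p - s) ^ 2) 1) := by
        refine Finset.prod_le_prod (fun _ _ => norm_nonneg _) fun k _ => (hle _).trans ?_
        have := Real.add_one_le_exp (-κ * min ((((k : ℝ) + 1) * p - s) ^ 2) 1)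
        linarith
    _ = Real.exp (-κ * ∑ k ∈ Finset.range n, min (((k + 1) * p - s) ^ 2) 1) := by
        rw [← Real.exp_sum, Finset.mul_sum]
    _ ≤ _ := by
        refine Real.exp_le_exp.2 ?_
        have := sum_min_sq_ge n hn s p
        nlinarith

end IsBoundedDensity

namespace FourierMinorant

variable {E : ℝ → ℝ} {M : ℝ} (F : FourierMinorant E)

/-- Local limit theorem for the free integrated random walk bridge, along bounded boundary data. -/
lemma tendsto_freeInt (h : IsBoundedDensity E M) {σ : ℝ} (hσ : 0 < σ)
    (hmean : ∫ x, x * E x = 0) (hvar : ∫ x, x ^ 2 * E x = σ ^ 2) {L : ℝ} {a c : ℕ → ℝ}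
    (ha : ∀ n, |a n| ≤ L) (hc : ∀ n, |c n| ≤ L) :
    Tendsto (fun n : ℕ => ((n : ℝ) ^ 2 : ℝ) • F.freeInt (c n) n (a n) 0) atTop
      (𝓝 (∫ w : ℝ × ℝ, (F.ρ : ℂ) * F.ρ * Complex.exp
        (-(2 * Real.pi ^ 2 * σ ^ 2 * (w.2 ^ 2 / 3 - w.1 * w.2 + w.1 ^ 2) : ℝ)))) := by
  obtain ⟨κ, hκ, hprod⟩ := h.exists_norm_prod_densityChar_le
  have hL : 0 ≤ L := (abs_nonneg _).trans (ha 0)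
  have hB : 0 ≤ F.B := (norm_nonneg _).trans (F.bound 0)
  set f : ℕ → ℝ × ℝ → ℂ := fun n z => F.amp n z *
    unitChar ((z.1 - n * z.2) * a n + ((n + 1) * z.2 - z.1) * 0 + (z.1 + z.2) * c n) with hf
  have hfint : ∀ n, Integrable (f n) := fun n => F.integrable_amp_mul h n (by fun_prop)
  set G : ℕ → ℝ × ℝ → ℂ := fun n w => f n ((√n)⁻¹ * w.1, (n * √n)⁻¹ * w.2) with hG
  have hpos : ∀ n : ℕ, 1 ≤ n → 0 < (√(n : ℝ))⁻¹ ∧ 0 < ((n : ℝ) * √n)⁻¹ := by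
    intro n hn
    have : (0 : ℝ) < n := by exact_mod_cast hn
    exact ⟨by positivity, by positivity⟩
  have hdet : ∀ n : ℕ, 1 ≤ n → ((√(n : ℝ))⁻¹ * ((n : ℝ) * √n)⁻¹)⁻¹ = (n : ℝ) ^ 2 := by
    intro n hn
    have hn' : (0 : ℝ) < n := by exact_mod_cast hn
    have hs2 : √(n : ℝ) ^ 2 = n := Real.sq_sqrt hn'.le
    rw [mul_inv, inv_inv, inv_inv]
    nlinarith
  have hGint : ∀ n, 1 ≤ n → Integrable (G n) := fun n hn =>
    integrable_comp_scale (hpos n hn).1 (hpos n hn).2 (hfint n)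
  have hGeq : ∀ n : ℕ, 1 ≤ n → ∫ w, G n w = ((n : ℝ) ^ 2 : ℝ) • F.freeInt (c n) n (a n) 0 := by
    intro n hn
    rw [hG]
    dsimp only
    rw [integral_comp_scale (hpos n hn).1 (hpos n hn).2, hdet n hn]
    rfl
  have hmin : ∀ n : ℕ, 1 ≤ n → ∀ w : ℝ × ℝ,
      (n : ℝ) * min (((√(n : ℝ))⁻¹ * w.1) ^ 2 + (n * ((n * √n)⁻¹ * w.2)) ^ 2) 1 =
        min (w.1 ^ 2 + w.2 ^ 2) n := by
    intro n hn w
    have hn' : (0 : ℝ) < n := by exact_mod_cast hn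
    have hs2 : √(n : ℝ) ^ 2 = n := Real.sq_sqrt hn'.le
    rw [mul_min_of_nonneg _ _ hn'.le, mul_one]
    congr 1
    have hs : √(n : ℝ) ≠ 0 := (Real.sqrt_pos.2 hn').ne'
    field_simp
    rw [hs2]
  have hGle : ∀ n : ℕ, 2 ≤ n → ∀ w, ‖G n w‖ ≤
      ‖F.τ ((√(n : ℝ))⁻¹ * w.1) * F.τ ((√(n : ℝ))⁻¹ * w.1 + (n * √n)⁻¹ * w.2)‖ *
        Real.exp (-κ * min (w.1 ^ 2 + w.2 ^ 2) n) := by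
    intro n hn w
    simp only [hG, hf, norm_mul, norm_unitChar, mul_one, amp]
    rw [← norm_mul]
    refine mul_le_mul_of_nonneg_left ?_ (norm_nonneg _)
    rw [← hmin n (by omega)]
    exact hprod n hn _ _
  set near : ℕ → Set (ℝ × ℝ) := fun n => {w | w.1 ^ 2 + w.2 ^ 2 ≤ n} with hnear
  have hnm : ∀ n, MeasurableSet (near n) := fun n =>
    measurableSet_le (by fun_prop) measurable_const
  have h1 : Tendsto (fun n => ∫ w, (near n).indicator (G n) w) atTop
      (𝓝 (∫ w : ℝ × ℝ, (F.ρ : ℂ) * F.ρ * Complex.exp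
        (-(2 * Real.pi ^ 2 * σ ^ 2 * (w.2 ^ 2 / 3 - w.1 * w.2 + w.1 ^ 2) : ℝ)))) := by
    rw [← tendsto_add_atTop_iff_nat 2]
    refine tendsto_integral_of_dominated_convergence
      (fun w => F.B * F.B * Real.exp (-κ * (w.1 ^ 2 + w.2 ^ 2)))
      (fun n => ((hGint (n + 2) (by omega)).indicator (hnm _)).aestronglyMeasurable)
      ((integrable_exp_neg_sq_add_sq hκ).const_mul _) (fun n => Eventually.of_forall fun w => ?_)
      (Eventually.of_forall fun w => ?_)
    · by_cases hw : w ∈ near (n + 2)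
      · rw [indicator_of_mem hw]
        refine (hGle (n + 2) (by omega) w).trans ?_
        rw [min_eq_left hw, norm_mul]
        gcongr
        · exact F.bound _
        · exact F.bound _
      · rw [indicator_of_notMem hw, norm_zero]
        positivity
    · rw [tendsto_add_atTop_iff_nat (f := fun n => (near n).indicator (G n) w)]
      have hs0 : Tendsto (fun n : ℕ => (√(n : ℝ))⁻¹) atTop (𝓝 0) :=
        tendsto_inv_atTop_zero.comp (Real.tendsto_sqrt_atTop.comp tendsto_natCast_atTop_atTop)
      have hb0 : Tendsto (fun n : ℕ => ((n : ℝ) * √(n : ℝ))⁻¹) atTop (𝓝 0) := by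
        have := (tendsto_inv_atTop_nhds_zero_nat (𝕜 := ℝ)).mul hs0
        rw [mul_zero] at this
        refine this.congr fun n => ?_
        rw [mul_inv]
      have hX : Tendsto (fun n : ℕ => (√(n : ℝ))⁻¹ * w.1) atTop (𝓝 0) := by
        simpa using hs0.mul_const w.1
      have hY : Tendsto (fun n : ℕ => ((n : ℝ) * √(n : ℝ))⁻¹ * w.2) atTop (𝓝 0) := by
        simpa using hb0.mul_const w.2
      have hXY := hX.add hY
      rw [add_zero] at hXY
      have hτ1 : Tendsto (fun n : ℕ => F.τ ((√(n : ℝ))⁻¹ * w.1)) atTop (𝓝 F.ρ) := by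
        rw [← F.apply_zero]; exact (F.cont.tendsto 0).comp hX
      have hτ2 : Tendsto (fun n : ℕ => F.τ ((√(n : ℝ))⁻¹ * w.1 + ((n : ℝ) * √(n : ℝ))⁻¹ * w.2))
          atTop (𝓝 F.ρ) := by
        rw [← F.apply_zero]; exact (F.cont.tendsto 0).comp hXY
      have hbd : ∀ {u v : ℕ → ℝ}, Tendsto u atTop (𝓝 0) → (∀ n, |v n| ≤ L) →
          Tendsto (fun n => u n * v n) atTop (𝓝 0) := by
        intro u v hu hv
        refine squeeze_zero_norm (a := fun n => |u n| * L) (fun n => ?_) ?_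
        · rw [Real.norm_eq_abs, abs_mul]
          exact mul_le_mul_of_nonneg_left (hv n) (abs_nonneg _)
        · simpa using hu.abs.mul_const L
      have hph : Tendsto (fun n : ℕ => unitChar (((√(n : ℝ))⁻¹ * w.1 -
          n * (((n : ℝ) * √(n : ℝ))⁻¹ * w.2)) * a n +
          (((n : ℝ) + 1) * (((n : ℝ) * √(n : ℝ))⁻¹ * w.2) - (√(n : ℝ))⁻¹ * w.1) * 0 +
          ((√(n : ℝ))⁻¹ * w.1 + ((n : ℝ) * √(n : ℝ))⁻¹ * w.2) * c n)) atTop (𝓝 1) := by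
        rw [← unitChar_zero]
        refine (continuous_unitChar.tendsto 0).comp ?_
        have hu : Tendsto (fun n : ℕ => (√(n : ℝ))⁻¹ * w.1 -
            n * (((n : ℝ) * √(n : ℝ))⁻¹ * w.2)) atTop (𝓝 0) := by
          have : Tendsto (fun n : ℕ => (√(n : ℝ))⁻¹ * (w.1 - w.2)) atTop (𝓝 0) := by
            simpa using hs0.mul_const (w.1 - w.2)
          refine this.congr' ?_
          filter_upwards [eventually_ge_atTop 1] with n hn
          have hn' : (n : ℝ) ≠ 0 := by positivity
          field_simp
        have := (hbd hu ha).add (hbd hXY hc)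
        rw [add_zero] at this
        refine this.congr fun n => ?_
        ring
      have hlim := ((hτ1.mul hτ2).mul
        (tendsto_prod_densityChar h hσ hmean hvar w.1 w.2)).mul hph
      rw [mul_one] at hlim
      refine hlim.congr' ?_
      filter_upwards [tendsto_natCast_atTop_atTop.eventually_ge_atTop (w.1 ^ 2 + w.2 ^ 2)]
        with n hn
      rw [indicator_of_mem (show w ∈ near n from hn)]
      rfl
  have h2 : Tendsto (fun n => ∫ w, (near n)ᶜ.indicator (G n) w) atTop (𝓝 0) := by
    set D := ∫ z : ℝ × ℝ, ‖F.τ z.1 * F.τ (z.1 + z.2)‖ with hD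
    have hlim : Tendsto (fun n : ℕ => ((n : ℝ) ^ 2 * Real.exp (-κ * n)) * D) atTop (𝓝 0) := by
      have := (tendsto_rpow_mul_exp_neg_mul_atTop_nhds_zero 2 κ hκ).comp
        tendsto_natCast_atTop_atTop
      simpa [Function.comp_def] using this.mul_const D
    refine squeeze_zero_norm' ?_ hlim
    filter_upwards [eventually_ge_atTop 2] with n hn
    have hp := hpos n (by omega)
    have hint := integrable_comp_scale hp.1 hp.2 F.integrable_tau_mul.norm
    refine (norm_integral_le_of_norm_le (hint.mul_const (Real.exp (-κ * n)))
      (Eventually.of_forall fun w => ?_)).trans (le_of_eq ?_)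
    · by_cases hw : w ∈ (near n)ᶜ
      · rw [indicator_of_mem hw]
        refine (hGle n hn w).trans ?_
        have hw' : (n : ℝ) ≤ w.1 ^ 2 + w.2 ^ 2 :=
          (not_le.1 (show ¬ w.1 ^ 2 + w.2 ^ 2 ≤ (n : ℝ) from hw)).le
        rw [min_eq_right hw']
      · rw [indicator_of_notMem hw, norm_zero]
        positivity
    · rw [integral_mul_const, integral_comp_scale hp.1 hp.2
        (fun z => ‖F.τ z.1 * F.τ (z.1 + z.2)‖), hdet n (by omega), smul_eq_mul]
      ring
  have h3 := h1.add h2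
  rw [add_zero] at h3
  refine h3.congr' ?_
  filter_upwards [eventually_ge_atTop 1] with n hn
  rw [← hGeq n hn, ← integral_add ((hGint n hn).indicator (hnm n))
    ((hGint n hn).indicator (hnm n).compl)]
  refine integral_congr_ae (Eventually.of_forall fun w => ?_)
  exact congrFun (indicator_self_add_compl (near n) (G n)) w

end FourierMinorant

lemma integral_gauss_form_pos {A : ℝ} (hA : 0 < A) :
    0 < ∫ w : ℝ × ℝ, Real.exp (-(A * (w.2 ^ 2 / 3 - w.1 * w.2 + w.1 ^ 2))) := by
  refine integral_exp_pos ?_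
  refine (integrable_exp_neg_sq_add_sq (κ := A / 24) (by positivity)).mono'
    (by fun_prop) (Eventually.of_forall fun w => ?_)
  rw [Real.norm_of_nonneg (Real.exp_pos _).le, Real.exp_le_exp]
  nlinarith [sq_nonneg (w.2 - 12 / 7 * w.1), mul_nonneg hA.le (sq_nonneg (w.2 - 12 / 7 * w.1)),
    mul_nonneg hA.le (sq_nonneg w.1)]

/-- Uniform local lower bound for the free partition function with bounded boundary data. -/
lemma IsBoundedDensity.exists_pathSum_ge {E : ℝ → ℝ} {M : ℝ} (h : IsBoundedDensity E M)
    {σ : ℝ} (hσ : 0 < σ) (hmean : ∫ x, x * E x = 0) (hvar : ∫ x, x ^ 2 * E x = σ ^ 2)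
    {L : ℝ} (hL : 0 ≤ L) :
    ∃ d : ℝ, 0 < d ∧ ∃ n₀ : ℕ, ∀ n ≥ n₀, ∀ a c : ℝ, |a| ≤ L → |c| ≤ L →
      ENNReal.ofReal (d / n ^ 2) ≤
        pathSum (fun x => ENNReal.ofReal (E (x + c))) volume n (fun _ => lapWeight E) a 0 := by
  obtain ⟨F⟩ := h.exists_fourierMinorant
  set A := 2 * Real.pi ^ 2 * σ ^ 2 with hA
  have hApos : 0 < A := by positivity
  have hIpos := integral_gauss_form_pos hApos
  set I := ∫ w : ℝ × ℝ, Real.exp (-(A * (w.2 ^ 2 / 3 - w.1 * w.2 + w.1 ^ 2))) with hI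
  have hval : ∫ w : ℝ × ℝ, (F.ρ : ℂ) * F.ρ * Complex.exp
        (-(A * (w.2 ^ 2 / 3 - w.1 * w.2 + w.1 ^ 2) : ℝ)) = ((F.ρ * F.ρ * I : ℝ) : ℂ) := by
    rw [hI, ← integral_const_mul, ← integral_complex_ofReal]
    refine integral_congr_ae (Eventually.of_forall fun w => ?_)
    push_cast
    rfl
  set Λ := F.ρ * F.ρ * I with hΛ
  have hρ := F.ρ_pos
  have hΛpos : 0 < Λ := by positivity
  have hev : ∃ n₀ : ℕ, ∀ n ≥ n₀, ∀ a c : ℝ, |a| ≤ L → |c| ≤ L →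
      Λ / 2 ≤ (n : ℝ) ^ 2 * (F.freeInt c n a 0).re := by
    let bad : ℕ → ℝ × ℝ → Prop := fun n q =>
      |q.1| ≤ L ∧ |q.2| ≤ L ∧ (n : ℝ) ^ 2 * (F.freeInt q.2 n q.1 0).re < Λ / 2
    have hch : ∀ n, ∃ q : ℝ × ℝ, |q.1| ≤ L ∧ |q.2| ≤ L ∧ ((∃ q', bad n q') → bad n q) := by
      intro n
      by_cases hb : ∃ q', bad n q'
      · obtain ⟨q, hq⟩ := hb
        exact ⟨q, hq.1, hq.2.1, fun _ => hq⟩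
      · exact ⟨0, by simpa using hL, by simpa using hL, fun h' => absurd h' hb⟩
    choose q hq1 hq2 hq3 using hch
    have hlim := F.tendsto_freeInt h hσ hmean hvar hq1 hq2
    rw [hval] at hlim
    have hre := (Complex.continuous_re.tendsto _).comp hlim
    rw [Complex.ofReal_re] at hre
    obtain ⟨n₀, hn₀⟩ := eventually_atTop.1
      (hre.eventually (lt_mem_nhds (show Λ / 2 < Λ by linarith)))
    refine ⟨n₀, fun n hn a c ha hc => ?_⟩
    by_contra hcon
    have hb := hq3 n ⟨(a, c), ha, hc, not_le.1 hcon⟩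
    have := hn₀ n hn
    simp only [Function.comp_apply, Complex.real_smul, Complex.re_ofReal_mul] at this
    exact lt_asymm this hb.2.2
  obtain ⟨n₀, hn₀⟩ := hev
  have hc₀ := F.c₀_pos
  refine ⟨F.c₀ ^ 2 * (Λ / 2), by positivity, max n₀ 1, fun n hn a c ha hc => ?_⟩
  refine le_trans (ENNReal.ofReal_le_ofReal ?_) (F.le_pathSum h c n a 0)
  have h1 := hn₀ n (le_of_max_le_left hn) a c ha hc
  have hn1 : (0 : ℝ) < n := by exact_mod_cast le_of_max_le_right hn
  rw [mul_div_assoc]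
  refine mul_le_mul_of_nonneg_left ?_ (by positivity)
  rw [div_le_iff₀ (by positivity)]
  linarith

/-- Weight of the excursions away from `0` that start from the heights `a, b` and return to `0`
after `n + 1` steps, with `f` evaluated at the height preceding the return. -/
def gapSum (E : ℝ → ℝ) (f : ℝ → ℝ≥0∞) (n : ℕ) (a b : ℝ) : ℝ≥0∞ :=
  pathSum f volume n (fun _ => lapWeight E) a b

/-- Integral of the gap weights over the first height after a contact. -/
def gapEntry (E : ℝ → ℝ) (L : ℝ) (f : ℝ → ℝ≥0∞) : ℕ → ℝ≥0∞
  | 0 => f 0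
  | n + 1 => ∫⁻ c in {c | |c| ≤ L}, gapSum E f n 0 c

/-- The pinning kernel with a reward for contacts whose neighbours have height at most `L`. -/
def tiltWeight (E : ℝ → ℝ) (κ : ℝ≥0∞) (L a b c : ℝ) : ℝ≥0∞ :=
  lapWeight E a b c * (if b = 0 ∧ |a| ≤ L ∧ |c| ≤ L then 1 + κ else 1)

/-- The partition function with rewards. -/
def tiltSum (E : ℝ → ℝ) (ε : ℝ) (κ : ℝ≥0∞) (L : ℝ) (m : ℕ) (a b : ℝ) : ℝ≥0∞ :=
  pathSum (fun x => ENNReal.ofReal (E x)) (pinFactor ε) m (fun _ => tiltWeight E κ L) a b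

/-- The weights that drive the renewal decomposition at the contacts. -/
def contactSeq (E : ℝ → ℝ) (ε : ℝ) (κ : ℝ≥0∞) (L : ℝ) : ℕ → ℝ → ℝ≥0∞
  | 0 => fun x => ENNReal.ofReal (E x)
  | j + 1 => fun a => ENNReal.ofReal ε * tiltSum E ε κ L j a 0

lemma gapSum_succ (E : ℝ → ℝ) (f : ℝ → ℝ≥0∞) (n : ℕ) (a b : ℝ) :
    gapSum E f (n + 1) a b = ∫⁻ c, lapWeight E a b c * gapSum E f n b c := rfl

lemma gapSum_mono (E : ℝ → ℝ) {f g : ℝ → ℝ≥0∞} (hfg : ∀ x, f x ≤ g x) (n : ℕ) (a b : ℝ) :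
    gapSum E f n a b ≤ gapSum E g n a b := by
  induction n generalizing a b with
  | zero => exact mul_le_mul_right (hfg b) _
  | succ n ih =>
    rw [gapSum_succ, gapSum_succ]
    exact lintegral_mono fun c => mul_le_mul_right (ih b c) _

lemma gapEntry_mono (E : ℝ → ℝ) (L : ℝ) {f g : ℝ → ℝ≥0∞} (hfg : ∀ x, f x ≤ g x) (n : ℕ) :
    gapEntry E L f n ≤ gapEntry E L g n := by
  cases n with
  | zero => exact hfg 0
  | succ n => exact lintegral_mono fun c => gapSum_mono E hfg n 0 c

lemma tiltWeight_zero (E : ℝ → ℝ) (L : ℝ) : tiltWeight E 0 L = lapWeight E := by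
  funext a b c
  simp [tiltWeight]

lemma tiltSum_zero (E : ℝ → ℝ) (ε L : ℝ) (m : ℕ) (a b : ℝ) :
    tiltSum E ε 0 L m a b = pinSum E ε m a b := by
  rw [tiltSum, tiltWeight_zero, pinSum]

lemma ENNReal.tsum_sum_antidiagonal (F : ℕ → ℕ → ℝ≥0∞) :
    ∑' m, ∑ p ∈ Finset.HasAntidiagonal.antidiagonal m, F p.1 p.2 = ∑' n, ∑' i, F n i := by
  rw [← ENNReal.tsum_prod, ← (Finset.HasAntidiagonal.sigmaAntidiagonalEquivProd (A := ℕ)).tsum_eq,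
    ENNReal.tsum_sigma']
  refine tsum_congr fun m => ?_
  rw [tsum_fintype, ← Finset.sum_coe_sort]
  rfl

namespace IsBoundedDensity

variable {E : ℝ → ℝ} {M : ℝ}

lemma measurable_gapSum_param (h : IsBoundedDensity E M) {X : Type*} [MeasurableSpace X]
    {k : ℝ → X → ℝ≥0∞} (hk : Measurable fun p : ℝ × X => k p.1 p.2) (n : ℕ) :
    Measurable fun p : ℝ × ℝ × X => gapSum E (fun x => k x p.2.2) n p.1 p.2.1 := by
  induction n with
  | zero =>
    refine Measurable.mul (h.measurable_lapWeight.comp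
      (by fun_prop : Measurable fun p : ℝ × ℝ × X => (p.1, p.2.1, (0 : ℝ)))) ?_
    exact hk.comp (by fun_prop : Measurable fun p : ℝ × ℝ × X => p.2)
  | succ n ih =>
    simp only [gapSum_succ]
    refine Measurable.lintegral_prod_right' (f := fun q : (ℝ × ℝ × X) × ℝ =>
      lapWeight E q.1.1 q.1.2.1 q.2 * gapSum E (fun x => k x q.1.2.2) n q.1.2.1 q.2) ?_
    refine Measurable.mul (h.measurable_lapWeight.comp
      (by fun_prop : Measurable fun q : (ℝ × ℝ × X) × ℝ => (q.1.1, q.1.2.1, q.2))) ?_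
    exact ih.comp (by fun_prop : Measurable fun q : (ℝ × ℝ × X) × ℝ => (q.1.2.1, q.2, q.1.2.2))

lemma measurable_gapSum (h : IsBoundedDensity E M) {f : ℝ → ℝ≥0∞} (hf : Measurable f) (n : ℕ) :
    Measurable fun p : ℝ × ℝ => gapSum E f n p.1 p.2 :=
  measurable_pathSum hf n fun _ => h.measurable_lapWeight

lemma measurable_lapWeight_right (h : IsBoundedDensity E M) (a b : ℝ) :
    Measurable (lapWeight E a b) :=
  h.measurable_lapWeight.comp (by fun_prop : Measurable fun c : ℝ => (a, b, c))

lemma measurable_gapSum_right (h : IsBoundedDensity E M) {f : ℝ → ℝ≥0∞} (hf : Measurable f) (n : ℕ)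
    (a : ℝ) : Measurable fun c => gapSum E f n a c :=
  (h.measurable_gapSum hf n).comp (by fun_prop : Measurable fun c : ℝ => (a, c))

lemma measurable_gapSum_left (h : IsBoundedDensity E M) {f : ℝ → ℝ≥0∞} (hf : Measurable f) (n : ℕ)
    (b : ℝ) : Measurable fun a => gapSum E f n a b :=
  (h.measurable_gapSum hf n).comp (by fun_prop : Measurable fun a : ℝ => (a, b))

lemma gapSum_lintegral (h : IsBoundedDensity E M) {X : Type*} [MeasurableSpace X] (ν : Measure X)
    [SFinite ν] {k : ℝ → X → ℝ≥0∞} (hk : Measurable fun p : ℝ × X => k p.1 p.2) (n : ℕ) (a b : ℝ) :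
    gapSum E (fun x => ∫⁻ c, k x c ∂ν) n a b = ∫⁻ c, gapSum E (fun x => k x c) n a b ∂ν := by
  induction n generalizing a b with
  | zero =>
    simp only [gapSum, pathSum]
    rw [lintegral_const_mul]
    exact hk.comp (by fun_prop : Measurable fun c : X => (b, c))
  | succ n ih =>
    simp only [gapSum_succ, ih]
    have hm := (h.measurable_gapSum_param hk n).comp
      (by fun_prop : Measurable fun q : ℝ × X => (b, q.1, q.2))
    rw [lintegral_lintegral_swap]
    · refine lintegral_congr fun y => ?_
      rw [lintegral_const_mul]
      exact hm.comp (by fun_prop : Measurable fun c : X => (y, c))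
    · refine (Measurable.mul ?_ ?_).aemeasurable
      · exact (h.measurable_lapWeight_right a b).comp
          (by fun_prop : Measurable fun q : X × ℝ => q.2)
      · exact hm.comp (by fun_prop : Measurable fun q : X × ℝ => (q.2, q.1))

lemma gapSum_const_mul (h : IsBoundedDensity E M) (r : ℝ≥0∞) {f : ℝ → ℝ≥0∞} (hf : Measurable f)
    (n : ℕ) (a b : ℝ) : gapSum E (fun x => r * f x) n a b = r * gapSum E f n a b := by
  induction n generalizing a b with
  | zero => simp only [gapSum, pathSum]; ring
  | succ n ih =>
    simp only [gapSum_succ, ih]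
    rw [← lintegral_const_mul]
    · refine lintegral_congr fun c => ?_
      ring
    · exact (h.measurable_lapWeight_right a b).mul (h.measurable_gapSum_right hf n b)

lemma gapSum_tsum (h : IsBoundedDensity E M) {f : ℕ → ℝ → ℝ≥0∞} (hf : ∀ i, Measurable (f i))
    (n : ℕ) (a b : ℝ) :
    gapSum E (fun x => ∑' i, f i x) n a b = ∑' i, gapSum E (f i) n a b := by
  have := h.gapSum_lintegral Measure.count (k := fun x i => f i x)
    (measurable_from_prod_countable_left fun i => hf i) n a b
  simpa only [lintegral_count] using this

lemma gapEntry_tsum (h : IsBoundedDensity E M) (L : ℝ) {f : ℕ → ℝ → ℝ≥0∞}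
    (hf : ∀ i, Measurable (f i)) (n : ℕ) :
    gapEntry E L (fun x => ∑' i, f i x) n = ∑' i, gapEntry E L (f i) n := by
  cases n with
  | zero => rfl
  | succ n =>
    simp only [gapEntry, h.gapSum_tsum hf]
    exact lintegral_tsum fun i => (h.measurable_gapSum_right (hf i) n 0).aemeasurable

lemma gapEntry_const_mul (h : IsBoundedDensity E M) (L : ℝ) (r : ℝ≥0∞) {f : ℝ → ℝ≥0∞}
    (hf : Measurable f) (n : ℕ) :
    gapEntry E L (fun x => r * f x) n = r * gapEntry E L f n := by
  cases n with
  | zero => rfl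
  | succ n =>
    simp only [gapEntry, h.gapSum_const_mul r hf]
    exact lintegral_const_mul _ (h.measurable_gapSum_right hf n 0)

lemma measurable_tiltWeight (h : IsBoundedDensity E M) (κ : ℝ≥0∞) (L : ℝ) :
    Measurable fun p : ℝ × ℝ × ℝ => tiltWeight E κ L p.1 p.2.1 p.2.2 := by
  unfold tiltWeight
  refine h.measurable_lapWeight.mul (Measurable.ite ?_ measurable_const measurable_const)
  refine MeasurableSet.inter ?_ (MeasurableSet.inter ?_ ?_)
  · exact measurableSet_eq_fun (by fun_prop) measurable_const
  · exact measurableSet_le (f := fun p : ℝ × ℝ × ℝ => |p.1|) (by fun_prop) measurable_const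
  · exact measurableSet_le (f := fun p : ℝ × ℝ × ℝ => |p.2.2|) (by fun_prop) measurable_const

lemma measurable_contactSeq (h : IsBoundedDensity E M) (ε : ℝ) (κ : ℝ≥0∞) (L : ℝ) (j : ℕ) :
    Measurable (contactSeq E ε κ L j) := by
  cases j with
  | zero => exact h.measurable_ofReal
  | succ j =>
    refine Measurable.const_mul ?_ _
    exact (measurable_pathSum h.measurable_ofReal j fun _ => h.measurable_tiltWeight κ L).comp
      (by fun_prop : Measurable fun a : ℝ => (a, (0 : ℝ)))

lemma tiltSum_succ (_h : IsBoundedDensity E M) (ε : ℝ) (κ : ℝ≥0∞) (L : ℝ) (m : ℕ) (a b : ℝ) :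
    tiltSum E ε κ L (m + 1) a b = tiltWeight E κ L a b 0 * contactSeq E ε κ L (m + 1) b +
      ∫⁻ c, tiltWeight E κ L a b c * tiltSum E ε κ L m b c := by
  have : tiltSum E ε κ L (m + 1) a b =
    ∫⁻ c, tiltWeight E κ L a b c * tiltSum E ε κ L m b c ∂(pinFactor ε) := rfl
  rw [this, lintegral_pinFactor, contactSeq]
  ring

lemma lintegral_mul_sum_gapSum (h : IsBoundedDensity E M) (ε : ℝ) (κ : ℝ≥0∞) (L : ℝ) (m : ℕ)
    (a b : ℝ) :
    ∫⁻ c, lapWeight E a b c * ∑ p ∈ Finset.HasAntidiagonal.antidiagonal m,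
      gapSum E (contactSeq E ε κ L p.2) p.1 b c =
      ∑ p ∈ Finset.HasAntidiagonal.antidiagonal m,
        gapSum E (contactSeq E ε κ L p.2) (p.1 + 1) a b := by
  simp only [Finset.mul_sum]
  rw [lintegral_finsetSum]
  · rfl
  · exact fun p _ => (h.measurable_lapWeight_right a b).mul
      (h.measurable_gapSum_right (h.measurable_contactSeq ε κ L p.2) p.1 b)

lemma le_tiltSum (h : IsBoundedDensity E M) (ε : ℝ) (κ : ℝ≥0∞) (L : ℝ) (m : ℕ) (a b : ℝ) :
    ∑ p ∈ Finset.HasAntidiagonal.antidiagonal m, gapSum E (contactSeq E ε κ L p.2) p.1 a b ≤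
      tiltSum E ε κ L m a b := by
  have hle : ∀ a b c, lapWeight E a b c ≤ tiltWeight E κ L a b c := by
    intro a b c
    unfold tiltWeight
    split_ifs
    · exact le_mul_of_one_le_right' le_self_add
    · rw [mul_one]
  induction m generalizing a b with
  | zero =>
    simp only [Finset.Nat.antidiagonal_zero, Finset.sum_singleton]
    exact mul_le_mul_left (hle a b 0) _
  | succ m ih =>
    rw [Finset.Nat.sum_antidiagonal_succ, h.tiltSum_succ, ← h.lintegral_mul_sum_gapSum]
    refine add_le_add (mul_le_mul_left (hle a b 0) _) (lintegral_mono fun c => ?_)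
    exact mul_le_mul' (hle a b c) (ih b c)

lemma tiltSum_le_of_ne (h : IsBoundedDensity E M) (ε : ℝ) (κ : ℝ≥0∞) (L : ℝ) (m : ℕ) (a : ℝ) {b : ℝ}
    (hb : b ≠ 0) :
    tiltSum E ε κ L m a b ≤
      ∑ p ∈ Finset.HasAntidiagonal.antidiagonal m, gapSum E (contactSeq E ε κ L p.2) p.1 a b := by
  have heq : ∀ a c, tiltWeight E κ L a b c = lapWeight E a b c := by
    intro a c
    simp [tiltWeight, hb]
  induction m generalizing a b with
  | zero =>
    simp only [Finset.Nat.antidiagonal_zero, Finset.sum_singleton]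
    exact mul_le_mul_left (heq a 0).le _
  | succ m ih =>
    rw [Finset.Nat.sum_antidiagonal_succ, h.tiltSum_succ, ← h.lintegral_mul_sum_gapSum]
    refine add_le_add (mul_le_mul_left (heq a 0).le _) (lintegral_mono_ae ?_)
    filter_upwards [Measure.ae_ne volume (0 : ℝ)] with c hc
    exact mul_le_mul' (heq a c).le (ih b hc fun a c' => by simp [tiltWeight, hc])

/-- The reward at a contact is controlled by the entry weights of the following gaps. -/
lemma tiltSum_zero_right_le (h : IsBoundedDensity E M) (ε : ℝ) (κ : ℝ≥0∞) {L : ℝ} (hL : 0 ≤ L)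
    (m : ℕ) (a : ℝ) :
    tiltSum E ε κ L m a 0 ≤
      ∑ p ∈ Finset.HasAntidiagonal.antidiagonal m, (gapSum E (contactSeq E ε κ L p.2) p.1 a 0 +
        if |a| ≤ L then κ * ENNReal.ofReal M *
          gapEntry E L (contactSeq E ε κ L p.2) p.1 else 0) := by
  have hw : ∀ c, tiltWeight E κ L a 0 c ≤ lapWeight E a 0 c +
      if |a| ≤ L ∧ |c| ≤ L then κ * ENNReal.ofReal M else 0 := by
    intro c
    by_cases hc : |a| ≤ L ∧ |c| ≤ L
    · simp only [tiltWeight, hc, and_self, if_true]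
      rw [mul_add, mul_one, mul_comm κ]
      exact add_le_add le_rfl (mul_le_mul_left (h.lapWeight_le _ _ _) _)
    · have : ¬ ((0 : ℝ) = 0 ∧ |a| ≤ L ∧ |c| ≤ L) := fun h' => hc h'.2
      rw [tiltWeight, if_neg hc, if_neg this, mul_one, add_zero]
  by_cases ha : |a| ≤ L
  swap
  · simp only [ha, if_false, add_zero, false_and] at hw ⊢
    cases m with
    | zero =>
      simp only [Finset.Nat.antidiagonal_zero, Finset.sum_singleton]
      exact mul_le_mul_left (hw 0) _
    | succ m =>
      rw [Finset.Nat.sum_antidiagonal_succ, h.tiltSum_succ, ← h.lintegral_mul_sum_gapSum]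
      refine add_le_add (mul_le_mul_left (hw 0) _) (lintegral_mono_ae ?_)
      filter_upwards [Measure.ae_ne volume (0 : ℝ)] with c hc
      exact mul_le_mul' (hw c) (h.tiltSum_le_of_ne ε κ L m 0 hc)
  · simp only [ha, if_true, true_and] at hw ⊢
    have hw0 := hw 0
    rw [if_pos (by simpa using hL)] at hw0
    cases m with
    | zero =>
      simp only [Finset.Nat.antidiagonal_zero, Finset.sum_singleton]
      refine (mul_le_mul_left hw0 _).trans (le_of_eq ?_)
      rw [add_mul]
      rfl
    | succ m =>
      rw [Finset.Nat.sum_antidiagonal_succ, h.tiltSum_succ, Finset.sum_add_distrib,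
        ← h.lintegral_mul_sum_gapSum, ← Finset.mul_sum]
      have h1 : tiltWeight E κ L a 0 0 * contactSeq E ε κ L (m + 1) 0 ≤
          gapSum E (contactSeq E ε κ L (m + 1)) 0 a 0 + κ * ENNReal.ofReal M *
            gapEntry E L (contactSeq E ε κ L (m + 1)) 0 := by
        refine (mul_le_mul_left hw0 _).trans (le_of_eq ?_)
        rw [add_mul]
        rfl
      have hms : MeasurableSet {c : ℝ | |c| ≤ L} :=
        measurableSet_le (by fun_prop) measurable_const
      have hmsum : Measurable fun c => ∑ p ∈ Finset.HasAntidiagonal.antidiagonal m,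
          gapSum E (contactSeq E ε κ L p.2) p.1 0 c := Finset.measurable_sum _ fun p _ =>
        h.measurable_gapSum_right (h.measurable_contactSeq ε κ L p.2) p.1 0
      have h2 : ∫⁻ c, tiltWeight E κ L a 0 c * tiltSum E ε κ L m 0 c ≤
          (∫⁻ c, lapWeight E a 0 c * ∑ p ∈ Finset.HasAntidiagonal.antidiagonal m,
            gapSum E (contactSeq E ε κ L p.2) p.1 0 c) + κ * ENNReal.ofReal M *
            ∑ p ∈ Finset.HasAntidiagonal.antidiagonal m,
              gapEntry E L (contactSeq E ε κ L p.2) (p.1 + 1) := by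
        calc _ ≤ ∫⁻ c, (lapWeight E a 0 c * (∑ p ∈ Finset.HasAntidiagonal.antidiagonal m,
              gapSum E (contactSeq E ε κ L p.2) p.1 0 c) + {c : ℝ | |c| ≤ L}.indicator
                (fun c => κ * ENNReal.ofReal M * ∑ p ∈ Finset.HasAntidiagonal.antidiagonal m,
                  gapSum E (contactSeq E ε κ L p.2) p.1 0 c) c) := by
              refine lintegral_mono_ae ?_
              filter_upwards [Measure.ae_ne volume (0 : ℝ)] with c hc
              refine (mul_le_mul' (hw c) (h.tiltSum_le_of_ne ε κ L m 0 hc)).trans (le_of_eq ?_)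
              rw [add_mul, indicator_apply]
              simp only [mem_ofPred_eq]
              split_ifs <;> simp
          _ = _ := by
              rw [lintegral_add_left (by exact (h.measurable_lapWeight_right a 0).mul hmsum),
                lintegral_indicator hms, lintegral_const_mul _ hmsum,
                lintegral_finsetSum _ fun p _ =>
                  h.measurable_gapSum_right (h.measurable_contactSeq ε κ L p.2) p.1 0]
              rfl
      refine (add_le_add h1 h2).trans (le_of_eq ?_)
      ring

end IsBoundedDensity

/-- Generating function of the contact weights without reward. -/
def contactGen (E : ℝ → ℝ) (ε L : ℝ) (y : ℝ≥0∞) (a : ℝ) : ℝ≥0∞ :=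
  ∑' j, y ^ j * contactSeq E ε 0 L j a

namespace IsBoundedDensity

variable {E : ℝ → ℝ} {M : ℝ}

lemma mul_gapEntry_le (h : IsBoundedDensity E M) {L : ℝ} (hL : 0 ≤ L) {m : ℕ} {a : ℝ} {Q : ℝ≥0∞}
    (hQ : ∀ c, |c| ≤ L → Q ≤ gapSum E (fun x => ENNReal.ofReal (E (x + c))) m a 0)
    {f : ℝ → ℝ≥0∞} (hf : Measurable f) (n : ℕ) :
    Q * gapEntry E L f n ≤ gapSum E (fun a' => gapSum E f n a' 0) m a 0 := by
  have hlap : ∀ x c, lapWeight E x 0 c = ENNReal.ofReal (E (x + c)) := by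
    intro x c
    rw [lapWeight, mul_zero, sub_zero, add_comm]
  have hmE : ∀ c, Measurable fun x => ENNReal.ofReal (E (x + c)) := fun c =>
    h.measurable_ofReal.comp (by fun_prop : Measurable fun x : ℝ => x + c)
  have hswap : ∀ (r : ℝ≥0∞) (c : ℝ), gapSum E (fun x => lapWeight E x 0 c * r) m a 0 =
      gapSum E (fun x => ENNReal.ofReal (E (x + c))) m a 0 * r := by
    intro r c
    simp only [hlap, mul_comm _ r]
    exact h.gapSum_const_mul r (hmE c) m a 0
  cases n with
  | zero =>
    have : (fun a' => gapSum E f 0 a' 0) = fun a' => lapWeight E a' 0 0 * f 0 := rfl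
    rw [this, hswap]
    exact mul_le_mul_left (hQ 0 (by simpa using hL)) _
  | succ n =>
    simp only [gapSum_succ E f n]
    have hg := h.measurable_gapSum_right hf n 0
    rw [h.gapSum_lintegral volume (k := fun x c => lapWeight E x 0 c * gapSum E f n 0 c)]
    · simp only [hswap, gapEntry]
      rw [← lintegral_const_mul _ hg]
      refine (setLIntegral_mono_ae' ?_ ?_).trans (setLIntegral_le_lintegral {c | |c| ≤ L} _)
      · exact measurableSet_le (by fun_prop) measurable_const
      · exact Eventually.of_forall fun c hc => mul_le_mul_left (hQ c hc) _
    · refine Measurable.mul (h.measurable_lapWeight.comp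
        (by fun_prop : Measurable fun p : ℝ × ℝ => (p.1, (0 : ℝ), p.2))) ?_
      exact hg.comp measurable_snd

lemma measurable_pow_mul_contactSeq (h : IsBoundedDensity E M) (ε : ℝ) (κ : ℝ≥0∞) (L : ℝ)
    (y : ℝ≥0∞) (j : ℕ) : Measurable fun a => y ^ j * contactSeq E ε κ L j a :=
  (h.measurable_contactSeq ε κ L j).const_mul _

lemma measurable_contactGen (h : IsBoundedDensity E M) (ε L : ℝ) (y : ℝ≥0∞) :
    Measurable (contactGen E ε L y) :=
  Measurable.tsum fun j => h.measurable_pow_mul_contactSeq ε 0 L y j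

/-- Renewal inequality for the generating function of the contact weights. -/
lemma le_contactGen (h : IsBoundedDensity E M) (ε L : ℝ) (y : ℝ≥0∞) (a : ℝ) :
    ENNReal.ofReal (E a) + ENNReal.ofReal ε *
      ∑' n, y ^ (n + 1) * gapSum E (contactGen E ε L y) n a 0 ≤ contactGen E ε L y a := by
  have hgen : ∀ n, gapSum E (contactGen E ε L y) n a 0 =
      ∑' i, y ^ i * gapSum E (contactSeq E ε 0 L i) n a 0 := by
    intro n
    refine (h.gapSum_tsum (fun i => h.measurable_pow_mul_contactSeq ε 0 L y i) n a 0).trans ?_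
    exact tsum_congr fun i => h.gapSum_const_mul _ (h.measurable_contactSeq ε 0 L i) n a 0
  simp only [hgen, ← ENNReal.tsum_mul_left]
  rw [← ENNReal.tsum_sum_antidiagonal (fun n i => ENNReal.ofReal ε * (y ^ (n + 1) *
    (y ^ i * gapSum E (contactSeq E ε 0 L i) n a 0))), contactGen,
    tsum_eq_zero_add' (f := fun j => y ^ j * contactSeq E ε 0 L j a) ENNReal.summable]
  refine add_le_add ?_ (ENNReal.tsum_le_tsum fun j => ?_)
  · rw [pow_zero, one_mul, contactSeq]
  rw [contactSeq]
  refine le_trans (le_of_eq ?_) (mul_le_mul_right (mul_le_mul_right (h.le_tiltSum ε 0 L j a 0) _) _)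
  rw [Finset.mul_sum, Finset.mul_sum]
  refine Finset.sum_congr rfl fun p hp => ?_
  rw [← Finset.HasAntidiagonal.mem_antidiagonal.1 hp]
  ring

/-- Rewarding the contacts with small neighbours is compensated by a change of the exponential
rate, as soon as the gaps provide enough entropy. -/
lemma sum_contactSeq_le (h : IsBoundedDensity E M) {ε L : ℝ} (hL : 0 ≤ L) {κ x y : ℝ≥0∞}
    {D Q : ℕ → ℝ≥0∞} (hxy : ∀ n, x ^ (n + 1) + D n ≤ y ^ (n + 1))
    (hQ : ∀ m a c, |a| ≤ L → |c| ≤ L →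
      Q m ≤ gapSum E (fun z => ENNReal.ofReal (E (z + c))) m a 0)
    (hκ : κ * ENNReal.ofReal M ≤ ENNReal.ofReal ε * ∑' m, D m * Q m) (J : ℕ) (a : ℝ) :
    ∑ j ∈ Finset.range J, x ^ j * contactSeq E ε κ L j a ≤ contactGen E ε L y a := by
  set g := contactGen E ε L y with hg
  have hgm : Measurable g := h.measurable_contactGen ε L y
  set S := ∑' n, x ^ (n + 1) * gapEntry E L g n with hS
  -- lower bound for the gap weights seen from a small height
  have hlow : ∀ a, |a| ≤ L → ∀ m, Q m * (ENNReal.ofReal ε * S) ≤ gapSum E g m a 0 := by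
    intro a ha m
    have hmeas : ∀ n, Measurable fun a' => gapSum E g n a' 0 := fun n =>
      h.measurable_gapSum_left hgm n 0
    calc Q m * (ENNReal.ofReal ε * S)
        = ENNReal.ofReal ε * ∑' n, x ^ (n + 1) * (Q m * gapEntry E L g n) := by
          rw [hS, ← mul_assoc, mul_comm (Q m), mul_assoc, ← ENNReal.tsum_mul_left]
          congr 1
          exact tsum_congr fun n => by ring
      _ ≤ ENNReal.ofReal ε * ∑' n, x ^ (n + 1) *
            gapSum E (fun a' => gapSum E g n a' 0) m a 0 := by
          gcongr
          exact h.mul_gapEntry_le hL (fun c hc => hQ m a c ha hc) hgm _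
      _ = gapSum E (fun a' => ENNReal.ofReal ε * ∑' n, x ^ (n + 1) * gapSum E g n a' 0) m a 0 := by
          rw [h.gapSum_const_mul _ (Measurable.tsum fun n => (hmeas n).const_mul _),
            h.gapSum_tsum fun n => (hmeas n).const_mul _]
          congr 1
          exact tsum_congr fun n => (h.gapSum_const_mul _ (hmeas n) m a 0).symm
      _ ≤ gapSum E g m a 0 := by
          refine gapSum_mono E (fun a' => ?_) m a 0
          refine le_trans ?_ ((le_add_self).trans (h.le_contactGen ε L y a'))
          refine mul_le_mul_right (ENNReal.tsum_le_tsum fun n => ?_) _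
          exact mul_le_mul_left (le_self_add.trans (hxy n)) _
  induction J generalizing a with
  | zero => simp
  | succ J ih =>
    set u : ℕ → ℝ → ℝ≥0∞ := fun i a => if i < J then x ^ i * contactSeq E ε κ L i a else 0 with hu
    have hum : ∀ i, Measurable (u i) := by
      intro i
      by_cases hi : i < J
      · simp only [hu, hi, if_true]
        exact h.measurable_pow_mul_contactSeq ε κ L x i
      · simp only [hu, hi, if_false]
        exact measurable_const
    have husum : ∀ a, ∑' i, u i a ≤ g a := by
      intro a
      refine le_trans (le_of_eq ?_) (ih a)
      rw [tsum_eq_sum (s := Finset.range J)]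
      · exact Finset.sum_congr rfl fun i hi => by simp only [hu, if_pos (Finset.mem_range.1 hi)]
      · intro i hi
        simp only [hu, if_neg (fun h' => hi (Finset.mem_range.2 h'))]
    have hstep : ∀ m < J, x ^ (m + 1) * contactSeq E ε κ L (m + 1) a ≤
        ∑ p ∈ Finset.HasAntidiagonal.antidiagonal m, ENNReal.ofReal ε * (x ^ (p.1 + 1) *
          (gapSum E (u p.2) p.1 a 0 +
            if |a| ≤ L then κ * ENNReal.ofReal M * gapEntry E L (u p.2) p.1 else 0)) := by
      intro m hm
      rw [contactSeq]
      refine (mul_le_mul_right (mul_le_mul_right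
        (h.tiltSum_zero_right_le ε κ hL m a) _) _).trans (le_of_eq ?_)
      rw [Finset.mul_sum, Finset.mul_sum]
      refine Finset.sum_congr rfl fun p hp => ?_
      have hpm := Finset.HasAntidiagonal.mem_antidiagonal.1 hp
      have hup : u p.2 = fun a => x ^ p.2 * contactSeq E ε κ L p.2 a := by
        funext a
        simp only [hu, if_pos (show p.2 < J by omega)]
      rw [hup, h.gapSum_const_mul _ (h.measurable_contactSeq ε κ L p.2),
        h.gapEntry_const_mul L _ (h.measurable_contactSeq ε κ L p.2), ← hpm]
      split_ifs <;> ring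
    rw [Finset.sum_range_succ']
    have hsum : ∑ m ∈ Finset.range J, x ^ (m + 1) * contactSeq E ε κ L (m + 1) a ≤
        ENNReal.ofReal ε * ∑' n, x ^ (n + 1) * (gapSum E g n a 0 +
          if |a| ≤ L then κ * ENNReal.ofReal M * gapEntry E L g n else 0) := by
      refine (Finset.sum_le_sum fun m hm => hstep m (Finset.mem_range.1 hm)).trans ?_
      refine (ENNReal.sum_le_tsum _).trans ?_
      rw [ENNReal.tsum_sum_antidiagonal (fun n i => ENNReal.ofReal ε * (x ^ (n + 1) *
          (gapSum E (u i) n a 0 +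
            if |a| ≤ L then κ * ENNReal.ofReal M * gapEntry E L (u i) n else 0))),
        ← ENNReal.tsum_mul_left]
      refine ENNReal.tsum_le_tsum fun n => ?_
      rw [ENNReal.tsum_mul_left, ENNReal.tsum_mul_left, ENNReal.tsum_add, ← h.gapSum_tsum hum]
      gcongr
      · exact gapSum_mono E husum n a 0
      · split_ifs
        · rw [ENNReal.tsum_mul_left, ← h.gapEntry_tsum L hum]
          gcongr
          exact gapEntry_mono E L husum n
        · simp
    have hfin : ∑' n, x ^ (n + 1) * (gapSum E g n a 0 +
          if |a| ≤ L then κ * ENNReal.ofReal M * gapEntry E L g n else 0) ≤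
        ∑' n, y ^ (n + 1) * gapSum E g n a 0 := by
      by_cases ha : |a| ≤ L
      · simp only [ha, if_true]
        have e1 : ∑' n, x ^ (n + 1) * (gapSum E g n a 0 +
            κ * ENNReal.ofReal M * gapEntry E L g n) =
            ∑' n, x ^ (n + 1) * gapSum E g n a 0 + κ * ENNReal.ofReal M * S := by
          rw [hS, ← ENNReal.tsum_mul_left, ← ENNReal.tsum_add]
          exact tsum_congr fun n => by ring
        rw [e1]
        calc _ ≤ ∑' n, x ^ (n + 1) * gapSum E g n a 0 +
              ENNReal.ofReal ε * (∑' m, D m * Q m) * S := by gcongr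
          _ = ∑' n, x ^ (n + 1) * gapSum E g n a 0 +
              ∑' m, D m * (Q m * (ENNReal.ofReal ε * S)) := by
              rw [mul_comm (ENNReal.ofReal ε), mul_assoc, ← ENNReal.tsum_mul_right]
              congr 1
              exact tsum_congr fun m => by ring
          _ ≤ ∑' n, x ^ (n + 1) * gapSum E g n a 0 + ∑' n, D n * gapSum E g n a 0 := by
              gcongr
              exact hlow a ha _
          _ ≤ _ := by
              rw [← ENNReal.tsum_add]
              refine ENNReal.tsum_le_tsum fun n => ?_
              rw [← add_mul]
              exact mul_le_mul_left (hxy n) _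
      · simp only [ha, if_false, add_zero]
        refine ENNReal.tsum_le_tsum fun n => mul_le_mul_left (le_self_add.trans (hxy n)) _
    refine le_trans ?_ (h.le_contactGen ε L y a)
    rw [add_comm]
    refine add_le_add (by simp [contactSeq]) (hsum.trans ?_)
    gcongr

lemma contactGen_lt_top (h : IsBoundedDensity E M) {ε : ℝ} (hε : 0 < ε)
    (hZ : ∀ γ : ℝ, 0 < γ → ∀ᶠ N : ℕ in atTop, Real.log (Zpin E ε N) ≤ γ * N) (L : ℝ)
    {l : ℝ} (hl : 0 < l) :
    contactGen E ε L (ENNReal.ofReal (Real.exp (-l))) 0 < ∞ := by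
  set r : ℕ → ℝ := fun j => Real.exp (-l) ^ j * (if j = 0 then E 0 else ε * Zpin E ε j) with hr
  have heq : contactGen E ε L (ENNReal.ofReal (Real.exp (-l))) 0 = ∑' j, ENNReal.ofReal (r j) := by
    refine tsum_congr fun j => ?_
    simp only [hr]
    rw [ENNReal.ofReal_mul (by positivity), ENNReal.ofReal_pow (by positivity)]
    congr 1
    cases j with
    | zero => rfl
    | succ j =>
      rw [if_neg (by omega), ENNReal.ofReal_mul hε.le, h.ofReal_Zpin, ← tiltSum_zero E ε L]
      rfl
  rw [heq, lt_top_iff_ne_top]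
  refine Summable.tsum_ofReal_ne_top ?_
  have hgeo : Summable fun j : ℕ => ε * Real.exp (-(l / 2)) ^ j :=
    (summable_geometric_of_lt_one (Real.exp_pos _).le
      (Real.exp_lt_one_iff.2 (by linarith))).mul_left _
  refine Summable.of_norm_bounded_eventually_nat hgeo ?_
  filter_upwards [hZ (l / 2) (by positivity), eventually_ge_atTop 1] with j hj hj1
  obtain ⟨m, rfl⟩ : ∃ m, j = m + 1 := ⟨j - 1, by omega⟩
  have hpos := h.Zpin_pos hε m
  simp only [hr]
  rw [if_neg (by omega), Real.norm_of_nonneg (by positivity)]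
  have hZle : Zpin E ε (m + 1) ≤ Real.exp (l / 2 * (m + 1 : ℕ)) := by
    rw [← Real.exp_log hpos]
    exact Real.exp_le_exp.2 hj
  calc _ ≤ Real.exp (-l) ^ (m + 1) * (ε * Real.exp (l / 2 * (m + 1 : ℕ))) := by gcongr
    _ = ε * Real.exp (-(l / 2)) ^ (m + 1) := by
      rw [← Real.exp_nat_mul, ← Real.exp_nat_mul, mul_left_comm, ← Real.exp_add]
      congr 2
      ring

/-- At zero free energy a reward of order `B l` per contact with small neighbours
raises the free energy by at most `l`. -/
lemma exists_sum_tiltSum_le (h : IsBoundedDensity E M) {σ : ℝ} (hσ : 0 < σ)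
    (hmean : ∫ x, x * E x = 0) (hvar : ∫ x, x ^ 2 * E x = σ ^ 2) {ε : ℝ} (hε : 0 < ε)
    (hZ : ∀ γ : ℝ, 0 < γ → ∀ᶠ N : ℕ in atTop, Real.log (Zpin E ε N) ≤ γ * N)
    {L : ℝ} (hL : 0 ≤ L) {B : ℝ} (hB : 0 < B) :
    ∃ l₀ : ℝ, 0 < l₀ ∧ ∀ l, 0 < l → l ≤ l₀ → ∃ C : ℝ≥0∞, C < ∞ ∧ ∀ J : ℕ,
      ∑ j ∈ Finset.range J, ENNReal.ofReal (Real.exp (-l * (j + 1 : ℕ))) *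
        tiltSum E ε (ENNReal.ofReal (B * l)) L j 0 0 ≤ C := by
  obtain ⟨d, hd, n₀, hlow⟩ := h.exists_pathSum_ge hσ hmean hvar hL
  have hM := h.bound_pos
  have hdiv := Real.tendsto_sum_range_one_div_nat_succ_atTop
  obtain ⟨k, hk, hkn⟩ : ∃ k, 2 * Real.exp 1 * B * M / (ε * d) +
      ∑ i ∈ Finset.range n₀, (1 / ((i : ℝ) + 1)) ≤ ∑ i ∈ Finset.range k, (1 / ((i : ℝ) + 1)) ∧
      n₀ ≤ k :=
    ((hdiv.eventually_ge_atTop _).and (eventually_ge_atTop n₀)).exists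
  have hk' : 2 * Real.exp 1 * B * M / (ε * d) ≤ ∑ i ∈ Finset.Ico n₀ k, (1 / ((i : ℝ) + 1)) := by
    rw [Finset.sum_Ico_eq_sub _ hkn]
    linarith
  refine ⟨1 / (k + 2), by positivity, fun l hl hlk => ?_⟩
  set Q : ℕ → ℝ≥0∞ := fun m => if n₀ ≤ m then ENNReal.ofReal (d / m ^ 2) else 0 with hQ
  set D : ℕ → ℝ≥0∞ := fun m =>
    ENNReal.ofReal (Real.exp (-(l / 2)) ^ (m + 1) - Real.exp (-l) ^ (m + 1)) with hD
  have hyx : ∀ m : ℕ, Real.exp (-l) ^ (m + 1) ≤ Real.exp (-(l / 2)) ^ (m + 1) := fun m => by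
    gcongr; linarith
  have hxy : ∀ m, ENNReal.ofReal (Real.exp (-l)) ^ (m + 1) + D m ≤
      ENNReal.ofReal (Real.exp (-(l / 2))) ^ (m + 1) := by
    intro m
    simp only [hD]
    rw [← ENNReal.ofReal_pow (by positivity), ← ENNReal.ofReal_pow (by positivity),
      ← ENNReal.ofReal_add (by positivity) (by linarith [hyx m])]
    exact ENNReal.ofReal_le_ofReal (by linarith)
  have hDlow : ∀ m : ℕ, l * (m + 1) ≤ 1 →
      Real.exp (-1) * (l * m / 2) ≤ Real.exp (-(l / 2)) ^ (m + 1) - Real.exp (-l) ^ (m + 1) := by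
    intro m hm
    rw [← Real.exp_nat_mul, ← Real.exp_nat_mul]
    have e1 : Real.exp ((m + 1 : ℕ) * -(l / 2)) - Real.exp ((m + 1 : ℕ) * -l) =
        Real.exp (-(l * (m + 1))) * (Real.exp (l * (m + 1) / 2) - 1) := by
      rw [mul_sub, ← Real.exp_add, mul_one]
      push_cast
      congr 2 <;> ring
    rw [e1]
    have h1 := Real.add_one_le_exp (l * ((m : ℝ) + 1) / 2)
    have h2 : Real.exp (-1) ≤ Real.exp (-(l * ((m : ℝ) + 1))) := Real.exp_le_exp.2 (by linarith)
    refine mul_le_mul h2 (by linarith) (by positivity) (Real.exp_pos _).le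
  have hκ : ENNReal.ofReal (B * l) * ENNReal.ofReal M ≤ ENNReal.ofReal ε * ∑' m, D m * Q m := by
    have h1 : ENNReal.ofReal (∑ i ∈ Finset.Ico n₀ k, Real.exp (-1) * l * d / 2 *
        (1 / ((i : ℝ) + 1))) ≤ ∑' m, D m * Q m := by
      rw [ENNReal.ofReal_sum_of_nonneg fun i _ => by positivity,
        tsum_eq_zero_add' (f := fun m => D m * Q m) ENNReal.summable]
      refine le_trans ?_ le_add_self
      refine le_trans (Finset.sum_le_sum fun i hi => ?_)
        (ENNReal.sum_le_tsum (f := fun m => D (m + 1) * Q (m + 1)) (Finset.Ico n₀ k))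
      rw [Finset.mem_Ico] at hi
      simp only [hQ, if_pos (show n₀ ≤ i + 1 by omega), hD]
      have hik : (i : ℝ) + 1 ≤ k := by exact_mod_cast hi.2
      have hl1 : l * (((i + 1 : ℕ) : ℝ) + 1) ≤ 1 := by
        rw [le_div_iff₀ (by positivity)] at hlk
        push_cast
        nlinarith
      have h3 := hDlow (i + 1) hl1
      rw [← ENNReal.ofReal_mul (le_trans (by positivity) h3)]
      refine ENNReal.ofReal_le_ofReal (le_trans (le_of_eq ?_)
        (mul_le_mul_of_nonneg_right h3 (by positivity)))
      push_cast
      field_simp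
    rw [← ENNReal.ofReal_mul (by positivity)]
    refine le_trans ?_ (mul_le_mul_right h1 _)
    rw [← ENNReal.ofReal_mul hε.le, ← Finset.mul_sum]
    refine ENNReal.ofReal_le_ofReal ?_
    have h4 : B * l * M = ε * (Real.exp (-1) * l * d / 2 *
        (2 * Real.exp 1 * B * M / (ε * d))) := by
      rw [Real.exp_neg]
      field_simp
    rw [h4]
    gcongr
  have hmain := h.sum_contactSeq_le (ε := ε) hL hxy (Q := Q) (fun m a c ha hc => ?_) hκ
  · refine ⟨(ENNReal.ofReal ε)⁻¹ * contactGen E ε L (ENNReal.ofReal (Real.exp (-(l / 2)))) 0,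
      ENNReal.mul_lt_top ?_ (h.contactGen_lt_top hε hZ L (by positivity)), fun J => ?_⟩
    · exact ENNReal.inv_lt_top.2 (ENNReal.ofReal_pos.2 hε)
    · have hJ := hmain (J + 1) 0
      rw [Finset.sum_range_succ'] at hJ
      refine le_trans (le_of_eq ?_) (mul_le_mul_right (le_self_add.trans hJ) _)
      rw [Finset.mul_sum]
      refine Finset.sum_congr rfl fun j _ => ?_
      rw [contactSeq, mul_left_comm (ENNReal.ofReal (Real.exp (-l)) ^ (j + 1)), ← mul_assoc,
        ENNReal.inv_mul_cancel (ENNReal.ofReal_pos.2 hε).ne' ENNReal.ofReal_ne_top, one_mul,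
        ← ENNReal.ofReal_pow (by positivity), ← Real.exp_nat_mul]
      congr 3
      ring
  · simp only [hQ]
    split_ifs with hm
    · exact hlow m hm a c ha hc
    · exact zero_le

end IsBoundedDensity

/-- The part of `E` carried by `|x| > L`. -/
def tailPart (E : ℝ → ℝ) (L x : ℝ) : ℝ := if L < |x| then E x else 0

/-- The density `E` multiplied by `T` on `|x| > L`. -/
def tailTilt (E : ℝ → ℝ) (T L x : ℝ) : ℝ := E x * if L < |x| then T else 1

/-- Lyapunov function of the transfer operator with tilted tails. -/
def tailPotential (E : ℝ → ℝ) (T L a b : ℝ) : ℝ :=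
  1 + tailTilt E T L (a - 2 * b) + tailTilt E T L (a - 2 * b) * tailTilt E T L b

lemma measurable_ite_lt_abs {α : Type*} [MeasurableSpace α] {f : α → ℝ} (hf : Measurable f)
    {u v : α → ℝ} (hu : Measurable u) (hv : Measurable v) (L : ℝ) :
    Measurable fun x => if L < |f x| then u x else v x :=
  Measurable.ite (measurableSet_lt (f := fun _ => L) (g := fun x => |f x|) measurable_const
    (measurable_abs.comp hf)) hu hv

namespace IsBoundedDensity

variable {E : ℝ → ℝ} {M : ℝ}

lemma tailPart_nonneg (h : IsBoundedDensity E M) (L x : ℝ) : 0 ≤ tailPart E L x := by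
  unfold tailPart
  split_ifs
  exacts [h.nonneg x, le_rfl]

lemma measurable_tailPart (h : IsBoundedDensity E M) (L : ℝ) : Measurable (tailPart E L) :=
  measurable_ite_lt_abs measurable_id h.measurable measurable_const L

lemma tailTilt_nonneg (h : IsBoundedDensity E M) {T : ℝ} (hT : 1 ≤ T) (L x : ℝ) :
    0 ≤ tailTilt E T L x := by
  unfold tailTilt
  have := h.nonneg x
  split_ifs <;> nlinarith

lemma measurable_tailTilt (h : IsBoundedDensity E M) (T L : ℝ) :
    Measurable (tailTilt E T L) :=
  h.measurable.mul (measurable_ite_lt_abs measurable_id measurable_const measurable_const L)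

lemma integrable_tailPart (h : IsBoundedDensity E M) (L : ℝ) : Integrable (tailPart E L) := by
  refine h.int.mono' (h.measurable_tailPart L).aestronglyMeasurable
    (Eventually.of_forall fun x => ?_)
  rw [Real.norm_eq_abs, abs_of_nonneg (h.tailPart_nonneg L x)]
  unfold tailPart
  split_ifs
  exacts [le_rfl, h.nonneg x]

lemma exists_integral_tailPart_le (h : IsBoundedDensity E M) {κ : ℝ} (hκ : 0 < κ) :
    ∃ L : ℝ, 0 ≤ L ∧ ∫ x, tailPart E L x ≤ κ := by
  have hlim : Tendsto (fun n : ℕ => ∫ x, tailPart E n x) atTop (𝓝 (∫ _ : ℝ, (0 : ℝ))) := by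
    refine tendsto_integral_of_dominated_convergence E
      (fun n => (h.measurable_tailPart n).aestronglyMeasurable) h.int
      (fun n => Eventually.of_forall fun x => ?_) (Eventually.of_forall fun x => ?_)
    · rw [Real.norm_eq_abs, abs_of_nonneg (h.tailPart_nonneg _ x)]
      unfold tailPart
      split_ifs
      exacts [le_rfl, h.nonneg x]
    · obtain ⟨n₀, hn₀⟩ := exists_nat_ge |x|
      refine tendsto_const_nhds.congr' ?_
      filter_upwards [eventually_ge_atTop n₀] with n hn
      rw [tailPart, if_neg (not_lt.2 (hn₀.trans (Nat.cast_le.2 hn)))]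
  rw [integral_zero] at hlim
  obtain ⟨n, hn⟩ := (hlim.eventually (gt_mem_nhds hκ)).exists
  exact ⟨n, n.cast_nonneg, hn.le⟩

lemma tailTilt_mul_le (h : IsBoundedDensity E M) {T M₁ : ℝ} (hT : 1 ≤ T) (hM : M ≤ M₁)
    (hM₁ : 1 ≤ M₁) (L x y z : ℝ) :
    tailTilt E T L x * (1 + tailTilt E T L y + tailTilt E T L y * tailTilt E T L z) ≤
      3 * M₁ ^ 2 * (E x + T ^ 3 * (tailPart E L x + tailPart E L y + tailPart E L z)) := by
  have hx := h.nonneg x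
  have hy := h.nonneg y
  have hz := h.nonneg z
  have hx' := (h.le x).trans hM
  have hy' := (h.le y).trans hM
  have hz' := (h.le z).trans hM
  set p := if L < |x| then T else 1 with hp
  set q := if L < |y| then T else 1 with hq
  set r := if L < |z| then T else 1 with hr
  have hp1 : 1 ≤ p := by rw [hp]; split_ifs <;> linarith
  have hq1 : 1 ≤ q := by rw [hq]; split_ifs <;> linarith
  have hr1 : 1 ≤ r := by rw [hr]; split_ifs <;> linarith
  have hpT : p ≤ T := by rw [hp]; split_ifs <;> linarith
  have hqT : q ≤ T := by rw [hq]; split_ifs <;> linarith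
  have hrT : r ≤ T := by rw [hr]; split_ifs <;> linarith
  have hTT : T ≤ T ^ 3 := by nlinarith [sq_nonneg T, sq_nonneg (T - 1)]
  have hTT2 : T ^ 2 ≤ T ^ 3 := by nlinarith [sq_nonneg T]
  have hMM : M₁ ≤ M₁ ^ 2 := by nlinarith
  have hM0 : 0 ≤ M₁ := by linarith
  have hT0 : 0 ≤ T := by linarith
  have t1 : E x * p ≤
      M₁ ^ 2 * (E x + T ^ 3 * (tailPart E L x + tailPart E L y + tailPart E L z)) := by
    have n2 := h.tailPart_nonneg L y
    have n3 := h.tailPart_nonneg L z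
    have key : E x * p ≤ E x + T ^ 3 * tailPart E L x := by
      rw [hp, tailPart]
      split_ifs
      · nlinarith
      · nlinarith
    calc E x * p ≤ E x + T ^ 3 * tailPart E L x := key
      _ ≤ E x + T ^ 3 * (tailPart E L x + tailPart E L y + tailPart E L z) := by
          gcongr; linarith
      _ ≤ _ := le_mul_of_one_le_left (by have := h.tailPart_nonneg L x; positivity) (by nlinarith)
  have t2 : E x * p * (E y * q) ≤
      M₁ ^ 2 * (E x + T ^ 3 * (tailPart E L x + tailPart E L y + tailPart E L z)) := by
    have n3 := h.tailPart_nonneg L z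
    have exy : E x * E y ≤ M₁ * E x := by nlinarith
    have exy' : E x * E y ≤ M₁ * E y := by nlinarith
    have key : E x * p * (E y * q) ≤ M₁ * (E x + T ^ 3 * (tailPart E L x + tailPart E L y)) := by
      by_cases c1 : L < |x|
      · calc E x * p * (E y * q) = E x * E y * (p * q) := by ring
          _ ≤ M₁ * E x * (T * T) := by gcongr
          _ ≤ M₁ * E x * T ^ 3 := by rw [← sq]; gcongr
          _ ≤ _ := by
            have := h.tailPart_nonneg L y
            rw [tailPart, if_pos c1, mul_assoc]
            gcongr
            nlinarith [pow_nonneg hT0 3, mul_nonneg (pow_nonneg hT0 3) this]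
      · by_cases c2 : L < |y|
        · calc E x * p * (E y * q) = E x * E y * (p * q) := by ring
            _ ≤ M₁ * E y * (T * T) := by gcongr
            _ ≤ M₁ * E y * T ^ 3 := by rw [← sq]; gcongr
            _ ≤ _ := by
              have := h.tailPart_nonneg L x
              rw [tailPart, tailPart, if_pos c2, mul_assoc, if_neg c1]
              gcongr
              nlinarith
        · rw [hp, hq, tailPart, tailPart, if_neg c1, if_neg c2, if_neg c1, if_neg c2]
          nlinarith
    refine key.trans ?_
    have := h.tailPart_nonneg L x
    have := h.tailPart_nonneg L y
    exact mul_le_mul hMM (by linarith [mul_nonneg (pow_nonneg hT0 3) n3])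
      (by positivity) (by positivity)
  have t3 : E x * p * (E y * q * (E z * r)) ≤
      M₁ ^ 2 * (E x + T ^ 3 * (tailPart E L x + tailPart E L y + tailPart E L z)) := by
    have n1 := h.tailPart_nonneg L x
    have n2 := h.tailPart_nonneg L y
    have n3 := h.tailPart_nonneg L z
    have exy : E x * E y * E z ≤ M₁ ^ 2 * E x := by
      calc E x * E y * E z ≤ E x * M₁ * M₁ := by gcongr
        _ = _ := by ring
    have exy' : E x * E y * E z ≤ M₁ ^ 2 * E y := by
      calc E x * E y * E z ≤ M₁ * E y * M₁ := by gcongr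
        _ = _ := by ring
    have exy'' : E x * E y * E z ≤ M₁ ^ 2 * E z := by
      calc E x * E y * E z ≤ M₁ * M₁ * E z := by gcongr
        _ = _ := by ring
    have big : ∀ w, 0 ≤ w → E x * E y * E z ≤ M₁ ^ 2 * w →
        w ≤ tailPart E L x + tailPart E L y + tailPart E L z →
        E x * p * (E y * q * (E z * r)) ≤
      M₁ ^ 2 * (E x + T ^ 3 * (tailPart E L x + tailPart E L y + tailPart E L z)) := by
      intro w hw h1 h2
      calc E x * p * (E y * q * (E z * r)) = E x * E y * E z * (p * q * r) := by ring
        _ ≤ M₁ ^ 2 * w * (T * T * T) := by gcongr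
        _ = M₁ ^ 2 * (0 + T ^ 3 * w) := by ring
        _ ≤ _ := by gcongr
    by_cases c1 : L < |x|
    · refine big (E x) hx exy ?_
      linarith [show tailPart E L x = E x from if_pos c1]
    by_cases c2 : L < |y|
    · refine big (E y) hy exy' ?_
      linarith [show tailPart E L y = E y from if_pos c2]
    by_cases c3 : L < |z|
    · refine big (E z) hz exy'' ?_
      linarith [show tailPart E L z = E z from if_pos c3]
    calc E x * p * (E y * q * (E z * r)) = E x * E y * E z := by
          rw [hp, hq, hr, if_neg c1, if_neg c2, if_neg c3]; ring
      _ ≤ M₁ ^ 2 * E x := exy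
      _ ≤ _ := by
          gcongr
          nlinarith [mul_nonneg (pow_nonneg hT0 3) (add_nonneg (add_nonneg n1 n2) n3)]
  simp only [tailTilt]
  rw [← hp, ← hq, ← hr]
  nlinarith

lemma lintegral_tailTilt_le (h : IsBoundedDensity E M) {T M₁ L : ℝ} (hT : 1 ≤ T) (hM : M ≤ M₁)
    (hM₁ : 1 ≤ M₁) (hL : T ^ 3 * ∫ x, tailPart E L x ≤ 1) (a b : ℝ) :
    ∫⁻ c, ENNReal.ofReal (tailTilt E T L (c + a - 2 * b) * tailPotential E T L b c) ≤
      ENNReal.ofReal (12 * M₁ ^ 2) := by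
  have hτ0 : 0 ≤ ∫ x, tailPart E L x := integral_nonneg fun x => h.tailPart_nonneg L x
  have i1 : Integrable fun c : ℝ => E (c + (a - 2 * b)) := h.int.comp_add_right _
  have i2 : Integrable fun c : ℝ => tailPart E L (c + (a - 2 * b)) :=
    (h.integrable_tailPart L).comp_add_right _
  have i3' : Integrable fun c : ℝ => tailPart E L (b + c) :=
    (h.integrable_tailPart L).comp_add_left _
  have i3 : Integrable fun c : ℝ => tailPart E L (b + (-2) * c) :=
    i3'.comp_mul_left' (by norm_num : (-2 : ℝ) ≠ 0)
  have i4 : Integrable fun c : ℝ => tailPart E L c := h.integrable_tailPart L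
  have e1 : ∫ c : ℝ, E (c + (a - 2 * b)) = 1 := by
    rw [integral_add_right_eq_self (fun x => E x), h.mass]
  have e2 : ∫ c : ℝ, tailPart E L (c + (a - 2 * b)) = ∫ x, tailPart E L x :=
    integral_add_right_eq_self (fun x => tailPart E L x) _
  have e3 : ∫ c : ℝ, tailPart E L (b + (-2) * c) = (∫ x, tailPart E L x) / 2 := by
    rw [Measure.integral_comp_mul_left (fun x => tailPart E L (b + x)) (-2),
      integral_add_left_eq_self (fun x => tailPart E L x)]
    norm_num
    ring
  set G : ℝ → ℝ := fun c => 3 * M₁ ^ 2 * (E (c + (a - 2 * b)) + T ^ 3 *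
    (tailPart E L (c + (a - 2 * b)) + tailPart E L (b + (-2) * c) + tailPart E L c)) with hG
  have iG : Integrable G := (i1.add (((i2.add i3).add i4).const_mul _)).const_mul _
  have hle : ∀ c, tailTilt E T L (c + a - 2 * b) * tailPotential E T L b c ≤ G c := by
    intro c
    have := h.tailTilt_mul_le hT hM hM₁ L (c + (a - 2 * b)) (b + (-2) * c) c
    rw [hG]
    refine le_trans (le_of_eq ?_) this
    rw [tailPotential, show c + a - 2 * b = c + (a - 2 * b) by ring,
      show b - 2 * c = b + (-2) * c by ring]
  have hG0 : ∀ c, 0 ≤ G c := by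
    intro c
    have := h.nonneg (c + (a - 2 * b))
    have := h.tailPart_nonneg L (c + (a - 2 * b))
    have := h.tailPart_nonneg L (b + (-2) * c)
    have := h.tailPart_nonneg L c
    simp only [hG]
    positivity
  calc _ ≤ ∫⁻ c, ENNReal.ofReal (G c) := lintegral_mono fun c => ENNReal.ofReal_le_ofReal (hle c)
    _ = ENNReal.ofReal (∫ c, G c) :=
        (ofReal_integral_eq_lintegral_ofReal iG (Eventually.of_forall hG0)).symm
    _ ≤ _ := by
        refine ENNReal.ofReal_le_ofReal ?_
        have : ∫ c, G c = 3 * M₁ ^ 2 * (1 + T ^ 3 * ((∫ x, tailPart E L x) +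
            (∫ x, tailPart E L x) / 2 + ∫ x, tailPart E L x)) := by
          simp only [hG]
          rw [integral_const_mul, integral_add i1 (by exact ((i2.add i3).add i4).const_mul _),
            integral_const_mul, integral_add (by exact i2.add i3) i4, integral_add i2 i3,
            e1, e2, e3]
        rw [this]
        have h3 : T ^ 3 * ((∫ x, tailPart E L x) + (∫ x, tailPart E L x) / 2 +
            ∫ x, tailPart E L x) ≤ 3 := by nlinarith [pow_nonneg (by linarith : 0 ≤ T) 3]
        nlinarith [sq_nonneg M₁]

lemma pathSum_tailTilt_le (h : IsBoundedDensity E M) {T M₁ L ε : ℝ} (hT : 1 ≤ T) (hM : M ≤ M₁)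
    (hM₁ : 1 ≤ M₁) (hL0 : 0 ≤ L) (hL : T ^ 3 * ∫ x, tailPart E L x ≤ 1) (hε : 0 ≤ ε)
    (m : ℕ) (a b : ℝ) :
    pathSum (fun x => ENNReal.ofReal (E x)) (pinFactor ε) m
        (fun _ a b c => ENNReal.ofReal (tailTilt E T L (c + a - 2 * b))) a b ≤
      ENNReal.ofReal (M * (12 * M₁ ^ 2 + ε * (1 + M)) ^ m * tailPotential E T L a b) := by
  have hM0 := h.bound_pos
  have htn := h.tailTilt_nonneg hT L
  have hΦ : ∀ a b, 1 ≤ tailPotential E T L a b := by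
    intro a b
    unfold tailPotential
    have := mul_nonneg (htn (a - 2 * b)) (htn b)
    linarith [htn (a - 2 * b)]
  set C := 12 * M₁ ^ 2 + ε * (1 + M) with hC
  have hC0 : 0 ≤ C := by positivity
  have hΦm : Measurable fun p : ℝ × ℝ => tailPotential E T L p.1 p.2 := by
    unfold tailPotential
    have := h.measurable_tailTilt T L
    fun_prop
  induction m generalizing a b with
  | zero =>
    simp only [pathSum, pow_zero, mul_one]
    rw [← ENNReal.ofReal_mul (htn _)]
    refine ENNReal.ofReal_le_ofReal ?_
    rw [show 0 + a - 2 * b = a - 2 * b by ring, tailPotential]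
    have h1 := htn (a - 2 * b)
    have h2 := mul_nonneg h1 (htn b)
    nlinarith [h.le b, mul_le_mul_of_nonneg_left (h.le b) h1]
  | succ m ih =>
    simp only [pathSum]
    calc _ ≤ ∫⁻ c, ENNReal.ofReal (M * C ^ m) *
          ENNReal.ofReal (tailTilt E T L (c + a - 2 * b) * tailPotential E T L b c)
          ∂(pinFactor ε) := by
          refine lintegral_mono fun c => ?_
          refine (mul_le_mul_right (ih b c) _).trans (le_of_eq ?_)
          rw [← ENNReal.ofReal_mul (htn _), ← ENNReal.ofReal_mul (by positivity)]
          congr 1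
          ring
      _ = ENNReal.ofReal (M * C ^ m) * ∫⁻ c,
          ENNReal.ofReal (tailTilt E T L (c + a - 2 * b) * tailPotential E T L b c)
          ∂(pinFactor ε) := lintegral_const_mul' _ _ ENNReal.ofReal_ne_top
      _ ≤ ENNReal.ofReal (M * C ^ m) * ENNReal.ofReal (C * tailPotential E T L a b) := by
          refine mul_le_mul_right ?_ _
          rw [lintegral_pinFactor, ← ENNReal.ofReal_mul hε]
          refine (add_le_add le_rfl (h.lintegral_tailTilt_le hT hM hM₁ hL a b)).trans ?_
          have h00 : tailTilt E T L 0 = E 0 := by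
            rw [tailTilt, abs_zero, if_neg (not_lt.2 hL0), mul_one]
          have e : tailTilt E T L (0 + a - 2 * b) * tailPotential E T L b 0 ≤
              (1 + M) * tailPotential E T L a b := by
            rw [tailPotential, tailPotential, h00, mul_zero, sub_zero,
              show 0 + a - 2 * b = a - 2 * b by ring]
            have h1 := htn (a - 2 * b)
            have h2 := mul_nonneg h1 (htn b)
            nlinarith [mul_le_mul_of_nonneg_left (h.le 0) h2]
          rw [← ENNReal.ofReal_add
            (mul_nonneg hε (mul_nonneg (htn _) (by linarith [hΦ b 0]))) (by positivity)]
          refine ENNReal.ofReal_le_ofReal ?_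
          rw [hC, add_mul]
          nlinarith [mul_le_mul_of_nonneg_left e hε, mul_le_mul_of_nonneg_left (hΦ a b)
            (by positivity : 0 ≤ 12 * M₁ ^ 2)]
      _ = _ := by
          rw [← ENNReal.ofReal_mul (by positivity)]
          congr 1
          ring

/-- Large discrete Laplacians are rare under the pinning measure. -/
lemma exists_integral_big_le (h : IsBoundedDensity E M) {ζ ε₁ : ℝ} (hζ : 0 < ζ) (hε₁ : 0 < ε₁) :
    ∃ L : ℝ, 0 ≤ L ∧ ∀ ε, 0 < ε → ε ≤ ε₁ → ∀ᶠ m : ℕ in atTop,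
      -((m : ℝ) + 1) ≤ Real.log (Zpin E ε (m + 1)) →
      ∫ φ, pathFunctional (m := m) (fun _ a b c => if L < |c + a - 2 * b| then 1 else 0) φ
        ∂(Ppin E ε (m + 1)) ≤ ζ * (m + 1) := by
  have hM0 := h.bound_pos
  set M₁ := max M 1 with hM₁
  set C := 12 * M₁ ^ 2 + ε₁ * (1 + M) with hC
  have hM₁1 : 1 ≤ M₁ := le_max_right _ _
  have hC1 : 1 ≤ C := by nlinarith [mul_pos hε₁ (by linarith : 0 < 1 + M)]
  have hlC : 0 ≤ Real.log C := Real.log_nonneg hC1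
  set t := (Real.log C + 2) / ζ with ht
  have ht0 : 0 < t := by positivity
  set T := Real.exp t with hT
  have hT1 : 1 ≤ T := Real.one_le_exp ht0.le
  obtain ⟨L, hL0, hL⟩ := h.exists_integral_tailPart_le (κ := (T ^ 3)⁻¹) (by positivity)
  have hL' : T ^ 3 * ∫ x, tailPart E L x ≤ 1 := by
    calc _ ≤ T ^ 3 * (T ^ 3)⁻¹ := by gcongr
      _ = 1 := mul_inv_cancel₀ (by positivity)
  refine ⟨L, hL0, fun ε hε hεle => ?_⟩
  set K := M * tailPotential E T L 0 0 with hK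
  have hΦ : 0 < tailPotential E T L 0 0 := by
    unfold tailPotential
    have := h.tailTilt_nonneg hT1 L (0 - 2 * 0)
    have := h.tailTilt_nonneg hT1 L 0
    positivity
  have hK0 : 0 < K := mul_pos hM0 hΦ
  obtain ⟨m₀, hm₀⟩ := exists_nat_ge (Real.log K)
  filter_upwards [eventually_ge_atTop m₀] with m hm hZ
  have key := h.jensen hε m
    (ξ := fun _ a b c => if L < |c + a - 2 * b| then t else 0)
    (fun n => measurable_ite_lt_abs (f := fun p : ℝ × ℝ × ℝ => p.2.2 + p.1 - 2 * p.2.1)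
      (by fun_prop) measurable_const measurable_const L)
    (C := t) (fun n a b c => by split_ifs <;> simp [abs_of_pos ht0, ht0.le])
  have e1 : ∀ φ : Fin (m + 1 - 1) → ℝ, pathFunctional (m := m)
      (fun _ a b c => if L < |c + a - 2 * b| then t else 0) φ =
      t * pathFunctional (m := m) (fun _ a b c => if L < |c + a - 2 * b| then 1 else 0) φ := by
    intro φ
    rw [pathFunctional, pathFunctional, Finset.mul_sum]
    refine Finset.sum_congr rfl fun n _ => ?_
    split_ifs <;> simp
  have e2 : (fun (_ : ℕ) (a b c : ℝ) => lapWeight E a b c *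
      ENNReal.ofReal (Real.exp (if L < |c + a - 2 * b| then t else 0))) =
      (fun (_ : ℕ) (a b c : ℝ) => ENNReal.ofReal (tailTilt E T L (c + a - 2 * b))) := by
    funext n a b c
    rw [lapWeight, ← ENNReal.ofReal_mul (h.nonneg _), tailTilt]
    congr 2
    split_ifs
    · rfl
    · rw [Real.exp_zero]
  simp only [e1] at key
  rw [e2, integral_const_mul] at key
  set X := ∫ φ, pathFunctional (m := m) (fun _ a b c => if L < |c + a - 2 * b| then 1 else 0) φ
        ∂(Ppin E ε (m + 1)) with hX
  have key2 := key.trans (h.pathSum_tailTilt_le hT1 (le_max_left M 1) hM₁1 hL0 hL' hε.le m 0 0)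
  have hle : M * (12 * M₁ ^ 2 + ε * (1 + M)) ^ m * tailPotential E T L 0 0 ≤ K * C ^ m := by
    rw [hK, mul_right_comm]
    have : 12 * M₁ ^ 2 + ε * (1 + M) ≤ C := by
      rw [hC]
      gcongr
    gcongr
  rw [← ENNReal.ofReal_mul (h.Zpin_pos hε m).le, ENNReal.ofReal_le_ofReal_iff (by positivity)]
    at key2
  have key3 := Real.log_le_log (mul_pos (h.Zpin_pos hε m) (Real.exp_pos _)) (key2.trans hle)
  rw [Real.log_mul (h.Zpin_pos hε m).ne' (Real.exp_pos _).ne', Real.log_exp,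
    Real.log_mul hK0.ne' (by positivity), Real.log_pow] at key3
  have hm' : (m₀ : ℝ) ≤ m := Nat.cast_le.2 hm
  have hfin : t * X ≤ t * (ζ * (m + 1)) := by
    have : t * ζ = Real.log C + 2 := by rw [ht]; field_simp
    rw [← mul_assoc, this]
    nlinarith
  exact le_of_mul_le_mul_left hfin ht0

end IsBoundedDensity

/-- A path leaving zero with large slope stays positive while its second differences are small. -/
lemma pos_of_small_laplacian {y : ℕ → ℝ} {n r R : ℕ} {L : ℝ} (h0 : y (n + 1) = 0)
    (hL : 0 ≤ L) (h1 : R * L < y (n + 2))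
    (hlap : ∀ k, n < k → k < n + r → |y (k + 2) + y k - 2 * y (k + 1)| ≤ L)
    (hr : 1 ≤ r) (hrR : r ≤ R) : 0 < y (n + r + 1) := by
  have key : ∀ j, j ≤ r → (0 ≤ y (n + 1 + j)) ∧ (1 ≤ j → 0 < y (n + 1 + j)) ∧
      (j < r → y (n + 2) - j * L ≤ y (n + 1 + j + 1) - y (n + 1 + j)) := by
    intro j
    induction j with
    | zero =>
      intro _
      refine ⟨by simp [h0], by simp, fun _ => ?_⟩
      simp [h0]
    | succ j ih =>
      intro hj
      obtain ⟨i1, -, i3⟩ := ih (by omega)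
      have i3 := i3 (by omega)
      have hjR : (j : ℝ) * L ≤ R * L :=
        mul_le_mul_of_nonneg_right (Nat.cast_le.2 (by omega)) hL
      have hpos : 0 < y (n + 1 + (j + 1)) := by
        rw [show n + 1 + (j + 1) = n + 1 + j + 1 by omega]
        linarith
      refine ⟨hpos.le, fun _ => hpos, fun hj' => ?_⟩
      have hl := abs_le.1 (hlap (n + 1 + j) (by omega) (by omega))
      rw [show n + 1 + (j + 1) + 1 = n + 1 + j + 2 by omega,
        show n + 1 + (j + 1) = n + 1 + j + 1 by omega]
      push_cast
      linarith [hl.1]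
  have := (key r le_rfl).2.1 hr
  rwa [show n + 1 + r = n + r + 1 by omega] at this

lemma ne_zero_of_small_laplacian {y : ℕ → ℝ} {n r R : ℕ} {L : ℝ} (h0 : y (n + 1) = 0)
    (hL : 0 ≤ L) (h1 : R * L < |y (n + 2)|)
    (hlap : ∀ k, n < k → k < n + r → |y (k + 2) + y k - 2 * y (k + 1)| ≤ L)
    (hr : 1 ≤ r) (hrR : r ≤ R) : y (n + r + 1) ≠ 0 := by
  rcases le_or_gt 0 (y (n + 2)) with hs | hs
  · rw [abs_of_nonneg hs] at h1
    exact (pos_of_small_laplacian h0 hL h1 hlap hr hrR).ne'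
  · rw [abs_of_neg hs] at h1
    have := pos_of_small_laplacian (y := fun k => -y k) (by simp [h0]) hL h1
      (fun k hk hk' => by
        rw [show -y (k + 2) + -y k - 2 * -y (k + 1) = -(y (k + 2) + y k - 2 * y (k + 1)) by ring,
          abs_neg]
        exact hlap k hk hk') hr hrR
    intro h
    simp [h] at this

open scoped Classical in
/-- Most zeros of a path with few large second differences have bounded neighbours. -/
lemma card_zeros_le (y : ℕ → ℝ) (m R : ℕ) (hR : 0 < R) {L : ℝ} (hL : 0 ≤ L) :
    ((Finset.range (m + 1)).filter fun n => y (n + 2) = 0).card ≤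
      ((Finset.range (m + 1)).filter fun n =>
        y (n + 1) = 0 ∧ |y n| ≤ (R + 1) * L ∧ |y (n + 2)| ≤ (R + 1) * L).card +
      (R + 1) * ((Finset.range (m + 1)).filter fun n =>
        L < |y (n + 2) + y n - 2 * y (n + 1)|).card + m / R + 2 := by
  set A := (Finset.range (m + 1)).filter fun n => y (n + 1) = 0 with hA
  set G := (Finset.range (m + 1)).filter fun n =>
    y (n + 1) = 0 ∧ |y n| ≤ (R + 1) * L ∧ |y (n + 2)| ≤ (R + 1) * L with hG
  set B := (Finset.range (m + 1)).filter fun n => L < |y (n + 2) + y n - 2 * y (n + 1)| with hB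
  set I := A.filter fun n => ∀ n' ∈ A, n < n' → n + R < n' with hI
  have hshift : ((Finset.range (m + 1)).filter fun n => y (n + 2) = 0).card ≤ A.card + 1 := by
    have hsub : ((Finset.range (m + 1)).filter fun n => y (n + 2) = 0) ⊆
        insert m (((Finset.range (m + 1)).filter fun n => y (n + 2) = 0).erase m) :=
      fun n hn => by by_cases hnm : n = m <;> simp_all
    refine (Finset.card_le_card hsub).trans ((Finset.card_insert_le _ _).trans ?_)
    refine Nat.add_le_add_right ?_ 1
    refine Finset.card_le_card_of_injOn (fun n => n + 1) (fun n hn => ?_)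
      (fun a _ b _ hab => by simpa using hab)
    simp only [Finset.coe_erase, Finset.coe_filter, Finset.mem_range, Set.mem_sdiff,
      Set.mem_ofPred_eq, Set.mem_singleton_iff, hA] at hn ⊢
    exact ⟨by omega, hn.1.2⟩
  have hcover : A ⊆ G ∪ ((B ∪ B.biUnion fun k => Finset.Ico (k - R) k) ∪ I) := by
    intro n hn
    have hn' := Finset.mem_filter.1 hn
    by_cases hbig : n ∈ B
    · simp [hbig]
    have hnb : |y (n + 2) + y n - 2 * y (n + 1)| ≤ L := by
      by_contra hc
      exact hbig (Finset.mem_filter.2 ⟨hn'.1, not_le.1 hc⟩)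
    by_cases hsl : |y (n + 2)| ≤ R * L
    · refine Finset.mem_union_left _ (Finset.mem_filter.2 ⟨hn'.1, hn'.2, ?_, by linarith⟩)
      rw [hn'.2, mul_zero, sub_zero] at hnb
      have : |y n| ≤ |y (n + 2) + y n| + |y (n + 2)| := by
        have := abs_sub (y (n + 2) + y n) (y (n + 2))
        rwa [add_sub_cancel_left] at this
      linarith
    · refine Finset.mem_union_right _ ?_
      by_cases hk : ∃ k ∈ B, n < k ∧ k ≤ n + R
      · obtain ⟨k, hkB, hk1, hk2⟩ := hk
        refine Finset.mem_union_left _ (Finset.mem_union_right _ (Finset.mem_biUnion.2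
          ⟨k, hkB, Finset.mem_Ico.2 ⟨by omega, hk1⟩⟩))
      · push Not at hk
        refine Finset.mem_union_right _ (Finset.mem_filter.2 ⟨hn, fun n' hn'A hlt => ?_⟩)
        by_contra hle
        have hA' := Finset.mem_filter.1 hn'A
        have hm := Finset.mem_range.1 hA'.1
        refine ne_zero_of_small_laplacian (r := n' - n) hn'.2 hL (not_le.1 hsl)
          (fun k hk1 hk2 => ?_) (by omega) (by omega) ?_
        · by_contra hc
          have := hk k (Finset.mem_filter.2 ⟨Finset.mem_range.2 (by omega), not_le.1 hc⟩) hk1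
          omega
        · rw [show n + (n' - n) + 1 = n' + 1 by omega]
          exact hA'.2
  have hIcard : I.card ≤ m / R + 1 := by
    rw [← Finset.card_range (m / R + 1)]
    refine Finset.card_le_card_of_injOn (fun n => n / R) (fun n hn => ?_) ?_
    · have h1 := Finset.mem_range.1 (Finset.mem_filter.1 (Finset.mem_filter.1 hn).1).1
      exact Finset.mem_coe.2 (Finset.mem_range.2
        (Nat.lt_succ_of_le (Nat.div_le_div_right (by omega))))
    · have aux : ∀ a ∈ I, ∀ b ∈ I, a / R = b / R → ¬ a < b := by
        intro a ha b hb hab hlt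
        have := (Finset.mem_filter.1 ha).2 b (Finset.mem_filter.1 hb).1 hlt
        have h1 := Nat.div_add_mod a R
        have h2 := Nat.div_add_mod b R
        have h3 := Nat.mod_lt b hR
        rw [hab] at h1
        omega
      intro a ha b hb hab
      have h1 := aux a ha b hb hab
      have h2 := aux b hb a ha hab.symm
      omega
  have hU : (B.biUnion fun k => Finset.Ico (k - R) k).card ≤ R * B.card := by
    refine (Finset.card_biUnion_le_card_mul _ _ R fun k _ => ?_).trans (mul_comm _ _).le
    rw [Nat.card_Ico]
    omega
  have hAc : A.card ≤ G.card + ((B.card + R * B.card) + (m / R + 1)) := by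
    refine (Finset.card_le_card hcover).trans ((Finset.card_union_le _ _).trans ?_)
    refine Nat.add_le_add_left ((Finset.card_union_le _ _).trans ?_) _
    refine Nat.add_le_add ((Finset.card_union_le _ _).trans ?_) hIcard
    exact Nat.add_le_add_left hU _
  have : (R + 1) * B.card = B.card + R * B.card := by ring
  omega

/-- Contacts are controlled by contacts with bounded neighbours and large second differences. -/
lemma contact_le_pathFunctional {m : ℕ} (φ : Fin (m + 1 - 1) → ℝ) (R : ℕ) (hR : 0 < R) {L : ℝ}
    (hL : 0 ≤ L) :
    (contact (m + 1) φ : ℝ) ≤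
      pathFunctional (m := m) (fun _ a b c =>
        if b = 0 ∧ |a| ≤ (R + 1) * L ∧ |c| ≤ (R + 1) * L then 1 else 0) φ +
      (R + 1) * pathFunctional (m := m) (fun _ a b c =>
        if L < |c + a - 2 * b| then 1 else 0) φ + (m : ℝ) / R + 2 := by
  classical
  have key := card_zeros_le (pathSeq 0 0 (m := m) φ) m R hR hL
  simp only [Finset.card_filter] at key
  have hc : ((∑ n ∈ Finset.range (m + 1), if pathSeq 0 0 (m := m) φ (n + 2) = 0
      then 1 else 0 : ℕ) : ℝ) ≤ _ :=
    Nat.cast_le.2 key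
  have hdiv : ((m / R : ℕ) : ℝ) ≤ (m : ℝ) / R := Nat.cast_div_le
  rw [contact_eq_sum, pathFunctional, pathFunctional]
  push_cast at hc ⊢
  linarith

lemma measurable_ite_good (L u : ℝ) : Measurable fun p : ℝ × ℝ × ℝ =>
    if p.2.1 = 0 ∧ |p.1| ≤ L ∧ |p.2.2| ≤ L then u else 0 := by
  refine Measurable.ite ?_ measurable_const measurable_const
  refine MeasurableSet.inter (measurableSet_eq_fun (f := fun p : ℝ × ℝ × ℝ => p.2.1)
    (by fun_prop) measurable_const) (MeasurableSet.inter ?_ ?_)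
  · exact measurableSet_le (f := fun p : ℝ × ℝ × ℝ => |p.1|) (by fun_prop) measurable_const
  · exact measurableSet_le (f := fun p : ℝ × ℝ × ℝ => |p.2.2|) (by fun_prop) measurable_const

lemma contact_eq_pathFunctional {m : ℕ} (φ : Fin (m + 1 - 1) → ℝ) :
    (contact (m + 1) φ : ℝ) =
      pathFunctional (m := m) (fun _ _ _ c => if c = 0 then 1 else 0) φ := by
  rw [contact_eq_sum, pathFunctional]
  push_cast
  rfl

lemma measurable_ite_contact (u : ℝ) : Measurable fun p : ℝ × ℝ × ℝ =>
    if p.2.2 = 0 then u else 0 :=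
  Measurable.ite (measurableSet_eq_fun (by fun_prop) (by fun_prop)) measurable_const
    measurable_const

lemma pathFunctional_add (ξ ζ : ℕ → ℝ → ℝ → ℝ → ℝ) {m : ℕ} (φ : Fin m → ℝ) :
    pathFunctional (fun n a b c => ξ n a b c + ζ n a b c) φ =
      pathFunctional ξ φ + pathFunctional ζ φ := Finset.sum_add_distrib

lemma pathFunctional_ite_const (p : ℝ → ℝ → ℝ → Prop) [∀ a b c, Decidable (p a b c)] (u : ℝ)
    {m : ℕ} (φ : Fin m → ℝ) :
    pathFunctional (fun _ a b c => if p a b c then u else 0) φ =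
      u * pathFunctional (fun _ a b c => if p a b c then 1 else 0) φ := by
  rw [pathFunctional, pathFunctional, Finset.mul_sum]
  refine Finset.sum_congr rfl fun n _ => ?_
  split_ifs <;> simp

lemma integral_le_of_le_add_mul_add {Ω : Type*} [MeasurableSpace Ω] {μ : Measure Ω}
    [IsProbabilityMeasure μ] {f g u : Ω → ℝ} {k w : ℝ} (hf : Integrable f μ) (hg : Integrable g μ)
    (hu : Integrable u μ) (hle : ∀ x, f x ≤ g x + k * u x + w) :
    ∫ x, f x ∂μ ≤ ∫ x, g x ∂μ + k * ∫ x, u x ∂μ + w := by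
  refine (integral_mono hf ((hg.add (hu.const_mul k)).add (integrable_const w)) hle).trans_eq ?_
  rw [integral_add' (hg.add (hu.const_mul k)) (integrable_const w),
    integral_add' hg (hu.const_mul k), integral_const_mul, integral_const]
  simp

namespace IsBoundedDensity

variable {E : ℝ → ℝ} {M : ℝ}

lemma integrable_contact (h : IsBoundedDensity E M) {ε : ℝ} (hε : 0 < ε) (m : ℕ) :
    Integrable (fun φ => (contact (m + 1) φ : ℝ)) (Ppin E ε (m + 1)) := by
  simp only [contact_eq_pathFunctional]
  exact h.integrable_pathFunctional hε m (fun _ => measurable_ite_contact 1) (C := 1)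
    (fun n a b c => by split_ifs <;> simp)

lemma integral_contact_le (h : IsBoundedDensity E M) {ε : ℝ} (hε : 0 < ε) (m : ℕ) :
    ∫ φ, (contact (m + 1) φ : ℝ) ∂(Ppin E ε (m + 1)) ≤ m + 1 := by
  have := h.isProbabilityMeasure_Ppin hε m
  have hle : ∀ φ : Fin (m + 1 - 1) → ℝ, (contact (m + 1) φ : ℝ) ≤ m + 1 := by
    intro φ
    rw [contact_eq_pathFunctional]
    refine (le_abs_self _).trans ((abs_pathFunctional_le (C := 1) ?_ _).trans (by simp))
    intro n a b c
    split_ifs <;> simp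
  refine (integral_mono (h.integrable_contact hε m) (integrable_const _) hle).trans ?_
  simp

/-- Lower bound on the tilted partition function at strength `ε'` through the model at `ε`. -/
lemma mul_exp_le_tiltSum (h : IsBoundedDensity E M) {ε ε' κ : ℝ} (hε : 0 < ε) (hε' : 0 < ε')
    (hκ : 0 ≤ κ) (L : ℝ) (m : ℕ) :
    ENNReal.ofReal (Zpin E ε (m + 1)) * ENNReal.ofReal (Real.exp (
      Real.log (1 + κ) * (∫ φ, pathFunctional (m := m)
        (fun _ a b c => if b = 0 ∧ |a| ≤ L ∧ |c| ≤ L then 1 else 0) φ ∂(Ppin E ε (m + 1))) +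
      Real.log (ε' / ε) * ∫ φ, (contact (m + 1) φ : ℝ) ∂(Ppin E ε (m + 1)))) ≤
    ENNReal.ofReal (ε' / ε) * tiltSum E ε' (ENNReal.ofReal κ) L m 0 0 := by
  have hr : 0 < ε' / ε := div_pos hε' hε
  have key := h.jensen hε m
    (ξ := fun _ a b c => (if b = 0 ∧ |a| ≤ L ∧ |c| ≤ L then Real.log (1 + κ) else 0) +
      if c = 0 then Real.log (ε' / ε) else 0)
    (fun n => (measurable_ite_good L _).add (measurable_ite_contact _))
    (C := |Real.log (1 + κ)| + |Real.log (ε' / ε)|)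
    (fun n a b c => by
      refine (abs_add_le _ _).trans (add_le_add ?_ ?_) <;> split_ifs <;> simp)
  have e1 : ∀ φ : Fin (m + 1 - 1) → ℝ, pathFunctional (m := m)
      (fun _ a b c => (if b = 0 ∧ |a| ≤ L ∧ |c| ≤ L then Real.log (1 + κ) else 0) +
      if c = 0 then Real.log (ε' / ε) else 0) φ =
      Real.log (1 + κ) * pathFunctional (m := m)
        (fun _ a b c => if b = 0 ∧ |a| ≤ L ∧ |c| ≤ L then 1 else 0) φ +
        Real.log (ε' / ε) * (contact (m + 1) φ : ℝ) := by
    intro φ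
    rw [pathFunctional_add
      (fun _ a b c => if b = 0 ∧ |a| ≤ L ∧ |c| ≤ L then Real.log (1 + κ) else 0)
      (fun _ _ _ c => if c = 0 then Real.log (ε' / ε) else 0),
      pathFunctional_ite_const (fun a b c => b = 0 ∧ |a| ≤ L ∧ |c| ≤ L),
      pathFunctional_ite_const (fun _ _ c => c = 0), contact_eq_pathFunctional]
  have e2 : (fun (_ : ℕ) (a b c : ℝ) => lapWeight E a b c *
      ENNReal.ofReal (Real.exp ((if b = 0 ∧ |a| ≤ L ∧ |c| ≤ L then Real.log (1 + κ) else 0) +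
      if c = 0 then Real.log (ε' / ε) else 0))) =
      (fun (_ : ℕ) (a b c : ℝ) => tiltWeight E (ENNReal.ofReal κ) L a b c *
        ENNReal.ofReal (if c = 0 then ε' / ε else 1)) := by
    funext n a b c
    rw [Real.exp_add, ENNReal.ofReal_mul (Real.exp_pos _).le, ← mul_assoc, tiltWeight]
    congr 2
    · split_ifs
      · rw [Real.exp_log (by linarith), ENNReal.ofReal_add zero_le_one hκ, ENNReal.ofReal_one]
      · simp
    · split_ifs
      · rw [Real.exp_log hr]
      · rw [Real.exp_zero]
  simp only [e1] at key
  rw [e2, pathSum_pinFactor_tilt hε, integral_add, integral_const_mul, integral_const_mul] at key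
  · exact key
  · exact (h.integrable_pathFunctional hε m (fun _ => measurable_ite_good L 1) (C := 1)
      (fun n a b c => by split_ifs <;> simp)).const_mul _
  · exact (h.integrable_contact hε m).const_mul _

/-- A positive contact fraction forces a positive fraction of contacts with bounded neighbours. -/
lemma exists_integral_good_ge (h : IsBoundedDensity E M) {ρ ε₁ : ℝ} (hρ : 0 < ρ) (hε₁ : 0 < ε₁) :
    ∃ L : ℝ, 0 ≤ L ∧ ∀ ε, 0 < ε → ε ≤ ε₁ → ∀ᶠ m : ℕ in atTop,
      -((m : ℝ) + 1) ≤ Real.log (Zpin E ε (m + 1)) →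
      ρ * (m + 1) ≤ ∫ φ, (contact (m + 1) φ : ℝ) ∂(Ppin E ε (m + 1)) →
      ρ / 2 * (m + 1) ≤ ∫ φ, pathFunctional (m := m)
        (fun _ a b c => if b = 0 ∧ |a| ≤ L ∧ |c| ≤ L then 1 else 0) φ ∂(Ppin E ε (m + 1)) := by
  obtain ⟨R, hR⟩ := exists_nat_gt (8 / ρ)
  have hR0 : (0 : ℝ) < R := lt_trans (by positivity) hR
  obtain ⟨L, hL0, hL⟩ := h.exists_integral_big_le (ζ := ρ / (8 * (R + 1))) (by positivity) hε₁
  refine ⟨(R + 1) * L, by positivity, fun ε hε hεle => ?_⟩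
  obtain ⟨m₀, hm₀⟩ := exists_nat_ge (16 / ρ)
  filter_upwards [hL ε hε hεle, eventually_ge_atTop m₀] with m hbig hm hZ hc
  have hbig := hbig hZ
  have := h.isProbabilityMeasure_Ppin hε m
  have ig := h.integrable_pathFunctional hε m
    (ξ := fun _ a b c => if b = 0 ∧ |a| ≤ (R + 1) * L ∧ |c| ≤ (R + 1) * L then 1 else 0)
    (fun _ => measurable_ite_good ((R + 1) * L) 1)
    (C := 1) (fun n a b c => by split_ifs <;> simp)
  have ib := h.integrable_pathFunctional hε m
    (ξ := fun _ a b c => if L < |c + a - 2 * b| then 1 else 0)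
    (fun n => measurable_ite_lt_abs (f := fun p : ℝ × ℝ × ℝ => p.2.2 + p.1 - 2 * p.2.1)
      (by fun_prop) measurable_const measurable_const L)
    (C := 1) (fun n a b c => by split_ifs <;> simp)
  have hmono := integral_le_of_le_add_mul_add (h.integrable_contact hε m) ig ib
    (k := (R : ℝ) + 1) (w := (m : ℝ) / R + 2)
    (fun φ => (contact_le_pathFunctional φ R (by exact_mod_cast hR0) hL0).trans_eq
      (add_assoc _ _ _))
  have hb : ((R : ℝ) + 1) * (∫ φ, pathFunctional (m := m)
      (fun _ a b c => if L < |c + a - 2 * b| then 1 else 0) φ ∂(Ppin E ε (m + 1))) ≤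
      ρ / 8 * (m + 1) := by
    calc _ ≤ ((R : ℝ) + 1) * (ρ / (8 * (R + 1)) * (m + 1)) := by gcongr
      _ = _ := by field_simp
  have hmR : (m : ℝ) / R ≤ ρ / 8 * (m + 1) := by
    rw [div_lt_iff₀ hρ] at hR
    rw [div_le_iff₀ hR0]
    nlinarith [m.cast_nonneg (α := ℝ)]
  have hm2 : 2 ≤ ρ / 8 * ((m : ℝ) + 1) := by
    have : (m₀ : ℝ) ≤ m := Nat.cast_le.2 hm
    rw [div_le_iff₀ hρ] at hm₀
    nlinarith
  linarith

/-- The free energy at `ε + δ` is `o(δ)` if it vanishes at `ε`. -/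
lemma exists_not_eventually_le_log_Zpin (h : IsBoundedDensity E M) {σ : ℝ} (hσ : 0 < σ)
    (hmean : ∫ x, x * E x = 0) (hvar : ∫ x, x ^ 2 * E x = σ ^ 2)
    {ε₀ : ℝ} (hε₀ : 0 < ε₀)
    (hZ : ∀ γ > 0, ∀ᶠ N : ℕ in atTop, Real.log (Zpin E ε₀ N) ≤ γ * N) {η : ℝ} (hη : 0 < η) :
    ∃ α : ℝ, 0 < α ∧ ∀ δ, 0 < δ → δ ≤ α →
      ¬ ∀ᶠ N : ℕ in atTop, η * δ * N ≤ Real.log (Zpin E (ε₀ + δ) N) := by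
  set ρ := η * ε₀ / 2 with hρ
  have hρ0 : 0 < ρ := by positivity
  obtain ⟨L, hL0, hL⟩ := h.exists_integral_good_ge hρ0 (by linarith : 0 < ε₀ + 1)
  set B := 4 / (η * ρ * ε₀) with hB
  have hB0 : 0 < B := by positivity
  obtain ⟨l₀, hl₀, hl⟩ := h.exists_sum_tiltSum_le hσ hmean hvar hε₀ hZ hL0 hB0
  refine ⟨min 1 (min (l₀ / η) (1 / (B * η))), by positivity, fun δ hδ hδα hcon => ?_⟩
  have hδ1 : δ ≤ 1 := hδα.trans (min_le_left _ _)
  have hδ2 : η * δ ≤ l₀ := by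
    have := (hδα.trans (min_le_right _ _)).trans (min_le_left _ _)
    rw [le_div_iff₀ hη] at this
    linarith
  have hδ3 : B * (η * δ) ≤ 1 := by
    have := (hδα.trans (min_le_right _ _)).trans (min_le_right _ _)
    rw [le_div_iff₀ (by positivity)] at this
    linarith
  set l := η * δ with hl_def
  have hlpos : 0 < l := by positivity
  set ε := ε₀ + δ with hε_def
  have hε : 0 < ε := by positivity
  obtain ⟨C, hC, hsum⟩ := hl l hlpos hδ2
  have hs : Real.log (ε₀ / ε) = -Real.log (ε / ε₀) := by
    rw [← Real.log_inv, inv_div]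
  set s := Real.log (ε / ε₀) with hs_def
  have hs0 : 0 < s := Real.log_pos (by rw [one_lt_div hε₀]; linarith)
  have hs1 : s ≤ δ / ε₀ := by
    have := Real.log_le_sub_one_of_pos (div_pos hε hε₀)
    refine this.trans (le_of_eq ?_)
    rw [hε_def]
    field_simp
    ring
  have hcon' := (tendsto_add_atTop_nat 1).eventually hcon
  have hZ' := (tendsto_add_atTop_nat 1).eventually (hZ (l / 2) (by positivity))
  have hlarge : ∀ᶠ m : ℕ in atTop, 1 ≤ ENNReal.ofReal (Real.exp (-l * ((m + 1 : ℕ) : ℝ))) *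
      tiltSum E ε₀ (ENNReal.ofReal (B * l)) L m 0 0 := by
    filter_upwards [hcon', hZ', hL ε hε (by linarith)] with m h1 h2 h3
    push_cast at h1 h2 ⊢
    set Cn := ∫ φ, (contact (m + 1) φ : ℝ) ∂(Ppin E ε (m + 1)) with hCn
    have hCle : Cn ≤ m + 1 := h.integral_contact_le hε m
    have hm0 : (0 : ℝ) < m + 1 := by positivity
    have hcomp := h.contact_mul_log_le hε hε₀ m
    rw [hs, ← hCn] at hcomp
    have hCn_ge : ρ * (m + 1) ≤ Cn := by
      have h4 : l / 2 * (m + 1) ≤ Cn * s := by nlinarith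
      have hCn0 : 0 ≤ Cn := integral_contact_nonneg E ε (m + 1)
      have h5 : Cn * s ≤ Cn * (δ / ε₀) := by gcongr
      have h6 : ρ * (m + 1) * (δ / ε₀) ≤ Cn * (δ / ε₀) := by
        refine le_trans (le_of_eq ?_) (h4.trans h5)
        rw [hρ, hl_def]
        field_simp
      exact le_of_mul_le_mul_right h6 (by positivity)
    have hG := h3 (by nlinarith) hCn_ge
    have hjen := h.mul_exp_le_tiltSum hε hε₀ (κ := B * l) (by positivity) L m
    rw [hs, ← hCn] at hjen
    set G := ∫ φ, pathFunctional (m := m)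
        (fun _ a b c => if b = 0 ∧ |a| ≤ L ∧ |c| ≤ L then 1 else 0) φ ∂(Ppin E ε (m + 1)) with hGd
    have hκ0 : 0 < B * l := by positivity
    have hlog : B * l / 2 ≤ Real.log (1 + B * l) := by
      have := Real.one_sub_inv_le_log_of_pos (by positivity : 0 < 1 + B * l)
      refine le_trans ?_ this
      rw [show 1 - (1 + B * l)⁻¹ = B * l / (1 + B * l) by field_simp; ring]
      gcongr
      linarith
    have hexp : 0 ≤ Real.log (1 + B * l) * G + -s * Cn := by
      have h7 : B * l / 2 * (ρ / 2 * (m + 1)) ≤ Real.log (1 + B * l) * G := by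
        refine mul_le_mul hlog hG (by positivity) (by linarith)
      have h8 : s * Cn ≤ δ / ε₀ * (m + 1) := by
        refine mul_le_mul hs1 hCle (integral_contact_nonneg E ε (m + 1)) (by positivity)
      have h9 : B * l / 2 * (ρ / 2 * (m + 1)) = δ / ε₀ * (m + 1) := by
        rw [hB, hl_def]
        field_simp
        ring
      linarith
    have hZexp : Real.exp (l * (m + 1)) ≤ Zpin E ε (m + 1) := by
      rw [← Real.exp_log (h.Zpin_pos hε m)]
      exact Real.exp_le_exp.2 h1
    have hT : ENNReal.ofReal (Real.exp (l * (m + 1))) ≤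
        tiltSum E ε₀ (ENNReal.ofReal (B * l)) L m 0 0 := by
      calc ENNReal.ofReal (Real.exp (l * (m + 1))) = ENNReal.ofReal (Real.exp (l * (m + 1))) * 1 :=
            (mul_one _).symm
        _ ≤ ENNReal.ofReal (Zpin E ε (m + 1)) *
            ENNReal.ofReal (Real.exp (Real.log (1 + B * l) * G + -s * Cn)) := by
            refine mul_le_mul' (ENNReal.ofReal_le_ofReal hZexp) ?_
            rw [← ENNReal.ofReal_one]
            exact ENNReal.ofReal_le_ofReal (Real.one_le_exp hexp)
        _ ≤ _ := hjen
        _ ≤ 1 * tiltSum E ε₀ (ENNReal.ofReal (B * l)) L m 0 0 := by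
            refine mul_le_mul_left ?_ _
            rw [← ENNReal.ofReal_one]
            refine ENNReal.ofReal_le_ofReal ((div_le_one hε).2 (by linarith))
        _ = _ := one_mul _
    calc (1 : ℝ≥0∞) = ENNReal.ofReal (Real.exp (-l * (m + 1))) *
          ENNReal.ofReal (Real.exp (l * (m + 1))) := by
          rw [← ENNReal.ofReal_mul (Real.exp_pos _).le, ← Real.exp_add]
          simp
      _ ≤ _ := mul_le_mul_right hT _
  obtain ⟨m₀, hm₀⟩ := eventually_atTop.1 hlarge
  obtain ⟨J, hJ⟩ := ENNReal.exists_nat_gt hC.ne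
  have h1 := hsum (m₀ + J)
  rw [Finset.sum_range_add] at h1
  have h2 : (J : ℝ≥0∞) ≤ ∑ x ∈ Finset.range J, ENNReal.ofReal
      (Real.exp (-l * ((m₀ + x + 1 : ℕ) : ℝ))) *
        tiltSum E ε₀ (ENNReal.ofReal (B * l)) L (m₀ + x) 0 0 := by
    calc (J : ℝ≥0∞) = ∑ _x ∈ Finset.range J, 1 := by simp
      _ ≤ _ := Finset.sum_le_sum fun x _ => hm₀ _ (by omega)
  exact absurd ((h2.trans le_add_self).trans h1) (not_le.2 hJ)

end IsBoundedDensity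

section FreeEnergy

variable {E : ℝ → ℝ} {ε γ : ℝ} {f : EReal}

lemma eventually_log_Zpin_le
    (hf : Tendsto (fun N : ℕ => (((N : ℝ)⁻¹ * Real.log (Zpin E ε N) : ℝ) : EReal)) atTop (𝓝 f))
    (hγ : f < (γ : EReal)) : ∀ᶠ N : ℕ in atTop, Real.log (Zpin E ε N) ≤ γ * N := by
  filter_upwards [hf.eventually (gt_mem_nhds hγ), eventually_ge_atTop 1] with N hN hN1
  have hN0 : (0 : ℝ) < N := Nat.cast_pos.2 hN1
  have := EReal.coe_lt_coe_iff.1 hN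
  rw [inv_mul_lt_iff₀ hN0] at this
  linarith

lemma eventually_le_log_Zpin
    (hf : Tendsto (fun N : ℕ => (((N : ℝ)⁻¹ * Real.log (Zpin E ε N) : ℝ) : EReal)) atTop (𝓝 f))
    (hγ : (γ : EReal) < f) : ∀ᶠ N : ℕ in atTop, γ * N ≤ Real.log (Zpin E ε N) := by
  filter_upwards [hf.eventually (lt_mem_nhds hγ), eventually_ge_atTop 1] with N hN hN1
  have hN0 : (0 : ℝ) < N := Nat.cast_pos.2 hN1
  have := EReal.coe_lt_coe_iff.1 hN
  rw [lt_inv_mul_iff₀ hN0] at this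
  linarith

end FreeEnergy

namespace IsBoundedDensity

variable {E : ℝ → ℝ} {M : ℝ}

/-- The free energy vanishes at the critical point. -/
lemma eventually_log_Zpin_critical_le (h : IsBoundedDensity E M) {Fp : ℝ → EReal}
    (hFp : ∀ ε : ℝ, 0 ≤ ε → Tendsto
      (fun N : ℕ => (((N : ℝ)⁻¹ * Real.log (Zpin E ε N) : ℝ) : EReal)) atTop (𝓝 (Fp ε)))
    {εc : ℝ} (hεc : IsLUB {ε : ℝ | 0 < ε ∧ Fp ε = 0} εc) (hεc0 : 0 < εc) {γ : ℝ} (hγ : 0 < γ) :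
    ∀ᶠ N : ℕ in atTop, Real.log (Zpin E εc N) ≤ γ * N := by
  have hlt : εc * Real.exp (-(γ / 2)) < εc := by
    have : Real.exp (-(γ / 2)) < 1 := Real.exp_lt_one_iff.2 (by linarith)
    nlinarith
  obtain ⟨ε₁, ⟨hε₁, hF⟩, hgt, hle⟩ := hεc.exists_between hlt
  have hev := eventually_log_Zpin_le (hFp ε₁ hε₁.le) (γ := γ / 2)
    (by rw [hF]; exact_mod_cast (by positivity : (0 : ℝ) < γ / 2))
  filter_upwards [hev, eventually_ge_atTop 1] with N hN hN1
  obtain ⟨m, rfl⟩ : ∃ m, N = m + 1 := ⟨N - 1, by omega⟩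
  have hcmp := h.contact_mul_log_le hεc0 hε₁ m
  have hC1 := h.integral_contact_le hεc0 m
  have hC0 := integral_contact_nonneg E εc (m + 1)
  set Cn := ∫ φ, (contact (m + 1) φ : ℝ) ∂(Ppin E εc (m + 1))
  have hl0 : Real.log (ε₁ / εc) ≤ 0 :=
    Real.log_nonpos (by positivity) ((div_le_one hεc0).2 hle)
  have hl1 : -(γ / 2) ≤ Real.log (ε₁ / εc) := by
    rw [Real.le_log_iff_exp_le (by positivity), le_div_iff₀ hεc0]
    linarith
  push_cast at hN ⊢
  nlinarith [mul_le_mul_of_nonneg_left hl1 hC0]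

end IsBoundedDensity

/-- **Theorem 1.4**, first part (Critical pinning model).  The contact fraction vanishes
continuously at the critical point:
`limsup_{ε ↓ ε_c^p} limsup_{N→∞} (1/N) E^p_{ε,N}[ℓ_N] = 0`. -/
theorem critical_pinning_contact_fraction_vanishes
    (E : ℝ → ℝ) (σ : ℝ)
    (hE_nonneg : ∀ x, 0 ≤ E x) (hE_cont : Continuous E)
    (hE_bdd : ∃ M, ∀ x, E x ≤ M) (hE_pos : 0 < E 0)
    (hE_int : Integrable E) (hE_mass : ∫ x, E x = 1)
    (hE_mom1 : Integrable fun x => x * E x) (hE_mean : ∫ x, x * E x = 0)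
    (hE_mom2 : Integrable fun x => x ^ 2 * E x) (hE_var : ∫ x, x ^ 2 * E x = σ ^ 2)
    (hσ : 0 < σ)
    (Fp : ℝ → EReal)
    (hFp_nonneg : ∀ ε : ℝ, 0 ≤ ε → 0 ≤ Fp ε)
    (hFp : ∀ ε : ℝ, 0 ≤ ε → Tendsto
      (fun N : ℕ => (((N : ℝ)⁻¹ * Real.log (Zpin E ε N) : ℝ) : EReal)) atTop (𝓝 (Fp ε)))
    (εcp : ℝ) (hεcp : IsLUB {ε : ℝ | 0 < ε ∧ Fp ε = 0} εcp) (hεcp_pos : 0 < εcp) :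
    ∀ η : ℝ, 0 < η → ∃ α : ℝ, 0 < α ∧ ∀ ε : ℝ, εcp < ε → ε ≤ εcp + α →
      Filter.limsup
        (fun N : ℕ => (∫ φ, (contact N φ : ℝ) ∂(Ppin E ε N)) / (N : ℝ)) atTop ≤ η := by
  intro η hη
  obtain ⟨M, hM⟩ := hE_bdd
  have h : IsBoundedDensity E M := ⟨hE_nonneg, hE_cont, hM, hE_pos, hE_int, hE_mass⟩
  have hZ : ∀ γ > 0, ∀ᶠ N : ℕ in atTop, Real.log (Zpin E εcp N) ≤ γ * N := fun γ hγ =>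
    h.eventually_log_Zpin_critical_le hFp hεcp hεcp_pos hγ
  set η' := η / (30 * εcp) with hη'
  have hη'0 : 0 < η' := by positivity
  obtain ⟨α₀, hα₀, hα⟩ :=
    h.exists_not_eventually_le_log_Zpin hσ hE_mean hE_var hεcp_pos hZ hη'0
  set α := min (α₀ / 2) εcp with hα_def
  have hα0 : 0 < α := by positivity
  have hα1 : 2 * α ≤ α₀ := by linarith [min_le_left (α₀ / 2) εcp]
  have hα2 : α ≤ εcp := min_le_right _ _
  have hFle : Fp (εcp + 2 * α) ≤ ((η' * (2 * α) : ℝ) : EReal) := by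
    by_contra hc
    exact hα (2 * α) (by positivity) hα1
      (eventually_le_log_Zpin (hFp (εcp + 2 * α) (by positivity)) (not_le.1 hc))
  refine ⟨α, hα0, fun ε hε1 hε2 => ?_⟩
  have hε : 0 < ε := hεcp_pos.trans hε1
  set ε' := εcp + 2 * α with hε'_def
  have hε' : 0 < ε' := by positivity
  have hup := eventually_log_Zpin_le (hFp ε' hε'.le) (γ := 4 * (η' * α))
    (hFle.trans_lt (EReal.coe_lt_coe_iff.2 (by nlinarith [mul_pos hη'0 hα0])))
  have hlow := eventually_le_log_Zpin (hFp ε hε.le) (γ := -(η' * α))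
    (lt_of_lt_of_le (by exact_mod_cast neg_lt_zero.2 (mul_pos hη'0 hα0)) (hFp_nonneg ε hε.le))
  have hs : α / (3 * εcp) ≤ Real.log (ε' / ε) := by
    refine le_trans ?_ (Real.one_sub_inv_le_log_of_pos (div_pos hε' hε))
    rw [inv_div, one_sub_div hε'.ne']
    exact div_le_div₀ (by linarith) (by linarith) hε' (by linarith)
  obtain ⟨N₀, hN₀⟩ := exists_nat_ge (2 / η)
  refine limsup_le_of_le (isCoboundedUnder_le_of_le _ (x := 0) fun N =>
    div_nonneg (IsBoundedDensity.integral_contact_nonneg E ε N) N.cast_nonneg) ?_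
  filter_upwards [hup, hlow, eventually_ge_atTop 1, eventually_ge_atTop N₀] with N h1 h2 hN1 hNN
  obtain ⟨m, rfl⟩ : ∃ m, N = m + 1 := ⟨N - 1, by omega⟩
  have hN0 : (0 : ℝ) < ((m + 1 : ℕ) : ℝ) := by positivity
  rw [div_le_iff₀ hN0]
  have hcmp := h.contact_mul_log_le hε hε' m
  set Cn := ∫ φ, (contact (m + 1) φ : ℝ) ∂(Ppin E ε (m + 1)) with hCn
  rcases le_or_gt Cn 1 with hC1 | hC1
  · have : (N₀ : ℝ) ≤ ((m + 1 : ℕ) : ℝ) := Nat.cast_le.2 hNN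
    rw [div_le_iff₀ hη] at hN₀
    nlinarith
  · have h3 : (Cn - 1) * (α / (3 * εcp)) ≤ 5 * (η' * α) * ((m + 1 : ℕ) : ℝ) := by
      refine (mul_le_mul_of_nonneg_left hs (by linarith)).trans ?_
      linarith
    have h4 : 5 * (η' * α) * ((m + 1 : ℕ) : ℝ) =
        (η / 2 * ((m + 1 : ℕ) : ℝ)) * (α / (3 * εcp)) := by
      rw [hη']
      field_simp
      norm_num
    rw [h4] at h3
    have h5 := le_of_mul_le_mul_right h3 (by positivity)
    have : (N₀ : ℝ) ≤ ((m + 1 : ℕ) : ℝ) := Nat.cast_le.2 hNN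
    rw [div_le_iff₀ hη] at hN₀
    nlinarith
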